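/- Let Ω ⊂ ℝ² be a bounded, open, connected set with Lipschitz boundary and let u ∈ W^{1,1}(Ω;S¹). Then the relaxed area of the graph of u is finite and satisfies 𝒜(u,Ω) ≤ ∫_Ω √(1 + |∇u|²) dx + ‖Det(∇u)‖_{flat,α}. -/

import Mathlib

open MeasureTheory Metric Filter Set
open scoped ENNReal NNReal Topology Classical

noncomputable section

abbrev R2 := EuclideanSpace ℝ (Fin 2)

/-- `Ω ⊂ ℝ²` has Lipschitz boundary: near every boundary point, after a rigid motion,
`Ω` coincides with the open region strictly above the graph of a Lipschitz function. -/
def HasLipschitzBoundary (Ω : Set R2) : Prop :=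
  ∀ p ∈ frontier Ω, ∃ r : ℝ, 0 < r ∧ ∃ (f : R2 ≃ᵢ R2) (γ : ℝ → ℝ) (L : ℝ≥0),
    LipschitzWith L γ ∧ ∀ x ∈ Metric.ball p r, (x ∈ Ω ↔ γ (f x 0) < f x 1)

/-- `G` is the weak (distributional) gradient of `u` on `Ω`:
`∫_Ω u_i ∂_j φ = -∫_Ω G_{ij} φ` for all test functions `φ ∈ C_c^∞(Ω)`. -/
def IsWeakGradient (Ω : Set R2) (u : R2 → R2) (G : R2 → Matrix (Fin 2) (Fin 2) ℝ) : Prop :=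
  ∀ φ : R2 → ℝ, ContDiff ℝ (⊤ : ℕ∞) φ → HasCompactSupport φ → tsupport φ ⊆ Ω →
    ∀ i j : Fin 2,
      (∫ x in Ω, u x i * fderiv ℝ φ x (EuclideanSpace.single j 1)) =
        - ∫ x in Ω, G x i j * φ x

/-- `u ∈ W^{1,1}(Ω;ℝ²)` with weak gradient `G`. -/
def MemW11 (Ω : Set R2) (u : R2 → R2) (G : R2 → Matrix (Fin 2) (Fin 2) ℝ) : Prop :=
  IntegrableOn u Ω ∧ (∀ i j : Fin 2, IntegrableOn (fun x => G x i j) Ω) ∧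
    IsWeakGradient Ω u G

/-- `|u| = 1` a.e. in `Ω`. -/
def SphereValued (Ω : Set R2) (u : R2 → R2) : Prop :=
  ∀ᵐ x ∂(volume.restrict Ω), ‖u x‖ = 1

/-- Frobenius norm of a `2×2` matrix. -/
def frob (M : Matrix (Fin 2) (Fin 2) ℝ) : ℝ :=
  Real.sqrt (∑ i, ∑ j, (M i j) ^ 2)

/-- Jacobian matrix of a map `v : ℝ² → ℝ²`. -/
def jacobianMatrix (v : R2 → R2) (x : R2) : Matrix (Fin 2) (Fin 2) ℝ :=
  Matrix.of fun i j => fderiv ℝ v x (EuclideanSpace.single j 1) i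

/-- Classical graph area `A(v,A) = ∫_A √(1 + |∇v|² + (Jv)²)` of a `C¹` map. -/
def classicalArea (A : Set R2) (v : R2 → R2) : ℝ≥0∞ :=
  ∫⁻ x in A, ENNReal.ofReal
    (Real.sqrt (1 + (∑ i, ∑ j, (jacobianMatrix v x i j) ^ 2) + (jacobianMatrix v x).det ^ 2))

/-- `L¹`-relaxed area functional `𝒜(u,A)`. -/
def relaxedArea (u : R2 → R2) (A : Set R2) : ℝ≥0∞ :=
  sInf { a : ℝ≥0∞ | ∃ v : ℕ → R2 → R2,
    (∀ k, ContDiffOn ℝ 1 (v k) A) ∧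
    (∀ k, IntegrableOn (fun x => v k x - u x) A) ∧
    Tendsto (fun k => ∫ x in A, ‖v k x - u x‖) atTop (nhds 0) ∧
    a = Filter.liminf (fun k => classicalArea A (v k)) atTop }

/-- `λ_u = (1/2)(u₁ ∇^⊥u₂ − u₂ ∇^⊥u₁)`, computed from the weak gradient `G`. -/
def lambdaVec (u : R2 → R2) (G : R2 → Matrix (Fin 2) (Fin 2) ℝ) (x : R2) : Fin 2 → ℝ :=
  ![ (1 / 2) * (-(u x 0) * G x 1 1 + u x 1 * G x 0 1),
     (1 / 2) * (u x 0 * G x 1 0 - u x 1 * G x 0 0) ]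

/-- Distributional Jacobian pairing `⟨Det(∇u), φ⟩ = ∫_Ω λ_u · ∇φ`. -/
def detPairing (Ω : Set R2) (u : R2 → R2) (G : R2 → Matrix (Fin 2) (Fin 2) ℝ)
    (φ : R2 → ℝ) : ℝ :=
  ∫ x in Ω, ∑ j, lambdaVec u G x j * fderiv ℝ φ x (EuclideanSpace.single j 1)

/-- `φ ∈ Lip₀(Ω)`: Lipschitz on `cl(Ω)` and vanishing on `∂Ω`. -/
def MemLip0 (Ω : Set R2) (φ : R2 → ℝ) : Prop :=
  (∃ L : ℝ≥0, LipschitzOnWith L φ (closure Ω)) ∧ ∀ p ∈ frontier Ω, φ p = 0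

/-- Admissible test functions for the flat norm: Lipschitz constant `≤ L` on `cl(Ω)`,
vanishing on `Z`, and bounded by `1` on `cl(Ω)`. -/
def FlatAdmissible (Ω Z : Set R2) (L : ℝ≥0) (φ : R2 → ℝ) : Prop :=
  LipschitzOnWith L φ (closure Ω) ∧ (∀ p ∈ Z, φ p = 0) ∧ ∀ p ∈ closure Ω, |φ p| ≤ 1

/-- Flat norm of a functional `F`, with vanishing condition on the set `Z`. -/
def flatNormOn (Ω Z : Set R2) (L : ℝ≥0) (F : (R2 → ℝ) → ℝ) : ℝ≥0∞ :=
  ⨆ φ ∈ {φ : R2 → ℝ | FlatAdmissible Ω Z L φ}, ENNReal.ofReal (F φ)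

/-- Flat norm of a functional `F` on `Lip₀(Ω)`; `L = 2` gives `‖·‖_{flat,α}` (α = 1/2),
`L = 1` gives `‖·‖_flat`. -/
def flatNorm (Ω : Set R2) (L : ℝ≥0) (F : (R2 → ℝ) → ℝ) : ℝ≥0∞ :=
  flatNormOn Ω (frontier Ω) L F

/-- `d̄_Ω(x,y) = min{|x−y|, dist(x,∂Ω) + dist(y,∂Ω)}`. -/
def dbar (Ω : Set R2) (x y : R2) : ℝ :=
  min (dist x y) (Metric.infDist x (frontier Ω) + Metric.infDist y (frontier Ω))

/-- Countably subadditive interior envelope `𝒜**(u,V)` (relative to `Ω`). -/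
def envA (u : R2 → R2) (Ω V : Set R2) : ℝ≥0∞ :=
  sInf { a : ℝ≥0∞ | ∃ A : ℕ → Set R2,
    (∀ k, IsOpen (A k) ∧ A k ⊆ Ω) ∧ V ⊆ ⋃ k, A k ∧ a = ∑' k, relaxedArea u (A k) }

/-- Property `(P_f)` for a finite family of pairs of points of `cl(Ω)`. -/
def SatisfiesPf (Ω : Set R2) {n : ℕ} (x y : Fin n → R2) : Prop :=
  (∀ k, (x k ∈ Ω ∧ y k ∈ frontier Ω ∧ dist (x k) (y k) = Metric.infDist (x k) (frontier Ω)) ∨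
        (y k ∈ Ω ∧ x k ∈ frontier Ω ∧ dist (x k) (y k) = Metric.infDist (y k) (frontier Ω))) ∧
  ∀ i j, x i ∈ Ω → y j ∈ Ω → x i ≠ y j

/-- The points of the family `x, y` lying in `Ω` are distinct and three by three
not collinear. -/
def InteriorPointsGeneric (Ω : Set R2) {n : ℕ} (x y : Fin n → R2) : Prop :=
  (∀ a b : Fin n ⊕ Fin n, Sum.elim x y a ∈ Ω → Sum.elim x y b ∈ Ω → a ≠ b →
    Sum.elim x y a ≠ Sum.elim x y b) ∧
  ∀ a b c : Fin n ⊕ Fin n, Sum.elim x y a ∈ Ω → Sum.elim x y b ∈ Ω → Sum.elim x y c ∈ Ω →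
    a ≠ b → a ≠ c → b ≠ c →
    ¬ Collinear ℝ ({Sum.elim x y a, Sum.elim x y b, Sum.elim x y c} : Set R2)

/-- `ι(w₁,w₂) = (w₁,−w₂)`. -/
def conjPt (w : R2) : R2 := (WithLp.equiv 2 (Fin 2 → ℝ)).symm ![w 0, -(w 1)]

/-- `u` is a (positive/negative) vortex around the points of the family lying in `Ω`:
the closed discs of radii `ρ` are contained in `Ω` and pairwise disjoint,
`u(z) = (z−x_i)/|z−x_i|` on `B_{ρ}(x_i)` and `u(z) = ι((z−y_j)/|z−y_j|)` on `B_{ρ}(y_j)`. -/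
def VortexAt (Ω : Set R2) (u : R2 → R2) {n : ℕ} (x y : Fin n → R2)
    (ρ : Fin n ⊕ Fin n → ℝ) : Prop :=
  (∀ a, Sum.elim x y a ∈ Ω → Metric.closedBall (Sum.elim x y a) (ρ a) ⊆ Ω) ∧
  (∀ a b, a ≠ b → Sum.elim x y a ∈ Ω → Sum.elim x y b ∈ Ω →
    Disjoint (Metric.closedBall (Sum.elim x y a) (ρ a))
      (Metric.closedBall (Sum.elim x y b) (ρ b))) ∧
  (∀ i, x i ∈ Ω → ∀ᵐ z ∂(volume.restrict (Metric.ball (x i) (ρ (Sum.inl i)))),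
    u z = ‖z - x i‖⁻¹ • (z - x i)) ∧
  (∀ i, y i ∈ Ω → ∀ᵐ z ∂(volume.restrict (Metric.ball (y i) (ρ (Sum.inr i)))),
    u z = conjPt (‖z - y i‖⁻¹ • (z - y i)))

/-- The energy `E(I_P, I_D, τ)` of a partition `{I_Dᶜ, I_D}` of `I` and an injection
`τ : I_D → I`. -/
def energy (Ω : Set R2) {n : ℕ} (x y : Fin n → R2) (ID : Finset (Fin n))
    (τ : Fin n → Fin n) : ℝ≥0∞ :=
  ((IDᶜ.filter fun k => x k ∈ Ω).card : ℝ≥0∞) +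
  (((Finset.univ \ ID.image τ).filter fun j => y j ∈ Ω).card : ℝ≥0∞) +
  2 * ∑ k ∈ ID, μH[1] (segment ℝ (y (τ k)) (x k) ∩ Ω)

section Part1

/-! ### Calculus of logarithmic derivatives -/

/-- identification of the plane with `ℂ` -/
def cx : R2 ≃ₗᵢ[ℝ] ℂ := Complex.orthonormalBasisOneI.repr.symm

lemma cx_re (x : R2) : (cx x).re = x 0 := by
  simp [cx]

lemma cx_im (x : R2) : (cx x).im = x 1 := by
  simp [cx]

lemma cx_symm_zero (z : ℂ) : (cx.symm z) 0 = z.re := by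
  rw [← cx_re, LinearIsometryEquiv.apply_symm_apply]

lemma cx_symm_one (z : ℂ) : (cx.symm z) 1 = z.im := by
  rw [← cx_im, LinearIsometryEquiv.apply_symm_apply]

/-- basis vectors -/
abbrev bv (j : Fin 2) : R2 := EuclideanSpace.single j 1

lemma cx_bv0 : cx (bv 0) = 1 := by
  apply Complex.ext <;> simp [cx_re, cx_im]

lemma cx_bv1 : cx (bv 1) = Complex.I := by
  apply Complex.ext <;> simp [cx_re, cx_im]

lemma norm_bv (j : Fin 2) : ‖bv j‖ = 1 := by simp [bv]

/-- partial derivatives -/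
def dj (j : Fin 2) (F : R2 → ℂ) (x : R2) : ℂ := fderiv ℝ F x (bv j)

/-- gradient of the phase of `F`, as a complex number -/
def W (F : R2 → ℂ) (x : R2) : ℂ := ⟨(dj 0 F x / F x).im, (dj 1 F x / F x).im⟩

/-- normalization -/
def nz (F : R2 → ℂ) (x : R2) : ℂ := F x / (‖F x‖ : ℂ)

lemma W_mul {F G : R2 → ℂ} {x : R2} (hF : DifferentiableAt ℝ F x) (hG : DifferentiableAt ℝ G x)
    (h1 : F x ≠ 0) (h2 : G x ≠ 0) : W (fun y => F y * G y) x = W F x + W G x := by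
  have key : ∀ j, dj j (fun y => F y * G y) x / (F x * G x) = dj j F x / F x + dj j G x / G x := by
    intro j
    unfold dj
    rw [fderiv_fun_mul hF hG]
    simp only [add_apply, smul_apply, smul_eq_mul]
    field_simp
    ring
  apply Complex.ext <;> simp [W, key]

lemma W_congr {F G : R2 → ℂ} {x : R2} (h : F =ᶠ[𝓝 x] G) : W F x = W G x := by
  simp [W, dj, h.fderiv_eq, h.eq_of_nhds]

lemma norm_dj_le (j : Fin 2) (F : R2 → ℂ) (x : R2) : ‖dj j F x‖ ≤ ‖fderiv ℝ F x‖ := by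
  have := (fderiv ℝ F x).le_opNorm (bv j)
  rwa [norm_bv, mul_one] at this

lemma norm_W_le (F : R2 → ℂ) (x : R2) : ‖W F x‖ ≤ 2 * (‖fderiv ℝ F x‖ / ‖F x‖) := by
  have h : ∀ j, |(dj j F x / F x).im| ≤ ‖fderiv ℝ F x‖ / ‖F x‖ := fun j =>
    (Complex.abs_im_le_norm _).trans (by
      rw [norm_div]; gcongr; exact norm_dj_le j F x)
  have := Complex.norm_le_abs_re_add_abs_im (W F x)
  have h0 := h 0
  have h1 := h 1
  simp only [W] at this ⊢
  linarith

lemma hasFDerivAt_cx (x : R2) : HasFDerivAt (fun y => cx y)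
    (cx.toContinuousLinearEquiv : R2 →L[ℝ] ℂ) x :=
  (cx.toContinuousLinearEquiv : R2 →L[ℝ] ℂ).hasFDerivAt

lemma contDiff_cx {n} : ContDiff ℝ n (fun y => cx y) :=
  (cx.toContinuousLinearEquiv : R2 →L[ℝ] ℂ).contDiff

lemma dj_lin (a : ℂ) (j : Fin 2) (x : R2) : dj j (fun y => cx y - a) x = cx (bv j) := by
  unfold dj
  rw [((hasFDerivAt_cx x).sub_const a).fderiv]; rfl

lemma W_lin {a : ℂ} {x : R2} (h : cx x ≠ a) :
    W (fun y => cx y - a) x = Complex.I / (starRingEnd ℂ (cx x - a)) := by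
  have h' : cx x - a ≠ 0 := sub_ne_zero.2 h
  have hn : Complex.normSq (cx x - a) ≠ 0 := by simpa using h'
  unfold W
  rw [dj_lin, dj_lin, cx_bv0, cx_bv1]
  beta_reduce
  generalize cx x - a = w
  apply Complex.ext
  · simp [Complex.div_re]
  · simp [Complex.div_im]

lemma W_conj {F : R2 → ℂ} {x : R2} (hF : DifferentiableAt ℝ F x) :
    W (fun y => starRingEnd ℂ (F y)) x = - W F x := by
  have key : ∀ j, dj j (fun y => starRingEnd ℂ (F y)) x = starRingEnd ℂ (dj j F x) := by
    intro j
    unfold dj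
    have := (Complex.conjCLE : ℂ →L[ℝ] ℂ).hasFDerivAt.comp x hF.hasFDerivAt
    have h2 : fderiv ℝ (fun y => starRingEnd ℂ (F y)) x = _ := this.fderiv
    rw [h2]; rfl
  unfold W
  simp only [key, ← map_div₀, Complex.conj_im]
  apply Complex.ext <;> rfl

lemma nz_mul (F G : R2 → ℂ) (x : R2) : nz (fun y => F y * G y) x = nz F x * nz G x := by
  simp [nz]; ring

lemma norm_nz {F : R2 → ℂ} {x : R2} (h : F x ≠ 0) : ‖nz F x‖ = 1 := by
  simp [nz, h]

lemma norm_nz_le (F : R2 → ℂ) (x : R2) : ‖nz F x‖ ≤ 1 := by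
  by_cases h : F x = 0
  · simp [nz, h]
  · exact (norm_nz h).le

lemma nz_conj (F : R2 → ℂ) (x : R2) :
    nz (fun y => starRingEnd ℂ (F y)) x = starRingEnd ℂ (nz F x) := by
  simp [nz]

lemma measurable_W {F : R2 → ℂ} (h : Measurable F) : Measurable (W F) := by
  have h1 : ∀ j, Measurable (dj j F) := fun j => measurable_fderiv_apply_const ℝ F (bv j)
  have : W F = fun x => (((dj 0 F x / F x).im : ℝ) : ℂ) + (((dj 1 F x / F x).im : ℝ) : ℂ) * Complex.I := by
    funext x; apply Complex.ext <;> simp [W]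
  rw [this]
  have h2 : ∀ j, Measurable (fun x => (((dj j F x / F x).im : ℝ) : ℂ)) := fun j =>
    Complex.measurable_ofReal.comp (Complex.measurable_im.comp ((h1 j).div h))
  exact (h2 0).add ((h2 1).mul_const _)

lemma measurable_nz {F : R2 → ℂ} (h : Measurable F) : Measurable (nz F) :=
  h.div (Complex.measurable_ofReal.comp h.norm)

/-- W of a product of real-exponential: phases -/
lemma W_exp {β : R2 → ℝ} {x : R2} (h : DifferentiableAt ℝ β x) :
    W (fun y => Complex.exp (Complex.I * (β y : ℂ))) x
      = ⟨fderiv ℝ β x (bv 0), fderiv ℝ β x (bv 1)⟩ := by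
  have h1 : HasFDerivAt (fun y => Complex.I * (β y : ℂ))
      (Complex.I • (Complex.ofRealCLM.comp (fderiv ℝ β x))) x := by
    have := (Complex.ofRealCLM.hasFDerivAt.comp x h.hasFDerivAt)
    exact this.const_mul Complex.I
  have h2 := h1.cexp
  have key : ∀ j, dj j (fun y => Complex.exp (Complex.I * (β y : ℂ))) x /
      Complex.exp (Complex.I * (β x : ℂ)) = Complex.I * (fderiv ℝ β x (bv j) : ℂ) := by
    intro j
    unfold dj
    rw [h2.fderiv]
    have := Complex.exp_ne_zero (Complex.I * (β x : ℂ))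
    simp
  apply Complex.ext <;> simp [W, key]

/-- area of the graph of a complex-valued map at points where it is nonzero -/
def Mu (F : R2 → ℂ) (x : R2) : ℂ := ⟨(dj 0 F x / F x).re, (dj 1 F x / F x).re⟩

lemma Mu_mul {F G : R2 → ℂ} {x : R2} (hF : DifferentiableAt ℝ F x) (hG : DifferentiableAt ℝ G x)
    (h1 : F x ≠ 0) (h2 : G x ≠ 0) : Mu (fun y => F y * G y) x = Mu F x + Mu G x := by
  have key : ∀ j, dj j (fun y => F y * G y) x / (F x * G x) = dj j F x / F x + dj j G x / G x := by
    intro j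
    unfold dj
    rw [fderiv_fun_mul hF hG]
    simp only [add_apply, smul_apply, smul_eq_mul]
    field_simp
    ring
  apply Complex.ext <;> simp [Mu, key]

/-- the area integrand for complex-valued maps -/
def aint (v : R2 → ℂ) (x : R2) : ℝ :=
  Real.sqrt (1 + (‖dj 0 v x‖ ^ 2 + ‖dj 1 v x‖ ^ 2) + ((starRingEnd ℂ (dj 0 v x)) * dj 1 v x).im ^ 2)

lemma classicalArea_eq (A : Set R2) (hA : IsOpen A) (v : R2 → ℂ) (hv : DifferentiableOn ℝ v A) :
    classicalArea A (fun x => cx.symm (v x)) = ∫⁻ x in A, ENNReal.ofReal (aint v x) := by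
  unfold classicalArea
  apply setLIntegral_congr_fun hA.measurableSet
  intro x hx
  have hd : DifferentiableAt ℝ v x := hv.differentiableAt (hA.mem_nhds hx)
  have h1 := (cx.symm.toContinuousLinearEquiv : ℂ →L[ℝ] R2).hasFDerivAt.comp x hd.hasFDerivAt
  have h2 : fderiv ℝ (fun x => cx.symm (v x)) x = _ := h1.fderiv
  have h3 : ∀ j, fderiv ℝ (fun x => cx.symm (v x)) x (EuclideanSpace.single j 1)
      = cx.symm (dj j v x) := by
    intro j; rw [h2]; rfl
  simp only [jacobianMatrix, Matrix.det_fin_two, Matrix.of_apply, Fin.sum_univ_two, h3,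
    cx_symm_zero, cx_symm_one, aint]
  congr 2
  simp only [← Complex.normSq_eq_norm_sq, Complex.normSq_apply, Complex.mul_im, Complex.conj_re,
    Complex.conj_im]
  ring

lemma aint_le {v : R2 → ℂ} {x : R2} (h0 : v x ≠ 0) (h1 : ‖v x‖ ≤ 1) :
    aint v x ≤ Real.sqrt (1 + ‖W v x‖ ^ 2) + ‖v x‖ * ‖Mu v x‖ +
      ‖v x‖ ^ 2 * |((starRingEnd ℂ (Mu v x)) * W v x).im| := by
  set r := ‖v x‖ with hr
  have hr0 : 0 < r := norm_pos_iff.2 h0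
  set p := dj 0 v x / v x with hp
  set q := dj 1 v x / v x with hq
  have e0 : dj 0 v x = p * v x := by rw [hp]; field_simp
  have e1 : dj 1 v x = q * v x := by rw [hq]; field_simp
  have hW : W v x = ⟨p.im, q.im⟩ := rfl
  have hM : Mu v x = ⟨p.re, q.re⟩ := rfl
  set K := |((starRingEnd ℂ (Mu v x)) * W v x).im| with hK
  have hdet : ((starRingEnd ℂ (dj 0 v x)) * dj 1 v x).im ^ 2 = (r ^ 2 * K) ^ 2 := by
    have : (starRingEnd ℂ (dj 0 v x)) * dj 1 v x = ((r ^ 2 : ℝ) : ℂ) * (starRingEnd ℂ p * q) := by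
      rw [e0, e1, map_mul, hr]
      have : ((‖v x‖ ^ 2 : ℝ) : ℂ) = (starRingEnd ℂ (v x)) * v x := by
        rw [mul_comm, Complex.mul_conj, Complex.normSq_eq_norm_sq]
      rw [this]; ring
    rw [this, Complex.im_ofReal_mul, mul_pow, mul_pow, hK, sq_abs, hW, hM]
    congr 2
    simp
    ring
  have hs : ‖dj 0 v x‖ ^ 2 + ‖dj 1 v x‖ ^ 2 = r ^ 2 * (‖W v x‖ ^ 2 + ‖Mu v x‖ ^ 2) := by
    rw [e0, e1, norm_mul, norm_mul, hW, hM, ← hr, mul_pow, mul_pow]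
    simp only [← Complex.normSq_eq_norm_sq, Complex.normSq_apply]
    ring
  unfold aint
  rw [hs, hdet]
  set w := ‖W v x‖ with hw
  set m := ‖Mu v x‖ with hm
  have hw0 : 0 ≤ w := norm_nonneg _
  have hm0 : 0 ≤ m := norm_nonneg _
  have hK0 : 0 ≤ K := abs_nonneg _
  apply Real.sqrt_le_iff.2
  have hS := Real.sqrt_nonneg (1 + w ^ 2)
  have hS2 := Real.sq_sqrt (show 0 ≤ 1 + w ^ 2 by positivity)
  set S := Real.sqrt (1 + w ^ 2)
  refine ⟨by positivity, ?_⟩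
  have a1 : 0 ≤ S * (r * m) := by positivity
  have a2 : 0 ≤ S * (r ^ 2 * K) := by positivity
  have a3 : 0 ≤ (r * m) * (r ^ 2 * K) := by positivity
  have a4 : r ^ 2 * w ^ 2 ≤ 1 * w ^ 2 := by
    gcongr; nlinarith
  nlinarith
end Part1

section Part2

/-! ### Basic integrals in the plane -/

lemma integrableOn_inv_norm (a : R2) {S : Set R2} (hS : Bornology.IsBounded S) :
    IntegrableOn (fun x : R2 => ‖x - a‖⁻¹) S := by
  have h0 : ∀ r : ℝ, 0 < r → IntegrableOn (fun x : R2 => ‖x‖⁻¹) (ball 0 r) := by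
    intro r hr
    have := (integrableOn_fun_norm_addHaar (E := R2) (F := ℝ) volume (f := fun y => y⁻¹) (r := r)).2
    apply this
    have hf : Module.finrank ℝ R2 = 2 := by simp
    rw [hf]
    have : IntegrableOn (fun _ : ℝ => (1 : ℝ)) (Ioo 0 r) := by
      simp [integrableOn_const_iff]
    refine this.congr_fun ?_ measurableSet_Ioo
    intro y hy
    have := hy.1.ne'
    simp [this]
  obtain ⟨r, hr0, hr⟩ := hS.subset_ball_lt 0 a
  have h1 := h0 r hr0
  have h2 : IntegrableOn (fun x : R2 => ‖x - a‖⁻¹) (ball a r) := by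
    rw [← integrable_indicator_iff measurableSet_ball] at h1 ⊢
    have := h1.comp_sub_right a
    refine this.congr (ae_of_all _ fun x => ?_)
    simp [Set.indicator, mem_ball, dist_eq_norm]
  exact h2.mono_set hr

lemma lintegral_inv_lt_top (a : R2) {S : Set R2} (hS : Bornology.IsBounded S) :
    ∫⁻ x in S, ENNReal.ofReal ‖x - a‖⁻¹ < ⊤ := by
  have := (integrableOn_inv_norm a hS).lintegral_lt_top
  exact this

/-- mollified Dirac mass (times `π`) -/
def kern (δ : ℝ) (x : R2) : ℝ := δ ^ 2 / (‖x‖ ^ 2 + δ ^ 2) ^ 2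

lemma kern_nonneg (δ : ℝ) (x : R2) : 0 ≤ kern δ x := by unfold kern; positivity

lemma continuous_kern {δ : ℝ} (hδ : 0 < δ) : Continuous (kern δ) := by
  unfold kern
  apply Continuous.div (by fun_prop) (by fun_prop)
  intro x; positivity

lemma kern_radial {δ : ℝ} (hδ : 0 < δ) :
    IntegrableOn (fun y : ℝ => y * (δ ^ 2 / (y ^ 2 + δ ^ 2) ^ 2)) (Ioi 0) ∧
    ∫ y in Ioi (0:ℝ), y * (δ ^ 2 / (y ^ 2 + δ ^ 2) ^ 2) = 1 / 2 := by
  have hd : ∀ y ∈ Ici (0:ℝ), HasDerivAt (fun y : ℝ => - (δ ^ 2 / 2) * (y ^ 2 + δ ^ 2)⁻¹)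
      (y * (δ ^ 2 / (y ^ 2 + δ ^ 2) ^ 2)) y := by
    intro y _
    have h1 : HasDerivAt (fun y : ℝ => y ^ 2 + δ ^ 2) (2 * y) y := by
      simpa using ((hasDerivAt_pow 2 y).add_const (δ ^ 2))
    have h2 := (h1.inv (by positivity)).const_mul (- (δ ^ 2 / 2))
    refine h2.congr_deriv ?_
    ring
  have hlim : Tendsto (fun y : ℝ => - (δ ^ 2 / 2) * (y ^ 2 + δ ^ 2)⁻¹) atTop (𝓝 0) := by
    have : Tendsto (fun y : ℝ => y ^ 2 + δ ^ 2) atTop atTop :=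
      tendsto_atTop_add_const_right _ _ (tendsto_pow_atTop two_ne_zero)
    simpa using (this.inv_tendsto_atTop).const_mul (- (δ ^ 2 / 2))
  have hp : ∀ y ∈ Ioi (0:ℝ), 0 ≤ y * (δ ^ 2 / (y ^ 2 + δ ^ 2) ^ 2) := by
    intro y hy
    have : 0 < y := hy
    positivity
  refine ⟨integrableOn_Ioi_deriv_of_nonneg' hd hp hlim, ?_⟩
  rw [integral_Ioi_of_hasDerivAt_of_nonneg' hd hp hlim]
  field_simp
  ring

lemma kern_integral {δ : ℝ} (hδ : 0 < δ) : Integrable (kern δ) ∧ ∫ x, kern δ x = Real.pi := by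
  have hf : Module.finrank ℝ R2 = 2 := by simp
  have hi : Integrable (kern δ) := by
    have := (integrable_fun_norm_addHaar (E := R2) (F := ℝ) volume
      (f := fun y => δ ^ 2 / (y ^ 2 + δ ^ 2) ^ 2)).2
    apply this
    rw [hf]
    simpa using (kern_radial hδ).1
  refine ⟨hi, ?_⟩
  have := (integral_fun_norm_addHaar (E := R2) (F := ℝ) volume
      (fun y => δ ^ 2 / (y ^ 2 + δ ^ 2) ^ 2))
  unfold kern
  rw [this, hf]
  have hv : volume.real (ball (0 : R2) 1) = Real.pi := by
    simp [Measure.real, Real.pi_pos.le]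
  rw [hv]
  simp only [Nat.add_one_sub_one, pow_one, smul_eq_mul, nsmul_eq_mul]
  rw [(kern_radial hδ).2]
  push_cast; ring

lemma kern_lintegral {δ : ℝ} (hδ : 0 < δ) (a : R2) :
    ∫⁻ x, ENNReal.ofReal (kern δ (x - a)) = ENNReal.ofReal Real.pi := by
  rw [lintegral_sub_right_eq_self (fun x => ENNReal.ofReal (kern δ x)) a,
    ← ofReal_integral_eq_lintegral_ofReal (kern_integral hδ).1 (ae_of_all _ (kern_nonneg δ)),
    (kern_integral hδ).2]

lemma inv_mul_inv_integrable {a b : R2} (hab : a ≠ b) {S : Set R2} (hS : Bornology.IsBounded S) :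
    IntegrableOn (fun x : R2 => ‖x - a‖⁻¹ * ‖x - b‖⁻¹) S := by
  have h := ((integrableOn_inv_norm a hS).add (integrableOn_inv_norm b hS)).const_mul (‖a - b‖⁻¹)
  refine Integrable.mono' h (by fun_prop) (ae_of_all _ fun x => ?_)
  have hd : 0 < ‖a - b‖ := norm_pos_iff.2 (sub_ne_zero.2 hab)
  rw [Real.norm_of_nonneg (by positivity)]
  simp only [Pi.add_apply]
  rcases eq_or_ne x a with rfl | ha
  · simp; positivity
  rcases eq_or_ne x b with rfl | hb
  · simp; positivity
  have pa : 0 < ‖x - a‖ := norm_pos_iff.2 (sub_ne_zero.2 ha)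
  have pb : 0 < ‖x - b‖ := norm_pos_iff.2 (sub_ne_zero.2 hb)
  have tri : ‖a - b‖ ≤ ‖x - a‖ + ‖x - b‖ := by
    have := norm_sub_le (x - b) (x - a)
    simp only [sub_sub_sub_cancel_left] at this
    linarith
  rw [← one_div, ← one_div, ← one_div]
  have : 1 / ‖a - b‖ * (1 / ‖x - a‖ + 1 / ‖x - b‖) - 1 / ‖x - a‖ * (1 / ‖x - b‖)
     = (‖x - a‖ + ‖x - b‖ - ‖a - b‖) / (‖a - b‖ * ‖x - a‖ * ‖x - b‖) := by
    field_simp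
    ring
  have h3 : 0 ≤ (‖x - a‖ + ‖x - b‖ - ‖a - b‖) / (‖a - b‖ * ‖x - a‖ * ‖x - b‖) :=
    div_nonneg (by linarith) (by positivity)
  linarith

lemma exists_inv_bound (s : ℝ) : ∃ K : ℝ≥0∞, K < ⊤ ∧ ∀ z : R2,
    ∫⁻ y in ball (0 : R2) s, ENNReal.ofReal ‖z - y‖⁻¹ ≤ K := by
  refine ⟨(∫⁻ y in ball (0 : R2) 1, ENNReal.ofReal ‖y - 0‖⁻¹) + volume (ball (0 : R2) s),
    ENNReal.add_lt_top.2 ⟨lintegral_inv_lt_top 0 isBounded_ball, measure_ball_lt_top⟩, fun z => ?_⟩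
  have h1 : ∀ y : R2, ENNReal.ofReal ‖z - y‖⁻¹ ≤
      (ball (0 : R2) 1).indicator (fun y => ENNReal.ofReal ‖y - 0‖⁻¹) (z - y) + 1 := by
    intro y
    by_cases h : z - y ∈ ball (0 : R2) 1
    · simp [h]
    · rw [mem_ball_zero_iff, not_lt] at h
      refine le_trans ?_ le_add_self
      rw [ENNReal.ofReal_le_one]
      exact inv_le_one_of_one_le₀ h
  calc ∫⁻ y in ball (0 : R2) s, ENNReal.ofReal ‖z - y‖⁻¹
      ≤ ∫⁻ y in ball (0 : R2) s, ((ball (0 : R2) 1).indicator (fun y => ENNReal.ofReal ‖y - 0‖⁻¹) (z - y) + 1) :=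
        lintegral_mono h1
    _ = (∫⁻ y in ball (0 : R2) s, (ball (0 : R2) 1).indicator (fun y => ENNReal.ofReal ‖y - 0‖⁻¹) (z - y)) + volume (ball (0 : R2) s) := by
        rw [lintegral_add_right _ measurable_const]; simp
    _ ≤ (∫⁻ y, (ball (0 : R2) 1).indicator (fun y => ENNReal.ofReal ‖y - 0‖⁻¹) (z - y)) + volume (ball (0 : R2) s) := by
        gcongr; exact Measure.restrict_le_self
    _ = _ := by
        rw [lintegral_sub_left_eq_self (μ := volume) ((ball (0 : R2) 1).indicator (fun y => ENNReal.ofReal ‖y - 0‖⁻¹)) z,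
          lintegral_indicator measurableSet_ball]
end Part2

section Part3

/-! ### Approximability predicate -/

/-- `h` can be approximated in `L¹` by smooth maps with area at most `∫√(1+|w|²) + κ`. -/
def Ok (Ω : Set R2) (h w : R2 → ℂ) (κ : ℝ≥0∞) : Prop :=
  ∀ η : ℝ≥0∞, 0 < η → ∃ v : R2 → ℂ, ContDiffOn ℝ 1 v Ω ∧ (∀ x ∈ Ω, ‖v x‖ ≤ 1) ∧
    ∫⁻ x in Ω, ‖v x - h x‖ₑ ≤ η ∧
    ∫⁻ x in Ω, ENNReal.ofReal (aint v x) ≤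
      (∫⁻ x in Ω, ENNReal.ofReal (Real.sqrt (1 + ‖w x‖ ^ 2))) + κ + η

lemma sqrt_one_add_le (a b : ℂ) :
    Real.sqrt (1 + ‖a‖ ^ 2) ≤ Real.sqrt (1 + ‖b‖ ^ 2) + ‖a - b‖ := by
  have hb : 0 ≤ Real.sqrt (1 + ‖b‖ ^ 2) := Real.sqrt_nonneg _
  have hb2 : Real.sqrt (1 + ‖b‖ ^ 2) ^ 2 = 1 + ‖b‖ ^ 2 := Real.sq_sqrt (by positivity)
  have hb3 : ‖b‖ ≤ Real.sqrt (1 + ‖b‖ ^ 2) := Real.le_sqrt_of_sq_le (by linarith)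
  have h1 : ‖a‖ ≤ ‖b‖ + ‖a - b‖ := by
    have := norm_add_le b (a - b)
    simpa using this
  apply Real.sqrt_le_iff.2
  refine ⟨by positivity, ?_⟩
  nlinarith [norm_nonneg (a - b), norm_nonneg a, norm_nonneg b,
    mul_le_mul_of_nonneg_right hb3 (norm_nonneg (a - b))]

lemma lintegral_sqrt_le {Ω : Set R2} {a b : R2 → ℂ} (hb : Measurable b) :
    ∫⁻ x in Ω, ENNReal.ofReal (Real.sqrt (1 + ‖a x‖ ^ 2)) ≤
      (∫⁻ x in Ω, ENNReal.ofReal (Real.sqrt (1 + ‖b x‖ ^ 2))) + ∫⁻ x in Ω, ‖a x - b x‖ₑ := by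
  rw [← lintegral_add_left (by fun_prop)]
  refine lintegral_mono fun x => ?_
  rw [← ofReal_norm, ← ENNReal.ofReal_add (by positivity) (by positivity)]
  exact ENNReal.ofReal_le_ofReal (sqrt_one_add_le _ _)

lemma Ok_transfer {Ω : Set R2} {h w : R2 → ℂ} {κ c : ℝ≥0∞} (hh : Measurable h) (hw : Measurable w)
    (H : ∀ η : ℝ≥0∞, 0 < η → ∃ h' w' : R2 → ℂ, Measurable h' ∧
      ∫⁻ x in Ω, ‖h' x - h x‖ₑ ≤ η ∧ ∫⁻ x in Ω, ‖w' x - w x‖ₑ ≤ c + η ∧ Ok Ω h' w' (κ + η)) :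
    Ok Ω h w (κ + c) := by
  intro η hη
  have hη3 : 0 < η / 3 := ENNReal.div_pos hη.ne' (by simp)
  obtain ⟨h', w', hm, h1, h2, h3⟩ := H (η / 3) hη3
  obtain ⟨v, v1, v2, v3, v4⟩ := h3 (η / 3) hη3
  have e3 : η / 3 + η / 3 + η / 3 = η := ENNReal.add_thirds η
  refine ⟨v, v1, v2, ?_, ?_⟩
  · calc ∫⁻ x in Ω, ‖v x - h x‖ₑ ≤ ∫⁻ x in Ω, (‖v x - h' x‖ₑ + ‖h' x - h x‖ₑ) := by
          refine lintegral_mono fun x => ?_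
          have := enorm_add_le (v x - h' x) (h' x - h x)
          simpa using this
      _ = (∫⁻ x in Ω, ‖v x - h' x‖ₑ) + ∫⁻ x in Ω, ‖h' x - h x‖ₑ :=
          lintegral_add_right _ (by fun_prop)
      _ ≤ η / 3 + η / 3 := add_le_add v3 h1
      _ ≤ η := le_self_add.trans e3.le
  · refine v4.trans ?_
    have := (lintegral_sqrt_le (Ω := Ω) (a := w') hw).trans (add_le_add_right h2 _)
    calc _ ≤ ((∫⁻ x in Ω, ENNReal.ofReal (Real.sqrt (1 + ‖w x‖ ^ 2))) + (c + η / 3)) +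
          (κ + η / 3) + η / 3 := by gcongr
      _ = (∫⁻ x in Ω, ENNReal.ofReal (Real.sqrt (1 + ‖w x‖ ^ 2))) + (κ + c) +
          (η / 3 + η / 3 + η / 3) := by ring
      _ = _ := by rw [e3]

lemma Ok_congr {Ω : Set R2} (hΩ : MeasurableSet Ω) {h w h' w' : R2 → ℂ} {κ : ℝ≥0∞}
    (H : Ok Ω h w κ)
    (e1 : ∀ x ∈ Ω, h x = h' x) (e2 : ∀ x ∈ Ω, w x = w' x) : Ok Ω h' w' κ := by
  intro η hη
  obtain ⟨v, v1, v2, v3, v4⟩ := H η hη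
  refine ⟨v, v1, v2, ?_, ?_⟩
  · rwa [setLIntegral_congr_fun hΩ (g := fun x => ‖v x - h x‖ₑ)
      (fun x hx => by simp only [e1 x hx])]
  · rwa [setLIntegral_congr_fun hΩ (f := fun x => ENNReal.ofReal (Real.sqrt (1 + ‖w' x‖ ^ 2)))
      (g := fun x => ENNReal.ofReal (Real.sqrt (1 + ‖w x‖ ^ 2)))
      (fun x hx => by simp only [e2 x hx])]

lemma relaxedArea_le_of_Ok {Ω : Set R2} (hΩ : IsOpen Ω) (hΩb : Bornology.IsBounded Ω)
    {u : R2 → R2} {h w : R2 → ℂ} {κ : ℝ≥0∞}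
    (hu : IntegrableOn u Ω) (hh : ∀ᵐ x ∂(volume.restrict Ω), h x = cx (u x)) (H : Ok Ω h w κ) :
    relaxedArea u Ω ≤ (∫⁻ x in Ω, ENNReal.ofReal (Real.sqrt (1 + ‖w x‖ ^ 2))) + κ := by
  have hpos : ∀ k : ℕ, (0 : ℝ≥0∞) < ENNReal.ofReal (1 / ((k : ℝ) + 1)) := fun k =>
    ENNReal.ofReal_pos.2 (by positivity)
  choose v v1 v2 v3 v4 using fun k : ℕ => H _ (hpos k)
  have hlim : Tendsto (fun k : ℕ => ENNReal.ofReal (1 / ((k : ℝ) + 1))) atTop (𝓝 0) := by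
    have := ENNReal.tendsto_ofReal (tendsto_one_div_add_atTop_nhds_zero_nat (𝕜 := ℝ))
    simpa using this
  have hfin : IsFiniteMeasure (volume.restrict Ω) :=
    ⟨by rw [Measure.restrict_apply_univ]; exact hΩb.measure_lt_top⟩
  have hvint : ∀ k, IntegrableOn (fun x => cx.symm (v k x)) Ω := fun k => by
    refine Integrable.of_bound (C := 1) ?_ ?_
    · exact ((cx.symm.continuous.comp_continuousOn (v1 k).continuousOn)).aestronglyMeasurable
        hΩ.measurableSet
    · exact (ae_restrict_iff' hΩ.measurableSet).2 (ae_of_all _ fun x hx => by simpa using v2 k x hx)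
  have hen : ∀ k, ∫⁻ x in Ω, ‖cx.symm (v k x) - u x‖ₑ ≤ ENNReal.ofReal (1 / ((k : ℝ) + 1)) := by
    intro k
    refine le_trans (le_of_eq ?_) (v3 k)
    refine lintegral_congr_ae ?_
    filter_upwards [hh] with x hx
    rw [hx, ← ofReal_norm, ← ofReal_norm]
    congr 1
    have : v k x - cx (u x) = cx (cx.symm (v k x) - u x) := by simp
    rw [this, LinearIsometryEquiv.norm_map]
  have hmem : relaxedArea u Ω ≤ Filter.liminf (fun k => classicalArea Ω (fun x => cx.symm (v k x))) atTop := by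
    refine sInf_le ⟨fun k x => cx.symm (v k x), fun k => ?_, fun k => (hvint k).sub hu, ?_, rfl⟩
    · exact (cx.symm.toContinuousLinearEquiv : ℂ →L[ℝ] R2).contDiff.comp_contDiffOn (v1 k)
    · have h0 : ∀ k, ∫ x in Ω, ‖cx.symm (v k x) - u x‖
          = (∫⁻ x in Ω, ‖cx.symm (v k x) - u x‖ₑ).toReal := fun k =>
        integral_norm_eq_lintegral_enorm ((hvint k).sub hu).aestronglyMeasurable
      refine squeeze_zero (fun k => by positivity) (fun k => ?_)
        (tendsto_one_div_add_atTop_nhds_zero_nat (𝕜 := ℝ))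
      rw [h0]
      exact ENNReal.toReal_le_of_le_ofReal (by positivity) (hen k)
  refine hmem.trans ?_
  have hl2 : Tendsto (fun k : ℕ => (∫⁻ x in Ω, ENNReal.ofReal (Real.sqrt (1 + ‖w x‖ ^ 2))) + κ +
      ENNReal.ofReal (1 / ((k : ℝ) + 1))) atTop
      (𝓝 ((∫⁻ x in Ω, ENNReal.ofReal (Real.sqrt (1 + ‖w x‖ ^ 2))) + κ)) := by
    simpa using hlim.const_add ((∫⁻ x in Ω, ENNReal.ofReal (Real.sqrt (1 + ‖w x‖ ^ 2))) + κ)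
  rw [← hl2.liminf_eq]
  refine liminf_le_liminf (Eventually.of_forall fun k => ?_)
  rw [classicalArea_eq Ω hΩ (v k) ((v1 k).differentiableOn one_ne_zero)]
  exact v4 k
end Part3

section Part4

/-! ### Vortex factors -/

/-- vortex factor of sign `q.2` at the point `q.1` -/
def vx (q : R2 × Bool) (x : R2) : ℂ :=
  if q.2 then cx x - cx q.1 else starRingEnd ℂ (cx x - cx q.1)

lemma norm_vx (q : R2 × Bool) (x : R2) : ‖vx q x‖ = ‖x - q.1‖ := by
  unfold vx
  split_ifs
  · rw [← map_sub, LinearIsometryEquiv.norm_map]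
  · rw [RCLike.norm_conj, ← map_sub, LinearIsometryEquiv.norm_map]

lemma vx_ne {q : R2 × Bool} {x : R2} (h : x ≠ q.1) : vx q x ≠ 0 := by
  rw [← norm_pos_iff, norm_vx, norm_pos_iff, sub_ne_zero]; exact h

lemma contDiff_conj {n} : ContDiff ℝ n (fun z : ℂ => starRingEnd ℂ z) :=
  (Complex.conjCLE : ℂ →L[ℝ] ℂ).contDiff

lemma contDiff_vx (q : R2 × Bool) {n} : ContDiff ℝ n (vx q) := by
  unfold vx
  split_ifs
  · exact contDiff_cx.sub contDiff_const
  · exact contDiff_conj.comp (contDiff_cx.sub contDiff_const)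

lemma differentiableAt_vx (q : R2 × Bool) (x : R2) : DifferentiableAt ℝ (vx q) x :=
  (contDiff_vx q (n := 1)).differentiable one_ne_zero x

lemma norm_W_vx {q : R2 × Bool} {x : R2} (h : x ≠ q.1) : ‖W (vx q) x‖ = ‖x - q.1‖⁻¹ := by
  have h' : cx x ≠ cx q.1 := fun e => h (cx.injective e)
  have h0 : ‖W (fun y => cx y - cx q.1) x‖ = ‖x - q.1‖⁻¹ := by
    rw [W_lin h', norm_div, RCLike.norm_conj, ← map_sub, LinearIsometryEquiv.norm_map]
    simp
  unfold vx
  split_ifs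
  · exact h0
  · rw [W_conj (F := fun y => cx y - cx q.1) ((hasFDerivAt_cx x).sub_const _).differentiableAt, norm_neg, h0]

/-- product of vortex factors -/
def vp (S : Finset (R2 × Bool)) (x : R2) : ℂ := ∏ q ∈ S, vx q x

lemma contDiff_vp (S : Finset (R2 × Bool)) {n} : ContDiff ℝ n (vp S) := by
  unfold vp
  exact contDiff_prod fun q _ => contDiff_vx q

lemma W_prod {ι : Type*} {S : Finset ι} {F : ι → R2 → ℂ} {x : R2}
    (hd : ∀ i ∈ S, DifferentiableAt ℝ (F i) x) (h0 : ∀ i ∈ S, F i x ≠ 0) :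
    W (fun y => ∏ i ∈ S, F i y) x = ∑ i ∈ S, W (F i) x := by
  induction S using Finset.induction_on with
  | empty => simp [W, dj]; rfl
  | insert a s ha ih =>
    simp only [Finset.prod_insert ha, Finset.sum_insert ha]
    rw [W_mul (hd a (by simp)) _ (h0 a (by simp)) _, ih]
    · exact fun i hi => hd i (by simp [hi])
    · exact fun i hi => h0 i (by simp [hi])
    · exact (HasFDerivAt.finsetProd (u := s) fun i hi =>
        (hd i (Finset.mem_insert_of_mem hi)).hasFDerivAt).differentiableAt
    · exact Finset.prod_ne_zero_iff.2 fun i hi => h0 i (by simp [hi])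

lemma Mu_prod {ι : Type*} {S : Finset ι} {F : ι → R2 → ℂ} {x : R2}
    (hd : ∀ i ∈ S, DifferentiableAt ℝ (F i) x) (h0 : ∀ i ∈ S, F i x ≠ 0) :
    Mu (fun y => ∏ i ∈ S, F i y) x = ∑ i ∈ S, Mu (F i) x := by
  induction S using Finset.induction_on with
  | empty => simp [Mu, dj]; rfl
  | insert a s ha ih =>
    simp only [Finset.prod_insert ha, Finset.sum_insert ha]
    rw [Mu_mul (hd a (by simp)) _ (h0 a (by simp)) _, ih]
    · exact fun i hi => hd i (by simp [hi])
    · exact fun i hi => h0 i (by simp [hi])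
    · exact (HasFDerivAt.finsetProd (u := s) fun i hi =>
        (hd i (Finset.mem_insert_of_mem hi)).hasFDerivAt).differentiableAt
    · exact Finset.prod_ne_zero_iff.2 fun i hi => h0 i (by simp [hi])

lemma W_vp {S : Finset (R2 × Bool)} {x : R2} (h : ∀ q ∈ S, x ≠ q.1) :
    W (vp S) x = ∑ q ∈ S, W (vx q) x :=
  W_prod (fun q _ => differentiableAt_vx q x) (fun q hq => vx_ne (h q hq))

lemma W_ofReal {ρ : R2 → ℝ} {x : R2} (h : DifferentiableAt ℝ ρ x) :
    W (fun y => (ρ y : ℂ)) x = 0 := by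
  have := Complex.ofRealCLM.hasFDerivAt.comp x h.hasFDerivAt
  have h2 : fderiv ℝ (fun y => (ρ y : ℂ)) x = Complex.ofRealCLM.comp (fderiv ℝ ρ x) := this.fderiv
  have h3 : ∀ j, (dj j (fun y => (ρ y : ℂ)) x / (ρ x : ℂ)).im = 0 := by
    intro j
    unfold dj
    rw [h2]
    simp only [ContinuousLinearMap.comp_apply, Complex.ofRealCLM_apply, ← Complex.ofReal_div, Complex.ofReal_im]
  unfold W
  rw [h3, h3]; rfl

/-- multiplying by a real positive factor does not change `W`. -/
lemma W_mul_ofReal {F : R2 → ℂ} {ρ : R2 → ℝ} {x : R2} (hF : DifferentiableAt ℝ F x)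
    (h : DifferentiableAt ℝ ρ x) (h1 : F x ≠ 0) (h2 : ρ x ≠ 0) :
    W (fun y => F y * (ρ y : ℂ)) x = W F x := by
  rw [W_mul hF _ h1 (by exact_mod_cast h2), W_ofReal h, add_zero]
  exact (Complex.ofRealCLM.hasFDerivAt.comp x h.hasFDerivAt).differentiableAt

lemma nz_mul_ofReal {F : R2 → ℂ} {ρ : R2 → ℝ} {x : R2} (h2 : 0 < ρ x) :
    nz (fun y => F y * (ρ y : ℂ)) x = nz F x := by
  have : nz (fun y => (ρ y : ℂ)) x = 1 := by
    unfold nz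
    have h3 : ((ρ x : ℝ) : ℂ) ≠ 0 := by exact_mod_cast h2.ne'
    simp only [Complex.norm_real, Real.norm_of_nonneg h2.le]
    exact div_self h3
  rw [nz_mul F (fun y => (ρ y : ℂ)), this, mul_one]

/-- `Mu` from the squared modulus -/
lemma Mu_eq {F : R2 → ℂ} {N : R2 → ℝ} {N' : R2 →L[ℝ] ℝ} {x : R2} (hF : DifferentiableAt ℝ F x)
    (hN : ∀ᶠ y in 𝓝 x, ‖F y‖ ^ 2 = N y) (hN' : HasFDerivAt N N' x) (h0 : F x ≠ 0) :
    Mu F x = ⟨N' (bv 0) / (2 * N x), N' (bv 1) / (2 * N x)⟩ := by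
  have h1 : HasFDerivAt (fun y => ‖F y‖ ^ 2) (2 • (innerSL ℝ (F x)).comp (fderiv ℝ F x)) x :=
    hF.hasFDerivAt.norm_sq
  have h2 := h1.unique (hN'.congr_of_eventuallyEq hN)
  have hx := hN.self_of_nhds
  have key : ∀ j, (dj j F x / F x).re = N' (bv j) / (2 * N x) := by
    intro j
    rw [← h2, ← hx]
    unfold dj
    simp only [smul_apply, ContinuousLinearMap.comp_apply, innerSL_apply_apply, Complex.inner,
      nsmul_eq_mul]
    have hn : Complex.normSq (F x) ≠ 0 := by simpa using h0
    rw [Complex.div_re, ← Complex.normSq_eq_norm_sq]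
    simp only [Complex.mul_re, Complex.conj_re, Complex.conj_im]
    field_simp
    push_cast
    ring
  unfold Mu
  rw [key, key]

lemma Mu_of_norm_one {F : R2 → ℂ} {x : R2} (hF : DifferentiableAt ℝ F x)
    (hN : ∀ᶠ y in 𝓝 x, ‖F y‖ = 1) : Mu F x = 0 := by
  have h0 : F x ≠ 0 := by rw [← norm_pos_iff, hN.self_of_nhds]; exact one_pos
  rw [Mu_eq hF (N := fun _ => 1) (N' := 0) (hN.mono fun y hy => by rw [hy]; norm_num)
    (hasFDerivAt_const _ _) h0]
  simp; rfl

/-- regularised vortex factor -/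
def rv (ε : ℝ) (q : R2 × Bool) (x : R2) : ℂ :=
  vx q x * (((Real.sqrt (‖x - q.1‖ ^ 2 + ε ^ 2))⁻¹ : ℝ) : ℂ)

lemma contDiff_rvaux {ε : ℝ} (hε : 0 < ε) (a : R2) {n : ℕ∞} :
    ContDiff ℝ n (fun x => (Real.sqrt (‖x - a‖ ^ 2 + ε ^ 2))⁻¹) := by
  have h1 : ContDiff ℝ n (fun x : R2 => ‖x - a‖ ^ 2 + ε ^ 2) :=
    ((contDiff_id.sub contDiff_const).norm_sq ℝ).add contDiff_const
  have h2 := h1.sqrt (fun x => by positivity)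
  exact h2.inv (fun x => by positivity)

lemma contDiff_rv {ε : ℝ} (hε : 0 < ε) (q : R2 × Bool) : ContDiff ℝ 1 (rv ε q) := by
  unfold rv
  exact (contDiff_vx q).mul (Complex.ofRealCLM.contDiff.comp (contDiff_rvaux hε q.1 (n := 1)))

lemma norm_rv_sq {ε : ℝ} (hε : 0 < ε) (q : R2 × Bool) (x : R2) :
    ‖rv ε q x‖ ^ 2 = 1 - ε ^ 2 * (‖x - q.1‖ ^ 2 + ε ^ 2)⁻¹ := by
  unfold rv
  have hp : 0 < ‖x - q.1‖ ^ 2 + ε ^ 2 := by positivity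
  rw [norm_mul, norm_vx, Complex.norm_real, mul_pow, norm_inv, Real.norm_of_nonneg (Real.sqrt_nonneg _),
    inv_pow, Real.sq_sqrt hp.le]
  field_simp
  ring

lemma norm_rv_le {ε : ℝ} (hε : 0 < ε) (q : R2 × Bool) (x : R2) : ‖rv ε q x‖ ≤ 1 := by
  have := norm_rv_sq hε q x
  have h2 : 0 ≤ ε ^ 2 * (‖x - q.1‖ ^ 2 + ε ^ 2)⁻¹ := by positivity
  have h3 : ‖rv ε q x‖ ^ 2 ≤ 1 := by linarith
  nlinarith [norm_nonneg (rv ε q x)]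

/-- error term -/
def ee (ε : ℝ) (x : R2) : ℝ := ε ^ 2 / (‖x‖ ^ 2 + ε ^ 2) * ‖x‖⁻¹

lemma norm_Mu_rv {ε : ℝ} (hε : 0 < ε) {q : R2 × Bool} {x : R2} (h : x ≠ q.1) :
    ‖Mu (rv ε q) x‖ = ee ε (x - q.1) := by
  have hp : 0 < ‖x - q.1‖ ^ 2 + ε ^ 2 := by positivity
  have hr : 0 < ‖x - q.1‖ := norm_pos_iff.2 (sub_ne_zero.2 h)
  have h1 : HasFDerivAt (fun y : R2 => ‖y - q.1‖ ^ 2 + ε ^ 2)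
      (2 • (innerSL ℝ (x - q.1))) x := by
    have := ((hasFDerivAt_id x).sub_const q.1).norm_sq
    simpa using this.add_const (ε ^ 2)
  have h2 := ((hasDerivAt_inv hp.ne').comp_hasFDerivAt x h1)
  have h3 := (h2.const_mul (ε ^ 2)).const_sub 1
  have h4 : rv ε q x ≠ 0 := by
    unfold rv
    refine mul_ne_zero (vx_ne h) ?_
    have : (Real.sqrt (‖x - q.1‖ ^ 2 + ε ^ 2))⁻¹ ≠ 0 := by positivity
    exact_mod_cast this
  have h5 := Mu_eq ((contDiff_rv hε q).differentiable one_ne_zero x)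
    (N := fun y => 1 - ε ^ 2 * (‖y - q.1‖ ^ 2 + ε ^ 2)⁻¹) (Eventually.of_forall (norm_rv_sq hε q)) h3 h4
  have h6 : Mu (rv ε q) x = ((ε ^ 2 / (‖x - q.1‖ ^ 2 + ε ^ 2) / ‖x - q.1‖ ^ 2 : ℝ) : ℂ) * cx (x - q.1) := by
    rw [h5]
    apply Complex.ext
    · simp only [Complex.re_ofReal_mul, cx_re]
      simp [EuclideanSpace.inner_single_right]
      field_simp
      ring
    · simp only [Complex.im_ofReal_mul, cx_im]
      simp [EuclideanSpace.inner_single_right]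
      field_simp
      ring
  rw [h6, norm_mul, Complex.norm_real, LinearIsometryEquiv.norm_map, Real.norm_of_nonneg (by positivity)]
  unfold ee
  field_simp

lemma W_rv {ε : ℝ} (hε : 0 < ε) {q : R2 × Bool} {x : R2} (h : x ≠ q.1) :
    W (rv ε q) x = W (vx q) x := by
  unfold rv
  exact W_mul_ofReal (differentiableAt_vx q x)
    ((contDiff_rvaux hε q.1 (n := 1)).differentiable one_ne_zero x) (vx_ne h) (by positivity)

end Part4

section Part5

/-- regular nonvanishing factor -/
structure Good (Ω : Set R2) (g : R2 → ℂ) : Prop where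
  meas : Measurable g
  smooth : ContDiffOn ℝ 1 g Ω
  ne : ∀ x ∈ Ω, g x ≠ 0
  intW : ∀ a ∈ Ω, IntegrableOn (fun x => ‖x - a‖⁻¹ * ‖W g x‖) Ω

lemma ee_nonneg (ε : ℝ) (x : R2) : 0 ≤ ee ε x := by unfold ee; positivity

lemma ee_le (ε : ℝ) (x : R2) : ee ε x ≤ ‖x‖⁻¹ := by
  unfold ee
  have : ε ^ 2 / (‖x‖ ^ 2 + ε ^ 2) ≤ 1 := div_le_one_of_le₀ (by nlinarith [sq_nonneg ‖x‖]) (by positivity)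
  exact mul_le_of_le_one_left (by positivity) this

lemma measurable_ee (ε : ℝ) : Measurable (ee ε) := by
  unfold ee; fun_prop

lemma contDiffOn_nz {Ω : Set R2} {g : R2 → ℂ} (h : ContDiffOn ℝ 1 g Ω) (h0 : ∀ x ∈ Ω, g x ≠ 0) :
    ContDiffOn ℝ 1 (nz g) Ω := by
  have h1 : ContDiffOn ℝ 1 (fun x => ((‖g x‖⁻¹ : ℝ) : ℂ)) Ω :=
    Complex.ofRealCLM.contDiff.comp_contDiffOn
      ((h.norm ℝ h0).inv (fun x hx => by simpa using h0 x hx))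
  have : nz g = fun y => g y * ((‖g y‖⁻¹ : ℝ) : ℂ) := by
    funext y; unfold nz; rw [div_eq_mul_inv]; push_cast; rfl
  rw [this]
  exact h.mul h1

lemma W_nz {g : R2 → ℂ} {x : R2} (h : DifferentiableAt ℝ g x) (h0 : g x ≠ 0) : W (nz g) x = W g x := by
  have : nz g = fun y => g y * ((‖g y‖⁻¹ : ℝ) : ℂ) := by
    funext y; unfold nz; rw [div_eq_mul_inv]; push_cast; rfl
  rw [this]
  refine W_mul_ofReal h ((h.norm ℝ h0).inv (by simpa using h0)) h0 (by simpa using h0)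

/-- approximating maps -/
def vap (g : R2 → ℂ) (S : Finset (R2 × Bool)) (ε : ℝ) (x : R2) : ℂ := nz g x * ∏ q ∈ S, rv ε q x

/-- the bound of the rest of phase gradient -/
def Bq (g : R2 → ℂ) (S : Finset (R2 × Bool)) (q : R2 × Bool) (x : R2) : ℝ :=
  1 + ‖W g x‖ + ∑ q' ∈ S.erase q, ‖x - q'.1‖⁻¹

lemma norm_vap_le (g : R2 → ℂ) (S : Finset (R2 × Bool)) {ε : ℝ} (hε : 0 < ε) (x : R2) :
    ‖vap g S ε x‖ ≤ 1 := by
  unfold vap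
  rw [norm_mul, norm_prod]
  exact mul_le_one₀ (norm_nz_le g x) (Finset.prod_nonneg fun _ _ => norm_nonneg _)
    (Finset.prod_le_one (fun _ _ => norm_nonneg _) fun q _ => norm_rv_le hε q x)

lemma norm_vap_le' (g : R2 → ℂ) (S : Finset (R2 × Bool)) {ε : ℝ} (hε : 0 < ε) (x : R2) {q : R2 × Bool}
    (hq : q ∈ S) : ‖vap g S ε x‖ ≤ ‖rv ε q x‖ := by
  unfold vap
  rw [norm_mul, norm_prod, ← Finset.mul_prod_erase S _ hq]
  calc _ ≤ 1 * (‖rv ε q x‖ * 1) := by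
        gcongr
        · exact norm_nz_le g x
        · exact (Finset.prod_le_one (fun _ _ => norm_nonneg _) fun q _ => norm_rv_le hε q x)
    _ = _ := by ring

set_option maxHeartbeats 1000000 in
lemma aint_vap {g : R2 → ℂ} {S : Finset (R2 × Bool)} {ε : ℝ} (hε : 0 < ε) {x : R2}
    {Ω : Set R2} (hΩ : IsOpen Ω) (hx : x ∈ Ω) (hg : Good Ω g) (hS : ∀ q ∈ S, x ≠ q.1) :
    aint (vap g S ε) x ≤ Real.sqrt (1 + ‖W (fun y => g y * vp S y) x‖ ^ 2) +
      ∑ q ∈ S, (kern ε (x - q.1) + ee ε (x - q.1) * Bq g S q x) := by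
  have hΩx : Ω ∈ 𝓝 x := hΩ.mem_nhds hx
  have hgd : DifferentiableAt ℝ g x := (hg.smooth.differentiableOn one_ne_zero).differentiableAt hΩx
  have hg0 := hg.ne x hx
  have hnd : DifferentiableAt ℝ (nz g) x :=
    ((contDiffOn_nz hg.smooth hg.ne).differentiableOn one_ne_zero).differentiableAt hΩx
  have hn0 : nz g x ≠ 0 := by rw [← norm_pos_iff, norm_nz hg0]; exact one_pos
  have hrd : ∀ q ∈ S, DifferentiableAt ℝ (rv ε q) x := fun q _ =>
    (contDiff_rv hε q).differentiable one_ne_zero x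
  have hr0 : ∀ q ∈ S, rv ε q x ≠ 0 := by
    intro q hq
    unfold rv
    refine mul_ne_zero (vx_ne (hS q hq)) ?_
    have : (Real.sqrt (‖x - q.1‖ ^ 2 + ε ^ 2))⁻¹ ≠ 0 := by positivity
    exact_mod_cast this
  have hpd : DifferentiableAt ℝ (fun y => ∏ q ∈ S, rv ε q y) x :=
    (HasFDerivAt.finsetProd (u := S) fun i hi => (hrd i hi).hasFDerivAt).differentiableAt
  have hp0 : ∏ q ∈ S, rv ε q x ≠ 0 := Finset.prod_ne_zero_iff.2 hr0
  have hWv : W (vap g S ε) x = W g x + ∑ q ∈ S, W (vx q) x := by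
    unfold vap
    rw [W_mul hnd hpd hn0 hp0, W_nz hgd hg0, W_prod hrd hr0]
    congr 1
    exact Finset.sum_congr rfl fun q hq => W_rv hε (hS q hq)
  have hWf : W (fun y => g y * vp S y) x = W g x + ∑ q ∈ S, W (vx q) x := by
    rw [W_mul hgd ((contDiff_vp S (n := 1)).differentiable one_ne_zero x) hg0
      (Finset.prod_ne_zero_iff.2 fun q hq => vx_ne (hS q hq)), W_vp hS]
  have hMu : Mu (vap g S ε) x = ∑ q ∈ S, Mu (rv ε q) x := by
    unfold vap
    rw [Mu_mul hnd hpd hn0 hp0, Mu_prod hrd hr0, Mu_of_norm_one hnd, zero_add]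
    filter_upwards [hΩx] with y hy using norm_nz (hg.ne y hy)
  have hv0 : vap g S ε x ≠ 0 := mul_ne_zero hn0 hp0
  have hv1 := norm_vap_le g S hε x
  refine (aint_le hv0 hv1).trans ?_
  rw [hWf, ← hWv, add_assoc]
  refine add_le_add_right ?_ _
  have hA : ‖vap g S ε x‖ * ‖Mu (vap g S ε) x‖ ≤ ∑ q ∈ S, ee ε (x - q.1) := by
    calc _ ≤ 1 * ∑ q ∈ S, ‖Mu (rv ε q) x‖ := by
          rw [hMu]; gcongr; exact norm_sum_le _ _
      _ = _ := by
          rw [one_mul]; exact Finset.sum_congr rfl fun q hq => norm_Mu_rv hε (hS q hq)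
  have hB : ‖vap g S ε x‖ ^ 2 * |((starRingEnd ℂ (Mu (vap g S ε) x)) * W (vap g S ε) x).im| ≤
      ∑ q ∈ S, (kern ε (x - q.1) + ee ε (x - q.1) * (‖W g x‖ + ∑ q' ∈ S.erase q, ‖x - q'.1‖⁻¹)) := by
    rw [hMu, map_sum, Finset.sum_mul, Complex.im_sum]
    refine (mul_le_mul_of_nonneg_left (Finset.abs_sum_le_sum_abs _ _) (by positivity)).trans ?_
    rw [Finset.mul_sum]
    refine Finset.sum_le_sum fun q hq => ?_
    have hr : 0 < ‖x - q.1‖ := norm_pos_iff.2 (sub_ne_zero.2 (hS q hq))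
    have e1 : ‖W (vap g S ε) x‖ ≤ ‖x - q.1‖⁻¹ + (‖W g x‖ + ∑ q' ∈ S.erase q, ‖x - q'.1‖⁻¹) := by
      rw [hWv]
      have : ‖∑ q ∈ S, W (vx q) x‖ ≤ ∑ q ∈ S, ‖x - q.1‖⁻¹ :=
        (norm_sum_le _ _).trans (Finset.sum_le_sum fun q hq => (norm_W_vx (hS q hq)).le)
      have h4 := Finset.add_sum_erase S (fun q => ‖x - q.1‖⁻¹) hq
      beta_reduce at h4
      have h3 := norm_add_le (W g x) (∑ q ∈ S, W (vx q) x)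
      linarith
    have e2 : |((starRingEnd ℂ (Mu (rv ε q) x)) * W (vap g S ε) x).im| ≤
        ee ε (x - q.1) * (‖x - q.1‖⁻¹ + (‖W g x‖ + ∑ q' ∈ S.erase q, ‖x - q'.1‖⁻¹)) := by
      refine (Complex.abs_im_le_norm _).trans ?_
      rw [norm_mul, RCLike.norm_conj, norm_Mu_rv hε (hS q hq)]
      exact mul_le_mul_of_nonneg_left e1 (ee_nonneg _ _)
    have e3 : ‖vap g S ε x‖ ^ 2 ≤ ‖rv ε q x‖ ^ 2 := by
      have := norm_vap_le' g S hε x hq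
      gcongr
    have e4 : ‖rv ε q x‖ ^ 2 * (ee ε (x - q.1) * ‖x - q.1‖⁻¹) = kern ε (x - q.1) := by
      rw [norm_rv_sq hε]
      unfold ee kern
      have hp : 0 < ‖x - q.1‖ ^ 2 + ε ^ 2 := by positivity
      field_simp
      ring
    have e5 : ‖rv ε q x‖ ^ 2 ≤ 1 := by
      have h7 := norm_rv_le hε q x
      nlinarith [norm_nonneg (rv ε q x)]
    have hT0 : 0 ≤ ‖W g x‖ + ∑ q' ∈ S.erase q, ‖x - q'.1‖⁻¹ :=
      add_nonneg (norm_nonneg _) (Finset.sum_nonneg fun _ _ => by positivity)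
    generalize ‖W g x‖ + ∑ q' ∈ S.erase q, ‖x - q'.1‖⁻¹ = T at hT0 e2 e1 ⊢
    have h9 := mul_nonneg (ee_nonneg ε (x - q.1)) hT0
    have h10 := mul_le_mul_of_nonneg_right e5 h9
    calc _ ≤ ‖rv ε q x‖ ^ 2 * (ee ε (x - q.1) * (‖x - q.1‖⁻¹ + T)) :=
          mul_le_mul e3 e2 (abs_nonneg _) (by positivity)
      _ = kern ε (x - q.1) + ‖rv ε q x‖ ^ 2 * (ee ε (x - q.1) * T) := by rw [← e4]; ring
      _ ≤ kern ε (x - q.1) + 1 * (ee ε (x - q.1) * T) := by linarith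
      _ = _ := by ring
  refine (add_le_add hA hB).trans (le_of_eq ?_)
  rw [← Finset.sum_add_distrib]
  refine Finset.sum_congr rfl fun q _ => ?_
  unfold Bq
  ring

lemma tendsto_rv {q : R2 × Bool} {x : R2} (h : x ≠ q.1) :
    Tendsto (fun k : ℕ => rv (1 / ((k : ℝ) + 1)) q x) atTop (𝓝 (nz (vx q) x)) := by
  have h0 : Tendsto (fun k : ℕ => 1 / ((k : ℝ) + 1)) atTop (𝓝 0) :=
    tendsto_one_div_add_atTop_nhds_zero_nat (𝕜 := ℝ)
  have hr : 0 < ‖x - q.1‖ := norm_pos_iff.2 (sub_ne_zero.2 h)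
  have h1 : Tendsto (fun k : ℕ => (Real.sqrt (‖x - q.1‖ ^ 2 + (1 / ((k : ℝ) + 1)) ^ 2))⁻¹) atTop
      (𝓝 (Real.sqrt (‖x - q.1‖ ^ 2 + 0 ^ 2))⁻¹) := by
    refine Tendsto.inv₀ ?_ (by positivity)
    exact (Real.continuous_sqrt.tendsto _).comp ((h0.pow 2).const_add _)
  have h2 := ((Complex.continuous_ofReal.tendsto _).comp h1).const_mul (vx q x)
  have h3 : nz (vx q) x = vx q x * (((Real.sqrt (‖x - q.1‖ ^ 2 + 0 ^ 2))⁻¹ : ℝ) : ℂ) := by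
    unfold nz
    rw [norm_vx]
    simp [Real.sqrt_sq hr.le, div_eq_mul_inv]
  rw [h3]
  exact h2

lemma tendsto_ee {x : R2} (h : x ≠ 0) :
    Tendsto (fun k : ℕ => ee (1 / ((k : ℝ) + 1)) x) atTop (𝓝 0) := by
  have h0 : Tendsto (fun k : ℕ => 1 / ((k : ℝ) + 1)) atTop (𝓝 0) :=
    tendsto_one_div_add_atTop_nhds_zero_nat (𝕜 := ℝ)
  have hr : 0 < ‖x‖ := norm_pos_iff.2 h
  have : Tendsto (fun k : ℕ => ee (1 / ((k : ℝ) + 1)) x) atTop (𝓝 ((0:ℝ) ^ 2 / (‖x‖ ^ 2 + (0:ℝ) ^ 2) * ‖x‖⁻¹)) := by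
    unfold ee
    refine Tendsto.mul_const _ (Tendsto.div (h0.pow 2) ((h0.pow 2).const_add _) (by positivity))
  simpa using this

lemma ae_ne_of_finset (S : Finset (R2 × Bool)) (μ : Measure R2) [NullSingletonClass μ] :
    ∀ᵐ x ∂μ, ∀ q ∈ S, x ≠ q.1 := by
  rw [Filter.eventually_all_finset]
  intro q _
  simp [ae_iff]

lemma nz_finset_prod {ι : Type*} (S : Finset ι) (F : ι → R2 → ℂ) (x : R2) :
    nz (fun y => ∏ i ∈ S, F i y) x = ∏ i ∈ S, nz (F i) x := by
  unfold nz
  rw [Finset.prod_div_distrib, norm_prod]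
  push_cast; rfl

lemma Ok_vp {Ω : Set R2} (hΩ : IsOpen Ω) (hΩb : Bornology.IsBounded Ω) {g : R2 → ℂ} (hg : Good Ω g)
    {S : Finset (R2 × Bool)} (hS : ∀ q ∈ S, q.1 ∈ Ω) (hinj : ∀ q ∈ S, ∀ q' ∈ S, q.1 = q'.1 → q = q') :
    Ok Ω (nz (fun y => g y * vp S y)) (W (fun y => g y * vp S y))
      (ENNReal.ofReal (Real.pi * S.card)) := by
  have hεp : ∀ k : ℕ, 0 < 1 / ((k : ℝ) + 1) := fun k => by positivity
  have hfin : IsFiniteMeasure (volume.restrict Ω) :=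
    ⟨by rw [Measure.restrict_apply_univ]; exact hΩb.measure_lt_top⟩
  have haeS := ae_ne_of_finset S (volume.restrict Ω)
  have hmv : ∀ k : ℕ, Measurable (vap g S (1 / ((k : ℝ) + 1))) := by
    intro k
    unfold vap
    refine (measurable_nz hg.meas).mul (Finset.measurable_prod _ fun q _ => ?_)
    exact (contDiff_rv (hεp k) q).continuous.measurable
  have hmf : Measurable (fun y => g y * vp S y) :=
    hg.meas.mul (contDiff_vp S (n := 1)).continuous.measurable
  have hmn := measurable_nz hmf
  -- convergence of the maps
  have T1 : Tendsto (fun k : ℕ => ∫⁻ x in Ω, ‖vap g S (1 / ((k : ℝ) + 1)) x - nz (fun y => g y * vp S y) x‖ₑ)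
      atTop (𝓝 0) := by
    have : Tendsto (fun k : ℕ => ∫⁻ x in Ω, ‖vap g S (1 / ((k : ℝ) + 1)) x - nz (fun y => g y * vp S y) x‖ₑ)
      atTop (𝓝 (∫⁻ x in Ω, 0)) := by
      refine tendsto_lintegral_of_dominated_convergence (fun _ => 2) ?_ ?_ ?_ ?_
      · intro k
        exact ((hmv k).sub hmn).enorm
      · intro k
        refine ae_of_all _ fun x => ?_
        beta_reduce
        rw [← ofReal_norm, ← ENNReal.ofReal_ofNat]
        refine ENNReal.ofReal_le_ofReal ?_
        have a := norm_vap_le g S (hεp k) x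
        have b := norm_nz_le (fun y => g y * vp S y) x
        have c := norm_sub_le (vap g S (1 / ((k : ℝ) + 1)) x) (nz (fun y => g y * vp S y) x)
        linarith
      · simpa using ENNReal.mul_ne_top (by simp) hΩb.measure_lt_top.ne
      · filter_upwards [haeS] with x hx
        have h1 : Tendsto (fun k : ℕ => vap g S (1 / ((k : ℝ) + 1)) x) atTop
            (𝓝 (nz (fun y => g y * vp S y) x)) := by
          rw [nz_mul g (vp S)]
          have : nz (vp S) x = ∏ q ∈ S, nz (vx q) x := nz_finset_prod S vx x
          rw [this]
          exact (tendsto_finsetProd S fun q hq => tendsto_rv (hx q hq)).const_mul _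
        have h2 := (h1.sub_const (nz (fun y => g y * vp S y) x)).enorm
        simpa using h2
    simpa using this
  -- convergence of errors
  have hBint : ∀ q ∈ S, IntegrableOn (fun x => ‖x - q.1‖⁻¹ * Bq g S q x) Ω := by
    intro q hq
    unfold Bq
    simp only [mul_add, mul_one, Finset.mul_sum]
    refine ((integrableOn_inv_norm q.1 hΩb).add (hg.intW q.1 (hS q hq))).add ?_
    refine integrable_finsetSum _ fun q' hq' => ?_
    rw [Finset.mem_erase] at hq'
    exact inv_mul_inv_integrable (fun e => hq'.1 (hinj q hq q' hq'.2 e).symm) hΩb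
  have hB0 : ∀ q x, 0 ≤ Bq g S q x := fun q x => by
    unfold Bq
    have : 0 ≤ ∑ q' ∈ S.erase q, ‖x - q'.1‖⁻¹ := Finset.sum_nonneg fun _ _ => by positivity
    positivity
  have hmB : ∀ q, Measurable (Bq g S q) := fun q => by
    unfold Bq
    have := measurable_W hg.meas
    refine (measurable_const.add this.norm).add (Finset.measurable_sum _ fun q _ => ?_)
    fun_prop
  have hmE : ∀ (ε : ℝ) q, Measurable (fun x => ENNReal.ofReal (ee ε (x - q.1) * Bq g S q x)) := by
    intro ε q
    exact (((measurable_ee ε).comp (measurable_id.sub_const _)).mul (hmB q)).ennreal_ofReal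
  have T2 : Tendsto (fun k : ℕ => ∑ q ∈ S, ∫⁻ x in Ω, ENNReal.ofReal (ee (1 / ((k : ℝ) + 1)) (x - q.1) * Bq g S q x))
      atTop (𝓝 0) := by
    have : Tendsto (fun k : ℕ => ∑ q ∈ S, ∫⁻ x in Ω, ENNReal.ofReal (ee (1 / ((k : ℝ) + 1)) (x - q.1) * Bq g S q x))
      atTop (𝓝 (∑ q ∈ S, ∫⁻ x in Ω, 0)) := by
      refine tendsto_finsetSum _ fun q hq => ?_
      refine tendsto_lintegral_of_dominated_convergence
        (fun x => ENNReal.ofReal (‖x - q.1‖⁻¹ * Bq g S q x)) (fun k => hmE _ q) ?_ ?_ ?_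
      · intro k
        refine ae_of_all _ fun x => ENNReal.ofReal_le_ofReal ?_
        exact mul_le_mul_of_nonneg_right (ee_le _ _) (hB0 q x)
      · exact (hBint q hq).lintegral_lt_top.ne
      · filter_upwards [haeS] with x hx
        have := (tendsto_ee (sub_ne_zero.2 (hx q hq))).mul_const (Bq g S q x)
        rw [zero_mul] at this
        simpa using ENNReal.tendsto_ofReal this
    simpa using this
  intro η hη
  have E1 := (tendsto_order.1 T1).2 η hη
  have E2 := (tendsto_order.1 T2).2 η hη
  obtain ⟨k, k1, k2⟩ := (E1.and E2).exists
  set ε := 1 / ((k : ℝ) + 1) with hεd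
  have hε : 0 < ε := hεp k
  refine ⟨vap g S ε, ?_, fun x _ => norm_vap_le g S hε x, k1.le, ?_⟩
  · unfold vap
    exact (contDiffOn_nz hg.smooth hg.ne).mul
      (contDiff_prod fun q _ => contDiff_rv hε q).contDiffOn
  · have hmW : Measurable (W (fun y => g y * vp S y)) := measurable_W hmf
    calc ∫⁻ x in Ω, ENNReal.ofReal (aint (vap g S ε) x)
        ≤ ∫⁻ x in Ω, (ENNReal.ofReal (Real.sqrt (1 + ‖W (fun y => g y * vp S y) x‖ ^ 2)) +
          ∑ q ∈ S, (ENNReal.ofReal (kern ε (x - q.1)) + ENNReal.ofReal (ee ε (x - q.1) * Bq g S q x))) := by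
          refine lintegral_mono_ae ?_
          filter_upwards [haeS, ae_restrict_mem hΩ.measurableSet] with x hx hxΩ
          refine (ENNReal.ofReal_le_ofReal (aint_vap hε hΩ hxΩ hg hx)).trans ?_
          refine ENNReal.ofReal_add_le.trans (add_le_add_right ?_ _)
          rw [ENNReal.ofReal_sum_of_nonneg fun q _ => add_nonneg (kern_nonneg _ _)
            (mul_nonneg (ee_nonneg _ _) (hB0 q x))]
          exact Finset.sum_le_sum fun q _ => ENNReal.ofReal_add_le
      _ = (∫⁻ x in Ω, ENNReal.ofReal (Real.sqrt (1 + ‖W (fun y => g y * vp S y) x‖ ^ 2))) +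
          ∑ q ∈ S, ((∫⁻ x in Ω, ENNReal.ofReal (kern ε (x - q.1))) +
            ∫⁻ x in Ω, ENNReal.ofReal (ee ε (x - q.1) * Bq g S q x)) := by
          have hk : ∀ q : R2 × Bool, Measurable (fun x => ENNReal.ofReal (kern ε (x - q.1))) := fun q =>
            ((continuous_kern hε).measurable.comp (measurable_id.sub_const _)).ennreal_ofReal
          rw [lintegral_add_left (by fun_prop), lintegral_finsetSum]
          · congr 1
            exact Finset.sum_congr rfl fun q _ => lintegral_add_left (hk q) _
          · exact fun q _ => (hk q).add (hmE ε q)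
      _ ≤ (∫⁻ x in Ω, ENNReal.ofReal (Real.sqrt (1 + ‖W (fun y => g y * vp S y) x‖ ^ 2))) +
          ((∑ q ∈ S, ENNReal.ofReal Real.pi) + η) := by
          rw [Finset.sum_add_distrib]
          gcongr with q hq
          refine le_trans ?_ (kern_lintegral hε q.1).le
          exact setLIntegral_le_lintegral _ _
      _ = _ := by
          rw [← add_assoc, Finset.sum_const, nsmul_eq_mul, mul_comm Real.pi,
            ENNReal.ofReal_mul (by positivity), ENNReal.ofReal_natCast]

end Part5

section Part6

/-! ### Closure properties of `Good` -/

lemma Good.diffAt {Ω : Set R2} (hΩ : IsOpen Ω) {g : R2 → ℂ} (hg : Good Ω g) {x : R2} (hx : x ∈ Ω) :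
    DifferentiableAt ℝ g x :=
  (hg.smooth.differentiableOn one_ne_zero).differentiableAt (hΩ.mem_nhds hx)

lemma Good.mul {Ω : Set R2} (hΩ : IsOpen Ω) {g h : R2 → ℂ} (hg : Good Ω g) (hh : Good Ω h) :
    Good Ω (fun x => g x * h x) where
  meas := hg.meas.mul hh.meas
  smooth := hg.smooth.mul hh.smooth
  ne := fun x hx => mul_ne_zero (hg.ne x hx) (hh.ne x hx)
  intW := by
    intro a ha
    refine ((hg.intW a ha).add (hh.intW a ha)).mono' ?_ ?_
    · have : Measurable (W (fun x => g x * h x)) := measurable_W (hg.meas.mul hh.meas)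
      have h2 : Measurable (fun x => ‖x - a‖⁻¹ * ‖W (fun x => g x * h x) x‖) := by fun_prop
      exact h2.aestronglyMeasurable
    · filter_upwards [ae_restrict_mem hΩ.measurableSet] with x hx
      rw [W_mul (hg.diffAt hΩ hx) (hh.diffAt hΩ hx) (hg.ne x hx) (hh.ne x hx),
        Real.norm_of_nonneg (by positivity)]
      simp only [Pi.add_apply]
      rw [← mul_add]
      gcongr
      exact norm_add_le _ _

lemma Good.of_bound {Ω : Set R2} (hΩ : IsOpen Ω) (hΩb : Bornology.IsBounded Ω) {g : R2 → ℂ}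
    (h1 : Measurable g) (h2 : ContDiffOn ℝ 1 g Ω) (h3 : ∀ x ∈ Ω, g x ≠ 0) {C : ℝ}
    (h4 : ∀ x ∈ Ω, ‖W g x‖ ≤ C) : Good Ω g where
  meas := h1
  smooth := h2
  ne := h3
  intW := by
    intro a ha
    refine ((integrableOn_inv_norm a hΩb).mul_const C).mono' ?_ ?_
    · have := measurable_W h1
      have h2 : Measurable (fun x => ‖x - a‖⁻¹ * ‖W g x‖) := by fun_prop
      exact h2.aestronglyMeasurable
    · filter_upwards [ae_restrict_mem hΩ.measurableSet] with x hx
      rw [Real.norm_of_nonneg (by positivity)]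
      have := h4 x hx
      gcongr

lemma Good.of_smooth {Ω : Set R2} (hΩ : IsOpen Ω) (hΩb : Bornology.IsBounded Ω) {g : R2 → ℂ}
    (h1 : ContDiff ℝ 1 g) (h3 : ∀ x ∈ closure Ω, g x ≠ 0) : Good Ω g := by
  have hc : IsCompact (closure Ω) := hΩb.isCompact_closure
  have hcont : ContinuousOn (fun x => 2 * (‖fderiv ℝ g x‖ / ‖g x‖)) (closure Ω) := by
    have := (h1.continuous_fderiv one_ne_zero).norm.continuousOn (s := closure Ω)
    exact (this.div h1.continuous.norm.continuousOn (fun x hx => by simpa using h3 x hx)).const_smul (2:ℝ)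
  obtain ⟨C, hC⟩ := hc.exists_bound_of_continuousOn hcont
  refine Good.of_bound hΩ hΩb h1.continuous.measurable h1.contDiffOn
    (fun x hx => h3 x (subset_closure hx)) (C := C) fun x hx => ?_
  exact (norm_W_le g x).trans ((le_abs_self _).trans (hC x (subset_closure hx)))

lemma Good.vx {Ω : Set R2} (hΩ : IsOpen Ω) (hΩb : Bornology.IsBounded Ω) {q : R2 × Bool} (hq : q.1 ∉ Ω) :
    Good Ω (vx q) where
  meas := (contDiff_vx q (n := 1)).continuous.measurable
  smooth := (contDiff_vx q).contDiffOn
  ne := fun x hx => vx_ne (fun e => hq (e ▸ hx))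
  intW := by
    intro a ha
    have hne : a ≠ q.1 := fun e => hq (e ▸ ha)
    refine (inv_mul_inv_integrable hne hΩb).congr_fun ?_ hΩ.measurableSet
    intro x hx
    beta_reduce
    rw [norm_W_vx (fun e => hq (e ▸ hx))]

/-! ### The dipole phase -/

section param
variable {F : R2 → ℝ → ℝ} {F' : R2 → ℝ → R2 →L[ℝ] ℝ}

lemma hasFDerivAt_param (hF : Continuous (Function.uncurry F)) (hF' : Continuous (Function.uncurry F'))
    (hd : ∀ x s, HasFDerivAt (fun y => F y s) (F' x s) x) (x : R2) :
    HasFDerivAt (fun y => ∫ s in (0:ℝ)..1, F y s) (∫ s in (0:ℝ)..1, F' x s) x := by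
  obtain ⟨C, hC⟩ := ((isCompact_closedBall x 1).prod (isCompact_Icc (a := (0:ℝ)) (b := 1))).exists_bound_of_continuousOn
    hF'.continuousOn
  have hFx : ∀ y, Continuous (F y) := fun y => hF.comp (by fun_prop : Continuous fun s : ℝ => (y, s))
  have hFx' : ∀ y, Continuous (F' y) := fun y => hF'.comp (by fun_prop : Continuous fun s : ℝ => (y, s))
  refine intervalIntegral.hasFDerivAt_integral_of_dominated_of_fderiv_le (bound := fun _ => C)
    (closedBall_mem_nhds x one_pos) ?_ ?_ ?_ ?_ ?_ ?_
  · exact Eventually.of_forall fun y => (hFx y).aestronglyMeasurable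
  · exact (hFx x).intervalIntegrable _ _
  · exact (hFx' x).aestronglyMeasurable
  · refine ae_of_all _ fun t ht y hy => ?_
    rw [uIoc_of_le zero_le_one] at ht
    exact hC (y, t) ⟨hy, Ioc_subset_Icc_self ht⟩
  · exact intervalIntegrable_const
  · exact ae_of_all _ fun t _ y _ => hd y t

lemma contDiff_param (hF : Continuous (Function.uncurry F)) (hF' : Continuous (Function.uncurry F'))
    (hd : ∀ x s, HasFDerivAt (fun y => F y s) (F' x s) x) :
    ContDiff ℝ 1 (fun y => ∫ s in (0:ℝ)..1, F y s) := by
  rw [contDiff_one_iff_hasFDerivAt]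
  exact ⟨_, intervalIntegral.continuous_parametric_intervalIntegral_of_continuous' hF' 0 1,
    hasFDerivAt_param hF hF' hd⟩

end param

/-- the functional `Im (conj D · h)` -/
def KD (a b : R2) : R2 →L[ℝ] ℝ :=
  Complex.imCLM.comp ((ContinuousLinearMap.mul ℝ ℂ (starRingEnd ℂ (cx (b - a)))).comp
    (cx.toContinuousLinearEquiv : R2 →L[ℝ] ℂ))

lemma KD_apply (a b h : R2) : KD a b h = ((starRingEnd ℂ (cx (b - a))) * cx h).im := rfl

/-- distance squared to the moving point, regularised -/
def Ns (a b : R2) (δ : ℝ) (x : R2) (s : ℝ) : ℝ := ‖x - (a + s • (b - a))‖ ^ 2 + δ ^ 2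

lemma Ns_pos (a b : R2) {δ : ℝ} (hδ : 0 < δ) (x : R2) (s : ℝ) : 0 < Ns a b δ x s := by
  unfold Ns; positivity

lemma continuous_Ns (a b : R2) (δ : ℝ) : Continuous (Function.uncurry (Ns a b δ)) := by
  unfold Ns Function.uncurry
  fun_prop

/-- integrand of the dipole phase -/
def Bs (a b : R2) (δ : ℝ) (x : R2) (s : ℝ) : ℝ := - (KD a b (x - a) * (Ns a b δ x s)⁻¹)

/-- its derivative -/
def Bs' (a b : R2) (δ : ℝ) (x : R2) (s : ℝ) : R2 →L[ℝ] ℝ :=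
  - ((Ns a b δ x s)⁻¹ • KD a b) +
    (2 * KD a b (x - a) * ((Ns a b δ x s) ^ 2)⁻¹) • innerSL ℝ (x - (a + s • (b - a)))

lemma hasFDerivAt_Bs (a b : R2) {δ : ℝ} (hδ : 0 < δ) (x : R2) (s : ℝ) :
    HasFDerivAt (fun y => Bs a b δ y s) (Bs' a b δ x s) x := by
  have h1 : HasFDerivAt (fun y : R2 => Ns a b δ y s) (2 • (innerSL ℝ (x - (a + s • (b - a))))) x := by
    have := ((hasFDerivAt_id x).sub_const (a + s • (b - a))).norm_sq
    exact (this.add_const (δ ^ 2)).congr_fderiv (by simp)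
  have h2 := ((hasDerivAt_inv (Ns_pos a b hδ x s).ne').comp_hasFDerivAt x h1)
  have h3 : HasFDerivAt (fun y : R2 => KD a b (y - a)) (KD a b) x := by
    exact ((KD a b).hasFDerivAt.comp x ((hasFDerivAt_id x).sub_const a)).congr_fderiv (by ext; simp)
  have h4 := (h3.mul h2).neg
  refine h4.congr_fderiv ?_
  ext h
  simp [Bs']
  ring

lemma continuous_Bs (a b : R2) {δ : ℝ} (hδ : 0 < δ) : Continuous (Function.uncurry (Bs a b δ)) := by
  have h1 := (continuous_Ns a b δ).inv₀ (fun p => (Ns_pos a b hδ p.1 p.2).ne')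
  have h2 : Continuous (fun p : R2 × ℝ => KD a b (p.1 - a)) := by fun_prop
  exact (h2.mul h1).neg

lemma continuous_Bs' (a b : R2) {δ : ℝ} (hδ : 0 < δ) : Continuous (Function.uncurry (Bs' a b δ)) := by
  have h1 := (continuous_Ns a b δ).inv₀ (fun p => (Ns_pos a b hδ p.1 p.2).ne')
  have h1' := ((continuous_Ns a b δ).pow 2).inv₀ (fun p => (pow_pos (Ns_pos a b hδ p.1 p.2) 2).ne')
  have h2 : Continuous (fun p : R2 × ℝ => 2 * KD a b (p.1 - a)) := by fun_prop
  have h3 : Continuous (fun p : R2 × ℝ => innerSL ℝ (p.1 - (a + p.2 • (b - a)))) := by fun_prop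
  exact ((h1.smul continuous_const).neg).add ((h2.mul h1').smul h3)

/-- the dipole phase -/
def bet (a b : R2) (δ : ℝ) (x : R2) : ℝ := ∫ s in (0:ℝ)..1, Bs a b δ x s

lemma contDiff_bet (a b : R2) {δ : ℝ} (hδ : 0 < δ) : ContDiff ℝ 1 (bet a b δ) :=
  contDiff_param (continuous_Bs a b hδ) (continuous_Bs' a b hδ) (hasFDerivAt_Bs a b hδ)

lemma gradient_Bs (a b : R2) {δ : ℝ} (hδ : 0 < δ) (x : R2) (s : ℝ) :
    HasDerivAt (fun s : ℝ => - (Complex.I * cx (x - (a + s • (b - a))) * (((Ns a b δ x s)⁻¹ : ℝ) : ℂ)))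
      ((⟨Bs' a b δ x s (bv 0), Bs' a b δ x s (bv 1)⟩ : ℂ) +
        2 * Complex.I * cx (b - a) * ((kern δ (x - (a + s • (b - a))) : ℝ) : ℂ)) s := by
  have hN := Ns_pos a b hδ x s
  have h0 : HasDerivAt (fun s : ℝ => x - (a + s • (b - a))) (-(b - a)) s := by
    have := (((hasDerivAt_id s).smul_const (b - a)).const_add a).const_sub x
    simpa using this
  have h1 : HasDerivAt (fun s : ℝ => cx (x - (a + s • (b - a)))) (cx (-(b - a))) s :=
    (hasFDerivAt_cx _).comp_hasDerivAt s h0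
  have h2 : HasDerivAt (fun s : ℝ => Ns a b δ x s) (2 * inner ℝ (x - (a + s • (b - a))) (-(b - a))) s :=
    h0.norm_sq.add_const (δ ^ 2)
  have h3 : HasDerivAt (fun s : ℝ => (((Ns a b δ x s)⁻¹ : ℝ) : ℂ)) _ s := (h2.inv hN.ne').ofReal_comp
  have h4 := ((h1.const_mul Complex.I).mul h3).neg
  refine h4.congr_deriv ?_
  have hk : kern δ (x - (a + s • (b - a))) = δ ^ 2 / (Ns a b δ x s) ^ 2 := rfl
  have hNe : Ns a b δ x s = (x - (a + s • (b - a))) 0 ^ 2 + (x - (a + s • (b - a))) 1 ^ 2 + δ ^ 2 := by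
    unfold Ns
    rw [EuclideanSpace.real_norm_sq_eq, Fin.sum_univ_two]
  have hin : inner ℝ (x - (a + s • (b - a))) (-(b - a)) =
     -((x - (a + s • (b - a))) 0 * (b - a) 0 + (x - (a + s • (b - a))) 1 * (b - a) 1) := by
    rw [inner_neg_right]
    simp [PiLp.inner_apply, Fin.sum_univ_two]
    ring
  have hK : KD a b (x - a) = (b - a) 0 * (x - (a + s • (b - a))) 1 - (b - a) 1 * (x - (a + s • (b - a))) 0 := by
    rw [KD_apply]
    simp [cx_re, cx_im]
    ring
  have hB : ∀ j, Bs' a b δ x s (bv j) = - ((Ns a b δ x s)⁻¹ * KD a b (bv j)) +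
     (2 * KD a b (x - a) * ((Ns a b δ x s) ^ 2)⁻¹) * (x - (a + s • (b - a))) j := by
    intro j
    simp [Bs', EuclideanSpace.inner_single_right]
  have hK0 : KD a b (bv 0) = - (b - a) 1 := by
    rw [KD_apply, cx_bv0]; simp only [mul_one, Complex.conj_im, cx_im]
  have hK1 : KD a b (bv 1) = (b - a) 0 := by
    rw [KD_apply, cx_bv1]; simp only [Complex.mul_I_im, Complex.conj_re, cx_re]
  rw [hB, hB, hK0, hK1, hK, hin, hk, map_neg]
  set X := x - (a + s • (b - a)) with hX
  set D := b - a with hD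
  set N := Ns a b δ x s with hNd
  have hδ2 : δ ^ 2 = N - (X 0 ^ 2 + X 1 ^ 2) := by rw [hNe]; ring
  rw [hδ2]
  apply Complex.ext
  · simp only [Complex.add_re, Complex.neg_re, Complex.mul_re, Complex.I_re, Complex.I_im,
      Complex.ofReal_re, Complex.ofReal_im, Complex.mul_im, cx_re, cx_im, Complex.re_ofNat,
      Complex.im_ofNat, Complex.neg_im, Complex.add_im]
    field_simp
    ring
  · simp only [Complex.add_re, Complex.neg_re, Complex.mul_re, Complex.I_re, Complex.I_im,
      Complex.ofReal_re, Complex.ofReal_im, Complex.mul_im, cx_re, cx_im, Complex.re_ofNat,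
      Complex.im_ofNat, Complex.neg_im, Complex.add_im]
    field_simp
    ring

end Part6

section Part7

/-- the smooth replacement of a dipole -/
def eb (a b : R2) (δ : ℝ) (x : R2) : ℂ := Complex.exp (Complex.I * (bet a b δ x : ℂ))

/-- dipole -/
def dp (a b : R2) (x : R2) : ℂ := vx (a, true) x * vx (b, false) x

lemma contDiff_eb (a b : R2) {δ : ℝ} (hδ : 0 < δ) : ContDiff ℝ 1 (eb a b δ) := by
  unfold eb
  exact (contDiff_const.mul (Complex.ofRealCLM.contDiff.comp (contDiff_bet a b hδ))).cexp

lemma norm_eb (a b : R2) (δ : ℝ) (x : R2) : ‖eb a b δ x‖ = 1 := by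
  unfold eb
  rw [mul_comm]; exact Complex.norm_exp_ofReal_mul_I _

lemma eb_ne (a b : R2) (δ : ℝ) (x : R2) : eb a b δ x ≠ 0 := Complex.exp_ne_zero _

lemma continuous_kern_seg (a b : R2) {δ : ℝ} (hδ : 0 < δ) :
    Continuous (fun p : R2 × ℝ => kern δ (p.1 - (a + p.2 • (b - a)))) :=
  (continuous_kern hδ).comp (by fun_prop)

lemma continuous_kern_seg1 (a b : R2) {δ : ℝ} (hδ : 0 < δ) (x : R2) :
    Continuous (fun s : ℝ => kern δ (x - (a + s • (b - a)))) := by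
  have h := continuous_kern hδ
  have h2 : Continuous (fun s : ℝ => x - (a + s • (b - a))) := by fun_prop
  exact h.comp h2

lemma continuous_Bs1 (a b : R2) {δ : ℝ} (hδ : 0 < δ) (x : R2) :
    Continuous (Bs' a b δ x) := by
  have h := continuous_Bs' a b hδ
  have h2 : Continuous (fun s : ℝ => (x, s)) := by fun_prop
  generalize Bs' a b δ = B at h ⊢
  exact h.comp h2

lemma integral_re_im {B : ℝ → R2 →L[ℝ] ℝ} (hB : Continuous B) {w : ℂ}
    (hw : w = ⟨(∫ s in (0:ℝ)..1, B s) (bv 0), (∫ s in (0:ℝ)..1, B s) (bv 1)⟩) :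
    w = ∫ s in (0:ℝ)..1, (⟨B s (bv 0), B s (bv 1)⟩ : ℂ) := by
  have hcV : Continuous (fun s => (⟨B s (bv 0), B s (bv 1)⟩ : ℂ)) := by
    have : (fun s => (⟨B s (bv 0), B s (bv 1)⟩ : ℂ)) =
      fun s => ((B s (bv 0) : ℝ) : ℂ) + ((B s (bv 1) : ℝ) : ℂ) * Complex.I := by
      funext s; apply Complex.ext <;> simp
    rw [this]
    fun_prop
  rw [hw, ContinuousLinearMap.intervalIntegral_apply (hB.intervalIntegrable _ _),
    ContinuousLinearMap.intervalIntegral_apply (hB.intervalIntegrable _ _)]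
  apply Complex.ext
  · exact (Complex.reCLM.intervalIntegral_comp_comm (hcV.intervalIntegrable 0 1))
  · exact (Complex.imCLM.intervalIntegral_comp_comm (hcV.intervalIntegrable 0 1))

set_option maxHeartbeats 1000000 in
lemma W_eb (a b : R2) {δ : ℝ} (hδ : 0 < δ) (x : R2) :
    W (eb a b δ) x = Complex.I * cx (x - a) * (((‖x - a‖ ^ 2 + δ ^ 2)⁻¹ : ℝ) : ℂ)
      - Complex.I * cx (x - b) * (((‖x - b‖ ^ 2 + δ ^ 2)⁻¹ : ℝ) : ℂ)
      - 2 * Complex.I * cx (b - a) * ((∫ s in (0:ℝ)..1, kern δ (x - (a + s • (b - a))) : ℝ) : ℂ) := by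
  have hd := hasFDerivAt_param (continuous_Bs a b hδ) (continuous_Bs' a b hδ) (hasFDerivAt_Bs a b hδ) x
  have hc' : Continuous (Bs' a b δ x) :=
    continuous_Bs1 a b hδ x
  have hcj : ∀ j, Continuous (fun s => Bs' a b δ x s (bv j)) := fun j => hc'.clm_apply continuous_const
  have hk : Continuous (fun s : ℝ => kern δ (x - (a + s • (b - a)))) :=
    continuous_kern_seg1 a b hδ x
  have hfd : fderiv ℝ (bet a b δ) x = ∫ s in (0:ℝ)..1, Bs' a b δ x s := hd.fderiv
  have h1 : W (eb a b δ) x = ⟨fderiv ℝ (bet a b δ) x (bv 0), fderiv ℝ (bet a b δ) x (bv 1)⟩ :=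
    W_exp ((contDiff_bet a b hδ).differentiable one_ne_zero x)
  have hcV : Continuous (fun s => (⟨Bs' a b δ x s (bv 0), Bs' a b δ x s (bv 1)⟩ : ℂ)) := by
    have : (fun s => (⟨Bs' a b δ x s (bv 0), Bs' a b δ x s (bv 1)⟩ : ℂ)) =
      fun s => ((Bs' a b δ x s (bv 0) : ℝ) : ℂ) + ((Bs' a b δ x s (bv 1) : ℝ) : ℂ) * Complex.I := by
      funext s; apply Complex.ext <;> simp
    rw [this]
    have h0 := hcj 0
    have h1 := hcj 1
    fun_prop
  have h2 : W (eb a b δ) x = ∫ s in (0:ℝ)..1, (⟨Bs' a b δ x s (bv 0), Bs' a b δ x s (bv 1)⟩ : ℂ) := by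
    refine integral_re_im hc' ?_
    rw [h1, hfd]
  have hkc : Continuous (fun s : ℝ => 2 * Complex.I * cx (b - a) *
     ((kern δ (x - (a + s • (b - a))) : ℝ) : ℂ)) := by fun_prop
  have h3 := intervalIntegral.integral_eq_sub_of_hasDerivAt (a := 0) (b := 1)
    (fun s _ => gradient_Bs a b hδ x s) ((hcV.add hkc).intervalIntegrable _ _)
  rw [intervalIntegral.integral_add (hcV.intervalIntegrable _ _) (hkc.intervalIntegrable _ _), ← h2,
    intervalIntegral.integral_const_mul, intervalIntegral.integral_ofReal] at h3
  have e1 : x - (a + (1:ℝ) • (b - a)) = x - b := by rw [one_smul]; abel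
  have e0 : x - (a + (0:ℝ) • (b - a)) = x - a := by rw [zero_smul, add_zero]
  simp only [Ns, e1, e0] at h3
  generalize (∫ s in (0:ℝ)..1, kern δ (x - (a + s • (b - a)))) = K at h3 ⊢
  generalize W (eb a b δ) x = w at h3 ⊢
  linear_combination h3

lemma W_vx_true {a x : R2} (h : x ≠ a) :
    W (vx (a, true)) x = Complex.I * cx (x - a) * (((‖x - a‖ ^ 2)⁻¹ : ℝ) : ℂ) := by
  have h' : cx x ≠ cx a := fun e => h (cx.injective e)
  have h0 : cx (x - a) ≠ 0 := by rw [map_sub, sub_ne_zero]; exact h'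
  have : vx (a, true) = fun y => cx y - cx a := by funext y; simp [vx]
  rw [this, W_lin h', ← map_sub]
  have h1 : (((‖x - a‖ ^ 2)⁻¹ : ℝ) : ℂ) = (cx (x - a) * starRingEnd ℂ (cx (x - a)))⁻¹ := by
    rw [Complex.mul_conj, Complex.normSq_eq_norm_sq, LinearIsometryEquiv.norm_map]
    push_cast; rfl
  have h2 : starRingEnd ℂ (cx (x - a)) ≠ 0 := (map_ne_zero _).2 h0
  rw [h1]
  field_simp

lemma W_vx_false {a x : R2} : W (vx (a, false)) x = - W (vx (a, true)) x := by
  have h1 : vx (a, false) = fun y => starRingEnd ℂ (vx (a, true) y) := by funext y; simp [vx]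
  rw [h1, W_conj (differentiableAt_vx _ x)]

lemma W_eb_sub (a b : R2) {δ : ℝ} (hδ : 0 < δ) {x : R2} (ha : x ≠ a) (hb : x ≠ b) :
    ‖W (eb a b δ) x - W (dp a b) x‖ ≤ ee δ (x - a) + ee δ (x - b) +
      2 * ‖b - a‖ * ∫ s in (0:ℝ)..1, kern δ (x - (a + s • (b - a))) := by
  have h1 : W (dp a b) x = Complex.I * cx (x - a) * (((‖x - a‖ ^ 2)⁻¹ : ℝ) : ℂ) -
      Complex.I * cx (x - b) * (((‖x - b‖ ^ 2)⁻¹ : ℝ) : ℂ) := by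
    unfold dp
    rw [W_mul (differentiableAt_vx _ x) (differentiableAt_vx _ x) (vx_ne ha) (vx_ne hb), W_vx_false,
      W_vx_true ha, W_vx_true hb]
    ring
  have key : ∀ c : R2, x ≠ c → ‖Complex.I * cx (x - c) * (((‖x - c‖ ^ 2 + δ ^ 2)⁻¹ : ℝ) : ℂ) -
      Complex.I * cx (x - c) * (((‖x - c‖ ^ 2)⁻¹ : ℝ) : ℂ)‖ = ee δ (x - c) := by
    intro c hc
    have hr : 0 < ‖x - c‖ := norm_pos_iff.2 (sub_ne_zero.2 hc)
    rw [← mul_sub, ← Complex.ofReal_sub, norm_mul, norm_mul, Complex.norm_I, Complex.norm_real,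
      LinearIsometryEquiv.norm_map, one_mul, Real.norm_eq_abs]
    have : (‖x - c‖ ^ 2 + δ ^ 2)⁻¹ - (‖x - c‖ ^ 2)⁻¹ = - (δ ^ 2 / (‖x - c‖ ^ 2 + δ ^ 2) * (‖x - c‖ ^ 2)⁻¹) := by
      field_simp
      ring
    rw [this, abs_neg, abs_of_nonneg (by positivity)]
    unfold ee
    field_simp
  have hI : 0 ≤ ∫ s in (0:ℝ)..1, kern δ (x - (a + s • (b - a))) :=
    intervalIntegral.integral_nonneg zero_le_one fun s _ => kern_nonneg _ _
  rw [W_eb a b hδ, h1]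
  have e : ∀ A B C D E : ℂ, A - B - C - (D - E) = (A - D) - (B - E) - C := by intros; ring
  rw [e]
  refine (norm_sub_le _ _).trans (add_le_add ((norm_sub_le _ _).trans (add_le_add (key a ha).le (key b hb).le)) ?_)
  rw [norm_mul, norm_mul, norm_mul, Complex.norm_I, Complex.norm_real, LinearIsometryEquiv.norm_map,
    Real.norm_of_nonneg hI]
  simp

lemma ofReal_mul_integral_cont (K : ℝ → ℝ) (hk : Continuous K) (hnn : ∀ s, 0 ≤ K s) {c : ℝ} (hc : 0 ≤ c) :
    ENNReal.ofReal (c * ∫ s in (0:ℝ)..1, K s) =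
      ENNReal.ofReal c * ∫⁻ s in Ioc (0:ℝ) 1, ENNReal.ofReal (K s) := by
  rw [ENNReal.ofReal_mul hc, intervalIntegral.integral_of_le zero_le_one,
    ofReal_integral_eq_lintegral_ofReal]
  · exact (hk.integrableOn_Icc (μ := volume)).mono_set Ioc_subset_Icc_self
  · exact ae_of_all _ hnn

set_option maxHeartbeats 1000000 in
lemma lintegral_seg (a b : R2) {δ : ℝ} (hδ : 0 < δ) (Ω : Set R2) :
    ∫⁻ x in Ω, ENNReal.ofReal (2 * ‖b - a‖ * ∫ s in (0:ℝ)..1, kern δ (x - (a + s • (b - a)))) ≤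
      ENNReal.ofReal (2 * Real.pi * ‖b - a‖) := by
  have hm : Measurable (fun p : R2 × ℝ => ENNReal.ofReal (kern δ (p.1 - (a + p.2 • (b - a))))) :=
    (continuous_kern_seg a b hδ).measurable.ennreal_ofReal
  have h1 : ∀ x : R2, ENNReal.ofReal (2 * ‖b - a‖ * ∫ s in (0:ℝ)..1, kern δ (x - (a + s • (b - a)))) =
      ENNReal.ofReal (2 * ‖b - a‖) * ∫⁻ s in Ioc (0:ℝ) 1, ENNReal.ofReal (kern δ (x - (a + s • (b - a)))) := by
    intro x
    have hk : Continuous (fun s : ℝ => kern δ (x - (a + s • (b - a)))) :=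
      continuous_kern_seg1 a b hδ x
    exact ofReal_mul_integral_cont _ hk (fun s => kern_nonneg _ _) (mul_nonneg zero_le_two (norm_nonneg _))
  simp only [h1]
  calc _ ≤ ∫⁻ x, ENNReal.ofReal (2 * ‖b - a‖) * ∫⁻ s in Ioc (0:ℝ) 1, ENNReal.ofReal (kern δ (x - (a + s • (b - a)))) :=
        setLIntegral_le_lintegral _ _
    _ = ENNReal.ofReal (2 * ‖b - a‖) * ∫⁻ x, ∫⁻ s in Ioc (0:ℝ) 1, ENNReal.ofReal (kern δ (x - (a + s • (b - a)))) :=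
        lintegral_const_mul' _ _ ENNReal.ofReal_ne_top
    _ = ENNReal.ofReal (2 * ‖b - a‖) * ∫⁻ s in Ioc (0:ℝ) 1, ∫⁻ x, ENNReal.ofReal (kern δ (x - (a + s • (b - a)))) := by
        rw [lintegral_lintegral_swap]
        exact hm.aemeasurable
    _ = ENNReal.ofReal (2 * ‖b - a‖) * ∫⁻ s in Ioc (0:ℝ) 1, ENNReal.ofReal Real.pi := by
        simp only [kern_lintegral hδ]
    _ = ENNReal.ofReal (2 * Real.pi * ‖b - a‖) := by
        rw [setLIntegral_const, Real.volume_Ioc]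
        simp only [sub_zero, ENNReal.ofReal_one, mul_one]
        rw [← ENNReal.ofReal_mul (by positivity)]
        congr 1; ring
    _ ≤ _ := le_rfl

/-- off the line through `a, b`, the phases converge. -/
lemma tendsto_eb {a b x : R2} (hx : KD a b (x - a) ≠ 0) :
    Tendsto (fun k : ℕ => eb a b (1 / ((k : ℝ) + 1)) x) atTop (𝓝 (nz (dp a b) x)) := by
  have h0 : Tendsto (fun k : ℕ => 1 / ((k : ℝ) + 1)) atTop (𝓝 0) :=
    tendsto_one_div_add_atTop_nhds_zero_nat (𝕜 := ℝ)
  set ζ : ℝ → ℂ := fun s => cx (x - (a + s • (b - a))) with hζ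
  set D : ℂ := cx (b - a) with hD
  have hζ0 : ζ 0 = cx (x - a) := by simp [hζ]
  have hζ1 : ζ 1 = cx (x - b) := by simp [hζ]
  have hζs : ∀ s : ℝ, ζ s = ζ 0 - s * D := by
    intro s
    have e : x - (a + s • (b - a)) = (x - a) - s • (b - a) := by abel
    rw [hζ0, hζ]; simp only [e, map_sub, map_smul, Complex.real_smul, hD]
  have hKζ : ∀ s : ℝ, ((starRingEnd ℂ D) * ζ s).im = KD a b (x - a) := by
    intro s
    rw [hζs, KD_apply, hζ0, mul_sub, Complex.sub_im]
    have : ((starRingEnd ℂ D) * (s * D)).im = 0 := by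
      simp [Complex.mul_im]; ring
    rw [this, sub_zero]
  have hne : ∀ s, ζ s ≠ 0 := by
    intro s e
    have := hKζ s
    rw [e] at this
    rw [mul_zero, Complex.zero_im] at this
    exact hx this.symm
  have hnorm : ∀ s, ‖x - (a + s • (b - a))‖ = ‖ζ s‖ := fun s => (LinearIsometryEquiv.norm_map _ _).symm
  have hζc : Continuous ζ := by
    have : ζ = fun s : ℝ => ζ 0 - s * D := funext hζs
    rw [this]; fun_prop
  -- the limit phase
  have hlim : Tendsto (fun k : ℕ => bet a b (1 / ((k : ℝ) + 1)) x) atTop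
      (𝓝 (∫ s in (0:ℝ)..1, - (KD a b (x - a) * (‖ζ s‖ ^ 2)⁻¹))) := by
    unfold bet
    refine intervalIntegral.tendsto_integral_filter_of_dominated_convergence
      (fun s => |KD a b (x - a)| * (‖ζ s‖ ^ 2)⁻¹) ?_ ?_ ?_ ?_
    · refine Eventually.of_forall fun k => ?_
      have hk : (0:ℝ) < 1 / ((k : ℝ) + 1) := by positivity
      exact ((continuous_Bs a b hk).comp (by fun_prop : Continuous fun s : ℝ => (x, s))).aestronglyMeasurable
    · refine Eventually.of_forall fun k => ae_of_all _ fun s _ => ?_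
      unfold Bs Ns
      rw [norm_neg, norm_mul, Real.norm_eq_abs, Real.norm_eq_abs, hnorm, abs_inv,
        abs_of_nonneg (show 0 ≤ ‖ζ s‖ ^ 2 + (1 / ((k:ℝ) + 1)) ^ 2 from add_nonneg (sq_nonneg _) (sq_nonneg _))]
      have hp : 0 < ‖ζ s‖ := norm_pos_iff.2 (hne s)
      gcongr
      exact le_add_of_nonneg_right (sq_nonneg _)
    · apply Continuous.intervalIntegrable
      refine continuous_const.mul (Continuous.inv₀ (by fun_prop) fun s => ?_)
      have hp : 0 < ‖ζ s‖ := norm_pos_iff.2 (hne s)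
      positivity
    · refine ae_of_all _ fun s _ => ?_
      unfold Bs Ns
      rw [hnorm]
      have hp : 0 < ‖ζ s‖ := norm_pos_iff.2 (hne s)
      refine Tendsto.neg (Tendsto.const_mul _ (Tendsto.inv₀ ?_ (by positivity)))
      have := (h0.pow 2).const_add (‖ζ s‖ ^ 2)
      simpa using this
  -- computation of the limit
  have hslit : ∀ s ∈ uIcc (0:ℝ) 1, ζ s / ζ 0 ∈ Complex.slitPlane := by
    intro s hs
    rw [Complex.mem_slitPlane_iff]
    by_cases h : s = 0
    · left; rw [h, div_self (hne 0)]; simp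
    · right
      have e : ζ s / ζ 0 = 1 - s * (D / ζ 0) := by
        rw [hζs]; field_simp [hne 0]
      have e2 : (D / ζ 0).im = - (KD a b (x - a)) / ‖ζ 0‖ ^ 2 := by
        rw [← hKζ 0, Complex.div_im, Complex.normSq_eq_norm_sq]
        simp only [Complex.mul_im, Complex.conj_re, Complex.conj_im]
        ring
      rw [e]
      simp only [Complex.sub_im, Complex.one_im, Complex.im_ofReal_mul, e2]
      have hp : 0 < ‖ζ 0‖ := norm_pos_iff.2 (hne 0)
      have : s * (-(KD a b) (x - a) / ‖ζ 0‖ ^ 2) ≠ 0 := by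
        refine mul_ne_zero h (div_ne_zero (neg_ne_zero.2 hx) (by positivity))
      intro h5
      apply this
      linarith
  have hderiv : ∀ s ∈ uIcc (0:ℝ) 1, HasDerivAt (fun s : ℝ => - (Complex.log (ζ s / ζ 0)).im)
      (- (KD a b (x - a) * (‖ζ s‖ ^ 2)⁻¹)) s := by
    intro s hs
    have h1 : HasDerivAt (fun s : ℝ => ζ s / ζ 0) (-D / ζ 0) s := by
      have h2 : HasDerivAt (fun s : ℝ => ζ 0 - s * D) (- D) s := by
        have := ((hasDerivAt_id s).ofReal_comp.mul_const D).const_sub (ζ 0)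
        simpa using this
      have h3 : ζ = fun s : ℝ => ζ 0 - s * D := funext hζs
      have h4 : HasDerivAt ζ (-D) s := by rw [h3]; simpa using h2
      exact h4.div_const _
    have h2 := h1.clog_real (hslit s hs)
    have h3 := (Complex.imCLM.hasFDerivAt.comp_hasDerivAt s h2).neg
    refine h3.congr_deriv ?_
    have hp : 0 < ‖ζ s‖ := norm_pos_iff.2 (hne s)
    have e1 : -D / ζ 0 / (ζ s / ζ 0) = - (D / ζ s) := by
      field_simp [hne 0, hne s]
    rw [e1, ← hKζ s]
    simp only [Complex.imCLM_apply, Complex.neg_im]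
    rw [Complex.div_im, Complex.normSq_eq_norm_sq]
    simp only [Complex.mul_im, Complex.conj_re, Complex.conj_im]
    ring
  have hIntg : ∫ s in (0:ℝ)..1, - (KD a b (x - a) * (‖ζ s‖ ^ 2)⁻¹) = - (ζ 1 / ζ 0).arg := by
    rw [intervalIntegral.integral_eq_sub_of_hasDerivAt hderiv]
    · rw [div_self (hne 0), Complex.log_one, Complex.log_im]; simp
    · apply Continuous.intervalIntegrable
      refine (continuous_const.mul (Continuous.inv₀ (by fun_prop) fun s => ?_)).neg
      have hp : 0 < ‖ζ s‖ := norm_pos_iff.2 (hne s)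
      positivity
  rw [hIntg] at hlim
  have hfin : Tendsto (fun k : ℕ => eb a b (1 / ((k : ℝ) + 1)) x) atTop
      (𝓝 (Complex.exp (Complex.I * ((- (ζ 1 / ζ 0).arg : ℝ) : ℂ)))) := by
    unfold eb
    exact (Complex.continuous_exp.tendsto _).comp
      (((Complex.continuous_ofReal.tendsto _).comp hlim).const_mul Complex.I)
  convert hfin using 2
  set q := ζ 1 / ζ 0 with hq
  have hq0 : q ≠ 0 := div_ne_zero (hne 1) (hne 0)
  have h5 : Complex.exp (Complex.I * ((- q.arg : ℝ) : ℂ)) = starRingEnd ℂ (q / ‖q‖) := by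
    have h6 : q / ‖q‖ = Complex.exp (q.arg * Complex.I) := by
      have := Complex.norm_mul_exp_arg_mul_I q
      have hn : (‖q‖ : ℂ) ≠ 0 := by simpa using hq0
      rw [div_eq_iff hn, mul_comm, this]
    rw [h6, ← Complex.exp_conj]
    congr 1
    simp [mul_comm]
  rw [h5, hq]
  have hdp : dp a b x = ζ 0 * starRingEnd ℂ (ζ 1) := by
    rw [hζ0, hζ1]; simp [dp, vx]
  unfold nz
  rw [hdp]
  have hc0 : starRingEnd ℂ (ζ 0) ≠ 0 := by simpa using hne 0
  have hn0 : (‖ζ 0‖ : ℂ) ≠ 0 := by simpa using hne 0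
  have hn1 : (‖ζ 1‖ : ℂ) ≠ 0 := by simpa using hne 1
  have hmc : ζ 0 * starRingEnd ℂ (ζ 0) = (‖ζ 0‖ : ℂ) * ‖ζ 0‖ := by
    rw [Complex.mul_conj, Complex.normSq_eq_norm_sq]; push_cast; ring
  simp only [norm_mul, norm_div, RCLike.norm_conj, map_div₀, Complex.conj_ofReal, Complex.ofReal_mul, Complex.ofReal_div]
  field_simp
  linear_combination (starRingEnd ℂ (ζ 1)) * hmc

lemma ae_KD {a b : R2} (h : a ≠ b) : ∀ᵐ x : R2, KD a b (x - a) ≠ 0 := by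
  have h1 : volume ((KD a b).ker : Set R2) = 0 := by
    apply Measure.addHaar_submodule
    intro e
    have h2 : cx.symm (Complex.I * cx (b - a)) ∈ (KD a b).ker := by rw [e]; trivial
    rw [LinearMap.mem_ker] at h2
    have h3 : KD a b (cx.symm (Complex.I * cx (b - a))) = ‖b - a‖ ^ 2 := by
      rw [KD_apply, LinearIsometryEquiv.apply_symm_apply, ← LinearIsometryEquiv.norm_map cx (b - a),
        ← Complex.normSq_eq_norm_sq, Complex.normSq_apply]
      simp only [Complex.mul_im, Complex.mul_re, Complex.conj_re, Complex.conj_im, Complex.I_re, Complex.I_im]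
      ring
    have h4 : ‖b - a‖ ^ 2 = 0 := h3.symm.trans h2
    rw [sq_eq_zero_iff, norm_eq_zero, sub_eq_zero] at h4
    exact h h4.symm
  have h2 : volume ((fun x => x - a) ⁻¹' ((KD a b).ker : Set R2)) = 0 := by
    rw [(measurePreserving_sub_right volume a).measure_preimage]
    · exact h1
    · exact (KD a b).isClosed_ker.measurableSet.nullMeasurableSet
  rw [ae_iff]
  refine measure_mono_null (fun x hx => ?_) h2
  exact not_not.1 hx

end Part7

section Part8

lemma measurable_dp (a b : R2) : Measurable (dp a b) :=
  ((contDiff_vx (a, true) (n := 1)).mul (contDiff_vx (b, false) (n := 1))).continuous.measurable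

lemma lintegral_ee_tendsto {Ω : Set R2} (hΩb : Bornology.IsBounded Ω) (a : R2) :
    Tendsto (fun k : ℕ => ∫⁻ x in Ω, ENNReal.ofReal (ee (1 / ((k : ℝ) + 1)) (x - a))) atTop (𝓝 0) := by
  have h := tendsto_lintegral_of_dominated_convergence (μ := volume.restrict Ω)
    (F := fun k : ℕ => fun x => ENNReal.ofReal (ee (1 / ((k : ℝ) + 1)) (x - a))) (f := fun _ => 0)
    (fun x => ENNReal.ofReal (‖x - a‖⁻¹))
    (fun k => ((measurable_ee _).comp (measurable_id.sub_const a)).ennreal_ofReal)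
    (fun k => ae_of_all _ fun x => ENNReal.ofReal_le_ofReal (ee_le _ _)) ?_ ?_
  · simpa using h
  · have := (integrableOn_inv_norm a hΩb).lintegral_lt_top
    exact this.ne
  · have : ∀ᵐ x ∂(volume.restrict Ω), x ≠ a := by simp [ae_iff]
    filter_upwards [this] with x hx
    have := (ENNReal.continuous_ofReal.tendsto 0).comp (tendsto_ee (sub_ne_zero.2 hx))
    rw [ENNReal.ofReal_zero] at this
    exact this

lemma Ok_dipole {Ω : Set R2} (hΩ : IsOpen Ω) (hΩb : Bornology.IsBounded Ω) {F : R2 → ℂ} (hFm : Measurable F)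
    (hFd : ∀ x ∈ Ω, DifferentiableAt ℝ F x) (hF0 : ∀ᵐ x ∂(volume.restrict Ω), F x ≠ 0)
    {a b : R2} (hab : a ≠ b) {κ : ℝ≥0∞}
    (H : ∀ δ : ℝ, 0 < δ → Ok Ω (nz (fun y => F y * eb a b δ y)) (W (fun y => F y * eb a b δ y)) κ) :
    Ok Ω (nz (fun y => F y * dp a b y)) (W (fun y => F y * dp a b y))
      (κ + ENNReal.ofReal (2 * Real.pi * ‖b - a‖)) := by
  have hfin : IsFiniteMeasure (volume.restrict Ω) :=
    ⟨by rw [Measure.restrict_apply_univ]; exact hΩb.measure_lt_top⟩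
  have hεp : ∀ k : ℕ, 0 < 1 / ((k : ℝ) + 1) := fun k => by positivity
  have hme : ∀ k : ℕ, Measurable (eb a b (1 / ((k : ℝ) + 1))) := fun k =>
    (contDiff_eb a b (hεp k)).continuous.measurable
  refine Ok_transfer (measurable_nz (hFm.mul (measurable_dp a b)))
    (measurable_W (hFm.mul (measurable_dp a b))) fun η hη => ?_
  have hne : ∀ᵐ x ∂(volume.restrict Ω), x ≠ a ∧ x ≠ b := by
    have h1 : ∀ᵐ x ∂(volume.restrict Ω), x ≠ a := by simp [ae_iff]
    have h2 : ∀ᵐ x ∂(volume.restrict Ω), x ≠ b := by simp [ae_iff]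
    exact h1.and h2
  have t1 : Tendsto (fun k : ℕ => ∫⁻ x in Ω, ‖nz (fun y => F y * eb a b (1 / ((k : ℝ) + 1)) y) x -
      nz (fun y => F y * dp a b y) x‖ₑ) atTop (𝓝 0) := by
    have h := tendsto_lintegral_of_dominated_convergence (μ := volume.restrict Ω)
      (F := fun k : ℕ => fun x => ‖nz (fun y => F y * eb a b (1 / ((k : ℝ) + 1)) y) x -
        nz (fun y => F y * dp a b y) x‖ₑ) (f := fun _ => 0)
      (fun x => 2)
      (fun k => ((measurable_nz (hFm.mul (hme k))).sub
        (measurable_nz (hFm.mul (measurable_dp a b)))).enorm) ?_ ?_ ?_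
    · simpa using h
    · refine fun k => ae_of_all _ fun x => ?_
      refine (enorm_sub_le).trans ?_
      have hh : ∀ G : R2 → ℂ, ‖nz G x‖ₑ ≤ 1 := by
        intro G
        rw [← ofReal_norm, ← ENNReal.ofReal_one]
        exact ENNReal.ofReal_le_ofReal (norm_nz_le G x)
      calc _ ≤ (1:ℝ≥0∞) + 1 := add_le_add (hh _) (hh _)
        _ = 2 := one_add_one_eq_two
    · rw [lintegral_const]
      exact ENNReal.mul_ne_top (by simp) (measure_ne_top _ _)
    · filter_upwards [ae_restrict_of_ae (ae_KD hab)] with x hx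
      have h1 := tendsto_eb hx
      have h2 : Tendsto (fun k : ℕ => ‖nz F x * eb a b (1 / ((k : ℝ) + 1)) x - nz F x * nz (dp a b) x‖ₑ)
          atTop (𝓝 ‖nz F x * nz (dp a b) x - nz F x * nz (dp a b) x‖ₑ) :=
        (((h1.const_mul _).sub_const _).enorm)
      rw [sub_self, enorm_zero] at h2
      refine h2.congr fun k => ?_
      rw [nz_mul, nz_mul]
      congr 3
      unfold nz; rw [norm_eb]; simp
  have t2 := (lintegral_ee_tendsto hΩb a).add (lintegral_ee_tendsto hΩb b)
  rw [add_zero] at t2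
  obtain ⟨k, hk1, hk2⟩ := ((t1.eventually_le_const hη).and (t2.eventually_le_const hη)).exists
  have hδ := hεp k
  generalize 1 / ((k : ℝ) + 1) = δ at *
  refine ⟨nz (fun y => F y * eb a b δ y), W (fun y => F y * eb a b δ y),
    measurable_nz (hFm.mul (contDiff_eb a b hδ).continuous.measurable), hk1, ?_, ?_⟩
  · have hmeas1 : Measurable fun x : R2 => ENNReal.ofReal (ee δ (x - a)) :=
      ((measurable_ee _).comp (measurable_id.sub_const a)).ennreal_ofReal
    have hmeas2 : Measurable fun x : R2 => ENNReal.ofReal (ee δ (x - b)) :=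
      ((measurable_ee _).comp (measurable_id.sub_const b)).ennreal_ofReal
    calc ∫⁻ x in Ω, ‖W (fun y => F y * eb a b δ y) x - W (fun y => F y * dp a b y) x‖ₑ
        ≤ ∫⁻ x in Ω, (ENNReal.ofReal (ee δ (x - a)) + ENNReal.ofReal (ee δ (x - b))) +
          ENNReal.ofReal (2 * ‖b - a‖ * ∫ s in (0:ℝ)..1, kern δ (x - (a + s • (b - a)))) := by
          refine lintegral_mono_ae ?_
          filter_upwards [hne, hF0, ae_restrict_mem hΩ.measurableSet] with x hx h0 hxΩ
          have hdd : DifferentiableAt ℝ (dp a b) x := (differentiableAt_vx _ x).mul (differentiableAt_vx _ x)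
          have hdp0 : dp a b x ≠ 0 := mul_ne_zero (vx_ne hx.1) (vx_ne hx.2)
          rw [W_mul (hFd x hxΩ) ((contDiff_eb a b hδ).differentiable one_ne_zero x) h0 (eb_ne _ _ _ _),
            W_mul (hFd x hxΩ) hdd h0 hdp0, add_sub_add_left_eq_sub, ← ofReal_norm]
          refine (ENNReal.ofReal_le_ofReal (W_eb_sub a b hδ hx.1 hx.2)).trans ?_
          exact ENNReal.ofReal_add_le.trans (add_le_add ENNReal.ofReal_add_le le_rfl)
      _ = ((∫⁻ x in Ω, ENNReal.ofReal (ee δ (x - a))) + ∫⁻ x in Ω, ENNReal.ofReal (ee δ (x - b))) +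
          ∫⁻ x in Ω, ENNReal.ofReal (2 * ‖b - a‖ * ∫ s in (0:ℝ)..1, kern δ (x - (a + s • (b - a)))) := by
          rw [lintegral_add_left (f := fun x => ENNReal.ofReal (ee δ (x - a)) + ENNReal.ofReal (ee δ (x - b)))
            (hmeas1.add hmeas2), lintegral_add_left hmeas1]
      _ ≤ η + ENNReal.ofReal (2 * Real.pi * ‖b - a‖) := add_le_add hk2 (lintegral_seg a b hδ Ω)
      _ = _ := add_comm _ _
  · intro η' hη'
    obtain ⟨v, v1, v2, v3, v4⟩ := H δ hδ η' hη'
    exact ⟨v, v1, v2, v3, v4.trans (add_le_add (add_le_add le_rfl le_self_add) le_rfl)⟩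

/-- functions with an admissible approximation, robustly under good factors -/
structure Qk (Ω : Set R2) (F : R2 → ℂ) (κ : ℝ) : Prop where
  smooth : ContDiff ℝ 1 F
  ne : ∀ᵐ x ∂(volume.restrict Ω), F x ≠ 0
  nn : 0 ≤ κ
  ok : ∀ g, Good Ω g → Ok Ω (nz (fun y => g y * F y)) (W (fun y => g y * F y)) (ENNReal.ofReal κ)

lemma Good.eb {Ω : Set R2} (hΩ : IsOpen Ω) (hΩb : Bornology.IsBounded Ω) (a b : R2) {δ : ℝ} (hδ : 0 < δ) :
    Good Ω (eb a b δ) :=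
  Good.of_smooth hΩ hΩb (contDiff_eb a b hδ) fun x _ => eb_ne _ _ _ _

lemma vx_ae_ne (μ : Measure R2) [NullSingletonClass μ] (q : R2 × Bool) : ∀ᵐ x ∂μ, vx q x ≠ 0 := by
  have h1 : ∀ᵐ x ∂μ, x ≠ q.1 := by simp [ae_iff]
  exact h1.mono fun x hx => vx_ne hx

lemma Qk.start {Ω : Set R2} (hΩ : IsOpen Ω) (hΩb : Bornology.IsBounded Ω)
    {S : Finset (R2 × Bool)} (hS : ∀ q ∈ S, q.1 ∈ Ω) (hinj : ∀ q ∈ S, ∀ q' ∈ S, q.1 = q'.1 → q = q') :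
    Qk Ω (vp S) (Real.pi * S.card) where
  smooth := contDiff_vp S
  ne := by
    filter_upwards [ae_ne_of_finset S (volume.restrict Ω)] with x hx
    exact Finset.prod_ne_zero_iff.2 fun q hq => vx_ne (hx q hq)
  nn := by positivity
  ok := fun g hg => Ok_vp hΩ hΩb hg hS hinj

lemma Qk.dipole {Ω : Set R2} (hΩ : IsOpen Ω) (hΩb : Bornology.IsBounded Ω) {F : R2 → ℂ} {κ : ℝ}
    (h : Qk Ω F κ) {a b : R2} (hab : a ≠ b) :
    Qk Ω (fun y => F y * dp a b y) (κ + 2 * Real.pi * ‖b - a‖) where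
  smooth := h.smooth.mul ((contDiff_vx _).mul (contDiff_vx _))
  ne := by
    filter_upwards [h.ne, vx_ae_ne _ (a, true), vx_ae_ne _ (b, false)] with x h1 h2 h3
    exact mul_ne_zero h1 (mul_ne_zero h2 h3)
  nn := add_nonneg h.nn (by positivity)
  ok := by
    intro g hg
    rw [ENNReal.ofReal_add h.nn (by positivity)]
    have := Ok_dipole hΩ hΩb (F := fun y => g y * F y) (hg.meas.mul h.smooth.continuous.measurable)
      (fun x hx => (hg.diffAt hΩ hx).mul (h.smooth.differentiable one_ne_zero x)) ?_ hab
      (κ := ENNReal.ofReal κ) ?_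
    · convert this using 3 <;> ring
    · filter_upwards [h.ne, ae_restrict_mem hΩ.measurableSet] with x h1 h2
      exact mul_ne_zero (hg.ne x h2) h1
    · intro δ hδ
      have := h.ok _ (hg.mul hΩ (Good.eb hΩ hΩb a b hδ))
      convert this using 3 <;> ring

lemma Qk.congr_real {Ω : Set R2} (hΩ : IsOpen Ω) {F G h : R2 → ℂ} {ρ : R2 → ℝ} {κ : ℝ}
    (hF : Qk Ω F κ) (hG : ContDiff ℝ 1 G) (hG0 : ∀ x ∈ Ω, F x ≠ 0 → G x ≠ 0) (hρ : ∀ x ∈ Ω, 0 < ρ x)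
    (hρd : ContDiff ℝ 1 ρ) (hh : Good Ω h) (e : ∀ x ∈ Ω, F x * h x = G x * (ρ x : ℂ)) : Qk Ω G κ where
  smooth := hG
  ne := by
    filter_upwards [hF.ne, ae_restrict_mem hΩ.measurableSet] with x h1 h2
    exact hG0 x h2 h1
  nn := hF.nn
  ok := by
    intro g hg
    have h1 := hF.ok _ (hg.mul hΩ hh)
    have ev : ∀ x ∈ Ω, (fun y => g y * h y * F y) =ᶠ[𝓝 x] fun y => (g y * G y) * (ρ y : ℂ) := by
      intro x hx
      filter_upwards [hΩ.mem_nhds hx] with y hy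
      rw [mul_assoc, mul_assoc, ← e y hy]; ring
    have e1 : ∀ x ∈ Ω, nz (fun y => g y * h y * F y) x = nz (fun y => g y * G y) x := by
      intro x hx
      rw [← nz_mul_ofReal (F := fun y => g y * G y) (hρ x hx)]
      unfold nz
      rw [(ev x hx).self_of_nhds]
    -- the phase gradients agree where the functions do not vanish
    intro η hη
    have h1' := Ok_congr hΩ.measurableSet h1 e1 (fun _ _ => rfl)
    obtain ⟨v, v1, v2, v3, v4⟩ := h1' η hη
    refine ⟨v, v1, v2, v3, v4.trans (le_of_eq ?_)⟩
    congr 2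
    refine lintegral_congr_ae ?_
    filter_upwards [hF.ne, ae_restrict_mem hΩ.measurableSet] with x h1 hx
    rw [W_congr (ev x hx), W_mul_ofReal (F := fun y => g y * G y) ((hg.diffAt hΩ hx).mul (hG.differentiable one_ne_zero x))
      (hρd.differentiable one_ne_zero x) (mul_ne_zero (hg.ne x hx) (hG0 x hx h1)) (hρ x hx).ne']

lemma vx_mul_vx_not (b : R2) (β : Bool) (x : R2) : vx (b, β) x * vx (b, !β) x = ((‖x - b‖ ^ 2 : ℝ) : ℂ) := by
  have : (cx x - cx b) * starRingEnd ℂ (cx x - cx b) = ((‖x - b‖ ^ 2 : ℝ) : ℂ) := by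
    rw [Complex.mul_conj, Complex.normSq_eq_norm_sq, ← map_sub, LinearIsometryEquiv.norm_map]
  cases β
  · simp only [vx, Bool.not_false, if_true]; rw [← this]; simp [mul_comm]
  · simp only [vx, Bool.not_true, if_true]; rw [← this]; simp

lemma Qk.single {Ω : Set R2} (hΩ : IsOpen Ω) (hΩb : Bornology.IsBounded Ω) {F : R2 → ℂ} {κ : ℝ}
    (h : Qk Ω F κ) {q : R2 × Bool} {b : R2} (hq : q.1 ∈ Ω) (hb : b ∉ Ω) :
    Qk Ω (fun y => F y * vx q y) (κ + 2 * Real.pi * dist q.1 b) := by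
  have hne : q.1 ≠ b := fun e => hb (e ▸ hq)
  obtain ⟨p, β⟩ := q
  simp only at hq hne ⊢
  have hρ : ∀ x ∈ Ω, 0 < ‖x - b‖ ^ 2 := fun x hx => by
    have : x - b ≠ 0 := sub_ne_zero.2 fun e => hb (e ▸ hx)
    positivity
  have hρd : ContDiff ℝ 1 (fun x : R2 => ‖x - b‖ ^ 2) := (contDiff_id.sub contDiff_const).norm_sq ℝ
  cases β
  · have h1 := h.dipole hΩ hΩb hne.symm
    rw [dist_eq_norm]
    refine h1.congr_real hΩ (h.smooth.mul (contDiff_vx _)) ?_ hρ hρd (Good.vx hΩ hΩb (q := (b, false)) hb) ?_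
    · intro x hx h0 h2
      apply h0
      simp only [dp]
      linear_combination vx (b, true) x * h2
    · intro x hx
      simp only [← vx_mul_vx_not b true, dp, Bool.not_true]; ring
  · have h1 := h.dipole hΩ hΩb hne
    rw [dist_comm, dist_eq_norm]
    refine h1.congr_real hΩ (h.smooth.mul (contDiff_vx _)) ?_ hρ hρd (Good.vx hΩ hΩb (q := (b, true)) hb) ?_
    · intro x hx h0 h2
      apply h0
      simp only [dp]
      linear_combination vx (b, false) x * h2
    · intro x hx
      simp only [← vx_mul_vx_not b true, dp, Bool.not_true]; ring

/-- cost of a single vortex -/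
def sc (Ω : Set R2) (x : R2) : ℝ := min 1 (2 * infDist x Ωᶜ)

lemma compl_nonempty {Ω : Set R2} (hΩb : Bornology.IsBounded Ω) : Ωᶜ.Nonempty := by
  by_contra h
  rw [not_nonempty_iff_eq_empty, compl_empty_iff] at h
  rw [h] at hΩb
  exact NormedSpace.unbounded_univ ℝ R2 hΩb

lemma Qk.vp_singles {Ω : Set R2} (hΩ : IsOpen Ω) (hΩb : Bornology.IsBounded Ω)
    {S : Finset (R2 × Bool)} (hS : ∀ q ∈ S, q.1 ∈ Ω) (hinj : ∀ q ∈ S, ∀ q' ∈ S, q.1 = q'.1 → q = q') :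
    Qk Ω (vp S) (Real.pi * ∑ q ∈ S, sc Ω q.1) := by
  have key : ∀ A : Finset (R2 × Bool), A ⊆ S → (∀ q ∈ A, sc Ω q.1 ≠ 1) →
      ∀ B : Finset (R2 × Bool), B ⊆ S → (∀ q ∈ B, sc Ω q.1 = 1) →
      Qk Ω (vp (A ∪ B)) (Real.pi * ∑ q ∈ A ∪ B, sc Ω q.1) := by
    intro A
    induction A using Finset.induction_on with
    | empty =>
      intro _ _ B hB hB1
      rw [Finset.empty_union, Finset.sum_congr rfl hB1]
      simpa using Qk.start hΩ hΩb (fun q hq => hS q (hB hq)) (fun q hq q' hq' => hinj q (hB hq) q' (hB hq'))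
    | insert q A hqA ih =>
      intro hA hA1 B hB hB1
      have h1 := ih (fun x hx => hA (Finset.mem_insert_of_mem hx)) (fun x hx => hA1 x (Finset.mem_insert_of_mem hx)) B hB hB1
      have hq1 := hA1 q (Finset.mem_insert_self _ _)
      have hqB : q ∉ A ∪ B := by
        rw [Finset.mem_union, not_or]
        exact ⟨hqA, fun h => hq1 (hB1 q h)⟩
      have hqΩ := hS q (hA (Finset.mem_insert_self _ _))
      obtain ⟨b, hb, hbd⟩ := hΩ.isClosed_compl.exists_infDist_eq_dist (compl_nonempty hΩb) q.1
      have h2 := h1.single hΩ hΩb (b := b) hqΩ hb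
      rw [Finset.insert_union]
      have e1 : vp (insert q (A ∪ B)) = fun y => vp (A ∪ B) y * vx q y := by
        funext y; unfold vp; rw [Finset.prod_insert hqB, mul_comm]
      have e2 : sc Ω q.1 = 2 * dist q.1 b := by
        rw [← hbd]; unfold sc at hq1 ⊢
        rcases min_choice 1 (2 * infDist q.1 Ωᶜ) with h | h
        · exact absurd h hq1
        · exact h
      rw [e1, Finset.sum_insert hqB, e2]
      convert h2 using 1; ring
  have h := key (S.filter fun q => sc Ω q.1 ≠ 1) (Finset.filter_subset _ _) (by simp)
    (S.filter fun q => ¬ sc Ω q.1 ≠ 1) (Finset.filter_subset _ _) (by simp)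
  rwa [Finset.filter_union_filter_not_eq] at h

lemma Qk.dipoles {Ω : Set R2} (hΩ : IsOpen Ω) (hΩb : Bornology.IsBounded Ω) {F : R2 → ℂ} {κ : ℝ}
    (h : Qk Ω F κ) (M : Finset (R2 × R2)) (hM : ∀ m ∈ M, m.1 ≠ m.2) :
    Qk Ω (fun y => F y * ∏ m ∈ M, dp m.1 m.2 y) (κ + Real.pi * ∑ m ∈ M, 2 * dist m.1 m.2) := by
  induction M using Finset.induction_on with
  | empty => simpa using h
  | insert m M hm ih =>
    have h1 := (ih fun x hx => hM x (Finset.mem_insert_of_mem hx)).dipole hΩ hΩb (hM m (Finset.mem_insert_self _ _))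
    simp only [Finset.prod_insert hm, Finset.sum_insert hm]
    convert h1 using 1
    · funext y; ring
    · rw [dist_comm, dist_eq_norm]; ring

end Part8

section Part9

/-- feasible dual pairs of an assignment problem -/
def Feas {ι κ : Type} (c : ι → κ → ℝ) (p : (ι → ℝ) × (κ → ℝ)) : Prop := ∀ i j, p.1 i + p.2 j ≤ c i j

lemma exists_dual_opt {ι κ : Type} [Fintype ι] [Fintype κ] [Nonempty ι] (hc : Fintype.card ι = Fintype.card κ)
    (c : ι → κ → ℝ) : ∃ p, Feas c p ∧ ∀ q, Feas c q → ∑ i, q.1 i + ∑ j, q.2 j ≤ ∑ i, p.1 i + ∑ j, p.2 j := by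
  obtain ⟨C, hC0, hC⟩ : ∃ C : ℝ, 0 ≤ C ∧ ∀ i j, |c i j| ≤ C := by
    refine ⟨∑ i, ∑ j, |c i j|, by positivity, fun i j => ?_⟩
    exact (Finset.single_le_sum (f := fun j => |c i j|) (fun _ _ => abs_nonneg _) (Finset.mem_univ j)).trans
      (Finset.single_le_sum (f := fun i => ∑ j, |c i j|) (fun _ _ => by positivity) (Finset.mem_univ i))
  set n : ℝ := (Fintype.card ι : ℝ) with hn
  have hn0 : 0 ≤ n := by positivity
  set R := 2 * n * C + C with hR
  have hR0 : 0 ≤ 2 * n * C := by positivity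
  set K : Set ((ι → ℝ) × (κ → ℝ)) := (univ.pi fun _ => Icc (-R) R) ×ˢ (univ.pi fun _ => Icc (-R) R) ∩ {p | Feas c p} with hK
  have hKc : IsCompact K := by
    refine IsCompact.inter_right ((isCompact_univ_pi fun _ => isCompact_Icc).prod (isCompact_univ_pi fun _ => isCompact_Icc)) ?_
    have : {p | Feas c p} = ⋂ i, ⋂ j, {p : (ι → ℝ) × (κ → ℝ) | p.1 i + p.2 j ≤ c i j} := by
      ext p; simp [Feas]
    rw [this]
    exact isClosed_iInter fun i => isClosed_iInter fun j => isClosed_le (by fun_prop) continuous_const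
  have h0 : ((fun _ => 0, fun _ => -C) : (ι → ℝ) × (κ → ℝ)) ∈ K := by
    refine ⟨⟨fun i _ => ⟨?_, ?_⟩, fun j _ => ⟨?_, ?_⟩⟩, fun i j => ?_⟩
    all_goals simp only
    all_goals try linarith
    have := neg_abs_le (c i j)
    linarith [hC i j]
  obtain ⟨p, hpK, hp⟩ := hKc.exists_isMaxOn ⟨_, h0⟩
    (f := fun p : (ι → ℝ) × (κ → ℝ) => ∑ i, p.1 i + ∑ j, p.2 j) (by fun_prop)
  refine ⟨p, hpK.2, fun q hq => ?_⟩
  have hV0 := hp h0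
  simp only [mem_setOf_eq] at hV0
  by_contra hlt
  push Not at hlt
  obtain ⟨i0, -, hi0⟩ := Finset.exists_max_image Finset.univ q.1 Finset.univ_nonempty
  set t := q.1 i0 with ht
  have hf : ∀ i, q.1 i - t ≤ 0 := fun i => by linarith [hi0 i (Finset.mem_univ i)]
  have hg : ∀ j, q.2 j + t ≤ C := fun j => by
    have := hq i0 j
    have := le_abs_self (c i0 j)
    linarith [hC i0 j]
  have hsum : ∑ i, (q.1 i - t) + ∑ j, (q.2 j + t) = ∑ i, q.1 i + ∑ j, q.2 j := by
    rw [Finset.sum_sub_distrib, Finset.sum_add_distrib, Finset.sum_const, Finset.sum_const, Finset.card_univ,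
      Finset.card_univ, hc]
    ring
  have hV : -(n * C) ≤ ∑ i, (q.1 i - t) + ∑ j, (q.2 j + t) := by
    rw [hsum]
    have e : ∑ _i : ι, (0:ℝ) + ∑ _j : κ, (-C) = -(n * C) := by
      rw [Finset.sum_const_zero, Finset.sum_const, Finset.card_univ, ← hc, nsmul_eq_mul]; ring
    linarith
  have hsg : ∑ j, (q.2 j + t) ≤ n * C := by
    have := Finset.sum_le_card_nsmul Finset.univ (fun j => q.2 j + t) C (fun j _ => hg j)
    rwa [Finset.card_univ, ← hc, nsmul_eq_mul] at this
  have hsf : ∑ i, (q.1 i - t) ≤ 0 := Finset.sum_nonpos fun i _ => hf i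
  have hq' : ((fun i => q.1 i - t, fun j => q.2 j + t) : (ι → ℝ) × (κ → ℝ)) ∈ K := by
    refine ⟨⟨fun i _ => ⟨?_, ?_⟩, fun j _ => ⟨?_, ?_⟩⟩, fun i j => ?_⟩
    all_goals simp only
    · have := Finset.single_le_sum (f := fun i => -(q.1 i - t)) (fun i _ => by linarith [hf i]) (Finset.mem_univ i)
      rw [Finset.sum_neg_distrib] at this
      linarith
    · linarith [hf i]
    · have := Finset.single_le_sum (f := fun j => C - (q.2 j + t)) (fun j _ => by linarith [hg j]) (Finset.mem_univ j)
      rw [Finset.sum_sub_distrib, Finset.sum_const, Finset.card_univ, ← hc, nsmul_eq_mul] at this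
      linarith
    · linarith [hg j]
    · linarith [hq i j]
  have := hp hq'
  simp only [mem_setOf_eq] at this
  rw [hsum] at this
  linarith

lemma assignment {ι κ : Type} [Fintype ι] [Fintype κ] (hc : Fintype.card ι = Fintype.card κ)
    (c : ι → κ → ℝ) : ∃ (σ : ι ≃ κ) (f : ι → ℝ) (g : κ → ℝ), (∀ i j, f i + g j ≤ c i j) ∧
      ∀ i, f i + g (σ i) = c i (σ i) := by
  cases isEmpty_or_nonempty ι with
  | inl h => exact ⟨Fintype.equivOfCardEq hc, fun _ => 0, fun _ => 0, fun i => h.elim i, fun i => h.elim i⟩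
  | inr h =>
  obtain ⟨⟨f, g⟩, hfe, hopt⟩ := exists_dual_opt hc c
  simp only [Feas] at hfe hopt
  set t : ι → Finset κ := fun i => Finset.univ.filter fun j => f i + g j = c i j with ht
  have hall : ∀ I : Finset ι, I.card ≤ (I.biUnion t).card := by
    intro I
    by_contra hlt
    push Not at hlt
    have hε : ∃ ε > 0, ∀ i j, f i + g j < c i j → ε ≤ c i j - (f i + g j) := by
      have : ∀ᶠ ε in 𝓝[>] (0:ℝ), ∀ i j, f i + g j < c i j → ε ≤ c i j - (f i + g j) := by
        rw [Filter.eventually_all]; intro i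
        rw [Filter.eventually_all]; intro j
        by_cases h : f i + g j < c i j
        · have : ∀ᶠ ε in 𝓝 (0:ℝ), ε < c i j - (f i + g j) := gt_mem_nhds (by linarith)
          filter_upwards [nhdsWithin_le_nhds this] with ε he _ using he.le
        · exact Eventually.of_forall fun ε h' => absurd h' h
      obtain ⟨ε, h1, h2⟩ := (this.and self_mem_nhdsWithin).exists
      exact ⟨ε, h2, h1⟩
    obtain ⟨ε, hε0, hε⟩ := hε
    have := hopt (fun i => f i + if i ∈ I then ε else 0, fun j => g j - if j ∈ I.biUnion t then ε else 0) ?_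
    · simp only [Finset.sum_add_distrib, Finset.sum_sub_distrib, Finset.sum_ite_mem, Finset.univ_inter,
        Finset.sum_const, nsmul_eq_mul] at this
      have h2 : ((I.biUnion t).card : ℝ) < I.card := by exact_mod_cast hlt
      nlinarith
    · intro i j
      simp only
      have h1 := hfe i j
      by_cases hi : i ∈ I
      · by_cases hj : j ∈ I.biUnion t
        · simp only [hi, hj, if_true]; linarith
        · simp only [hi, hj, if_true, if_false]
          have : f i + g j ≠ c i j := fun e => hj (Finset.mem_biUnion.2 ⟨i, hi, by simp [ht, e]⟩)
          linarith [hε i j (lt_of_le_of_ne h1 this)]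
      · simp only [hi, if_false]
        split_ifs <;> linarith
  obtain ⟨σ, hσ, hσt⟩ := (Finset.all_card_le_biUnion_card_iff_exists_injective t).1 hall
  have hb : Function.Bijective σ := (Fintype.bijective_iff_injective_and_card σ).2 ⟨hσ, hc⟩
  refine ⟨Equiv.ofBijective σ hb, f, g, hfe, fun i => ?_⟩
  have := hσt i
  simpa [ht] using this

lemma sc_lip (Ω : Set R2) (x y : R2) : sc Ω x ≤ sc Ω y + 2 * dist x y := by
  unfold sc
  have := infDist_le_infDist_add_dist (s := Ωᶜ) (x := x) (y := y)
  rcases min_choice 1 (2 * infDist y Ωᶜ) with h | h <;> rw [h]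
  · exact (min_le_left _ _).trans (by linarith [dist_nonneg (x := x) (y := y)])
  · exact (min_le_right _ _).trans (by linarith)

lemma sc_nonneg (Ω : Set R2) (x : R2) : 0 ≤ sc Ω x := le_min zero_le_one (by have := infDist_nonneg (x := x) (s := Ωᶜ); positivity)

lemma sc_le_one (Ω : Set R2) (x : R2) : sc Ω x ≤ 1 := min_le_left _ _

lemma sc_zero {Ω : Set R2} {x : R2} (h : x ∉ Ω) : sc Ω x = 0 := by
  unfold sc; rw [infDist_zero_of_mem h]; simp

/-- construction of the test function from the potentials -/
lemma exists_phi (Ω : Set R2) (P N : Finset R2) (F G : R2 → ℝ) (h1 : ∀ p ∈ P, ∀ n ∈ N, F p + G n ≤ 2 * dist p n)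
    (h2 : ∀ p ∈ P, F p ≤ sc Ω p) (h3 : ∀ n ∈ N, G n ≤ sc Ω n) :
    ∃ φ : R2 → ℝ, LipschitzWith 2 φ ∧ (∀ x, |φ x| ≤ 1) ∧ (∀ x, x ∉ Ω → φ x = 0) ∧
      (∀ p ∈ P, F p ≤ φ p) ∧ ∀ n ∈ N, φ n ≤ - G n := by
  set m : R2 → ℝ := fun x => N.fold min (sc Ω x) (fun n => 2 * dist x n - G n) with hm
  have hml : ∀ x y, m x ≤ m y + 2 * dist x y := by
    intro x y
    rw [← sub_le_iff_le_add, hm]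
    have hx := (Finset.le_fold_min (s := N) (f := fun n => 2 * dist x n - G n) (b := sc Ω x) (c := m x)).1 le_rfl
    refine (Finset.le_fold_min _).2 ⟨?_, fun n hn => ?_⟩
    · linarith [hx.1, sc_lip Ω x y]
    · have := hx.2 n hn
      have := dist_triangle x y n
      simp only at *
      linarith
  have hφl : ∀ x y, max (- sc Ω x) (m x) ≤ max (- sc Ω y) (m y) + 2 * dist x y := by
    intro x y
    refine max_le ?_ ?_
    · have := sc_lip Ω y x
      rw [dist_comm] at this
      linarith [le_max_left (- sc Ω y) (m y)]
    · linarith [hml x y, le_max_right (- sc Ω y) (m y)]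
  have hms : ∀ x, m x ≤ sc Ω x := fun x => ((Finset.le_fold_min (m x)).1 le_rfl).1
  have hab : ∀ x, |max (- sc Ω x) (m x)| ≤ sc Ω x := fun x => by
    rw [abs_le]
    exact ⟨le_max_left _ _, max_le (by linarith [sc_nonneg Ω x]) (hms x)⟩
  refine ⟨fun x => max (- sc Ω x) (m x), ?_, fun x => (hab x).trans (sc_le_one Ω x), ?_, ?_, ?_⟩
  · exact LipschitzWith.of_le_add_mul 2 fun x y => by simpa using hφl x y
  · intro x hx
    have := hab x
    rw [sc_zero hx] at this
    simpa [sc_zero hx] using this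
  · intro p hp
    refine le_max_of_le_right ((Finset.le_fold_min _).2 ⟨h2 p hp, fun n hn => ?_⟩)
    linarith [h1 p hp n hn]
  · intro n hn
    refine max_le (by linarith [h3 n hn]) ?_
    have := ((Finset.le_fold_min (s := N) (f := fun k => 2 * dist n k - G k) (b := sc Ω n) (m n)).1 le_rfl).2 n hn
    simpa using this

end Part9

section Part10

lemma exists_mid {α β : Type} [Finite α] [Finite β] (a : α → ℝ) (b : β → ℝ) (h : ∀ i j, a i ≤ b j) :
    ∃ t, (∀ i, a i ≤ t) ∧ ∀ j, t ≤ b j := by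
  cases isEmpty_or_nonempty α with
  | inr h1 =>
    obtain ⟨i, hi⟩ := Finite.exists_max a
    exact ⟨a i, hi, fun j => h i j⟩
  | inl h1 =>
    cases isEmpty_or_nonempty β with
    | inr h2 =>
      obtain ⟨j, hj⟩ := Finite.exists_min b
      exact ⟨b j, fun i => h1.elim i, hj⟩
    | inl h2 => exact ⟨0, fun i => h1.elim i, fun i => h2.elim i⟩

lemma prod_matched {P N X : Type} [Fintype P] [Fintype N] [CommMonoid X] (r : P → N → Prop)
    (hr1 : ∀ p n n', r p n → r p n' → n = n') (a : P → X) :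
    ∏ m ∈ Finset.univ.filter (fun m : P × N => r m.1 m.2), a m.1 =
      ∏ p ∈ Finset.univ.filter (fun p => ∃ n, r p n), a p := by
  refine Finset.prod_nbij Prod.fst ?_ ?_ ?_ ?_
  · intro m hm; simp only [Finset.mem_filter, Finset.mem_univ, true_and] at hm ⊢; exact ⟨_, hm⟩
  · rintro ⟨p, n⟩ hm ⟨p', n'⟩ hm' h
    simp only [Finset.coe_filter, Finset.mem_univ, true_and, mem_setOf_eq] at hm hm' h
    subst h; rw [hr1 _ _ _ hm hm']
  · rintro p hp
    simp only [Finset.coe_filter, Finset.mem_univ, true_and, mem_setOf_eq] at hp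
    obtain ⟨n, hn⟩ := hp
    exact ⟨(p, n), by simpa using hn, rfl⟩
  · intros; rfl

lemma prod_matched' {P N X : Type} [Fintype P] [Fintype N] [CommMonoid X] (r : P → N → Prop)
    (hr1 : ∀ p p' n, r p n → r p' n → p = p') (a : N → X) :
    ∏ m ∈ Finset.univ.filter (fun m : P × N => r m.1 m.2), a m.2 =
      ∏ n ∈ Finset.univ.filter (fun n => ∃ p, r p n), a n := by
  refine Finset.prod_nbij Prod.snd ?_ ?_ ?_ ?_
  · intro m hm; simp only [Finset.mem_filter, Finset.mem_univ, true_and] at hm ⊢; exact ⟨_, hm⟩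
  · rintro ⟨p, n⟩ hm ⟨p', n'⟩ hm' h
    simp only [Finset.coe_filter, Finset.mem_univ, true_and, mem_setOf_eq] at hm hm' h
    subst h; rw [hr1 _ _ _ hm hm']
  · rintro n hp
    simp only [Finset.coe_filter, Finset.mem_univ, true_and, mem_setOf_eq] at hp
    obtain ⟨p, hn⟩ := hp
    exact ⟨(p, n), by simpa using hn, rfl⟩
  · intros; rfl

/-- optimal matching with its dual potentials -/
lemma matching (P N : Type) [Fintype P] [Fintype N] (d : P → N → ℝ) (s : P → ℝ) (s' : N → ℝ) :
    ∃ r : P → N → Prop, (∀ p n n', r p n → r p n' → n = n') ∧ (∀ p p' n, r p n → r p' n → p = p') ∧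
      ∃ (F : P → ℝ) (G : N → ℝ), (∀ p n, F p + G n ≤ d p n) ∧ (∀ p, F p ≤ s p) ∧ (∀ n, G n ≤ s' n) ∧
      ∑ m ∈ Finset.univ.filter (fun m : P × N => r m.1 m.2), d m.1 m.2 +
        ∑ p ∈ Finset.univ.filter (fun p => ¬ ∃ n, r p n), s p +
        ∑ n ∈ Finset.univ.filter (fun n => ¬ ∃ p, r p n), s' n ≤ ∑ p, F p + ∑ n, G n := by
  set c : P ⊕ N → N ⊕ P → ℝ := fun i j => match i, j with
    | .inl p, .inl n => d p n
    | .inl p, .inr _ => s p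
    | .inr _, .inl n => s' n
    | .inr _, .inr _ => 0 with hc
  obtain ⟨σ, f, g, h1, h2⟩ := assignment (ι := P ⊕ N) (κ := N ⊕ P) (by simp [add_comm]) c
  obtain ⟨t, ht1, ht2⟩ := exists_mid (fun n : N => f (.inr n)) (fun p : P => - g (.inr p))
    (fun n p => by have := h1 (.inr n) (.inr p); simp only [hc] at this; linarith)
  obtain ⟨r, hr⟩ : ∃ r : P → N → Prop, ∀ p n, r p n ↔ σ (.inl p) = .inl n := ⟨_, fun _ _ => Iff.rfl⟩
  refine ⟨r, ?_, ?_, fun p => min (f (.inl p) - t) (s p),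
    fun n => min (g (.inl n) + t) (s' n), ?_, fun p => min_le_right _ _, fun n => min_le_right _ _, ?_⟩
  · intro p n n' h h'; rw [hr] at h h'; rw [h] at h'; simpa using h'
  · intro p p' n h h'
    rw [hr] at h h'
    have := σ.injective (h.trans h'.symm)
    simpa using this
  · intro p n
    have := h1 (.inl p) (.inl n); simp only [hc] at this
    have e1 := min_le_left (f (.inl p) - t) (s p)
    have e2 := min_le_left (g (.inl n) + t) (s' n)
    linarith
  have hA : ∑ i, c i (σ i) = ∑ i, f i + ∑ j, g j := by
    rw [← Equiv.sum_comp σ g, ← Finset.sum_add_distrib]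
    exact Finset.sum_congr rfl fun i _ => (h2 i).symm
  have hB : ∑ i, f i + ∑ j, g j ≤ ∑ p, min (f (.inl p) - t) (s p) + ∑ n, min (g (.inl n) + t) (s' n) := by
    rw [Fintype.sum_sum_type, Fintype.sum_sum_type]
    have e1 : ∑ p, (f (.inl p) + g (.inr p)) ≤ ∑ p, min (f (.inl p) - t) (s p) :=
      Finset.sum_le_sum fun p _ => le_min (by have := ht2 p; linarith)
        (by have := h1 (.inl p) (.inr p); simpa only [hc] using this)
    have e2 : ∑ n, (g (.inl n) + f (.inr n)) ≤ ∑ n, min (g (.inl n) + t) (s' n) :=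
      Finset.sum_le_sum fun n _ => le_min (by have := ht1 n; linarith)
        (by have := h1 (.inr n) (.inl n); simp only [hc] at this; linarith)
    rw [Finset.sum_add_distrib] at e1 e2
    linarith
  refine le_trans (le_of_eq ?_) (hA.le.trans hB)
  rw [Fintype.sum_sum_type]
  congr 1
  · rw [← Finset.sum_filter_add_sum_filter_not Finset.univ (fun p => ∃ n, r p n) (fun p => c (.inl p) (σ (.inl p)))]
    congr 1
    · have hr1 : ∀ p n n', r p n → r p n' → n = n' := by
        intro p n n' h h'; rw [hr] at h h'; rw [h] at h'; simpa using h'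
      have := prod_matched (X := Multiplicative ℝ) r hr1 (fun p => Multiplicative.ofAdd (c (.inl p) (σ (.inl p))))
      have e : ∑ m ∈ Finset.univ.filter (fun m : P × N => r m.1 m.2), c (.inl m.1) (σ (.inl m.1)) =
        ∑ p ∈ Finset.univ.filter (fun p => ∃ n, r p n), c (.inl p) (σ (.inl p)) := this
      rw [← e]
      refine Finset.sum_congr rfl fun m hm => ?_
      simp only [Finset.mem_filter, Finset.mem_univ, true_and, hr] at hm
      rw [hm]
    · refine Finset.sum_congr rfl fun p hp => ?_
      simp only [Finset.mem_filter, Finset.mem_univ, true_and, hr] at hp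
      rcases h : σ (.inl p) with n | p'
      · exact absurd ⟨n, h⟩ hp
      · rfl
  · set k : P ⊕ N → ℝ := fun i => match i with
      | .inl _ => 0
      | .inr n => c (.inr n) (σ (.inr n)) with hk
    have e1 : ∑ n, c (.inr n) (σ (.inr n)) = ∑ i, k i := by
      rw [Fintype.sum_sum_type]; simp [hk]
    rw [e1, ← Equiv.sum_comp σ.symm k, Fintype.sum_sum_type]
    have e2 : ∑ p : P, k (σ.symm (.inr p)) = 0 := by
      refine Finset.sum_eq_zero fun p _ => ?_
      rcases h : σ.symm (.inr p) with p' | n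
      · rfl
      · change c (.inr n) (σ (.inr n)) = 0
        rw [← h, Equiv.apply_symm_apply, h]
    rw [e2, add_zero, Finset.sum_filter]
    refine Finset.sum_congr rfl fun n _ => ?_
    rcases h : σ.symm (.inl n) with p' | n'
    · rw [if_neg]
      push Not; exact ⟨p', by rw [hr, ← h, Equiv.apply_symm_apply]⟩
    · rw [if_pos]
      · change _ = c (.inr n') (σ (.inr n'))
        rw [← h, Equiv.apply_symm_apply, h]
      · rintro ⟨p, hp⟩
        rw [hr] at hp
        rw [← hp, Equiv.symm_apply_apply] at h
        cases h

/-- main estimate for products of vortices -/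
lemma Qk.vp_main {Ω : Set R2} (hΩ : IsOpen Ω) (hΩb : Bornology.IsBounded Ω)
    {S : Finset (R2 × Bool)} (hS : ∀ q ∈ S, q.1 ∈ Ω) (hinj : ∀ q ∈ S, ∀ q' ∈ S, q.1 = q'.1 → q = q') :
    ∃ κ : ℝ, Qk Ω (vp S) (Real.pi * κ) ∧ ∃ φ : R2 → ℝ, LipschitzWith 2 φ ∧ (∀ x, |φ x| ≤ 1) ∧ (∀ x, x ∉ Ω → φ x = 0) ∧
      κ ≤ ∑ q ∈ S, (if q.2 then 1 else -1) * φ q.1 := by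
  set P := S.filter (fun q => q.2 = true) with hP
  set N := S.filter (fun q => ¬ q.2 = true) with hN
  obtain ⟨r, hr1, hr2, F, G, hFG, hF, hG, hle⟩ := matching P N (fun p n => 2 * dist p.1.1 n.1.1)
    (fun p => sc Ω p.1.1) (fun n => sc Ω n.1.1)
  have mP : ∀ p : P, p.1 ∈ S ∧ p.1 = (p.1.1, true) := by
    rintro ⟨⟨x, b⟩, hp⟩
    simp only [hP, Finset.mem_filter] at hp
    exact ⟨hp.1, by rw [← hp.2]⟩
  have mN : ∀ p : N, p.1 ∈ S ∧ p.1 = (p.1.1, false) := by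
    rintro ⟨⟨x, b⟩, hp⟩
    simp only [hN, Finset.mem_filter, Bool.not_eq_true] at hp
    exact ⟨hp.1, by rw [← hp.2]⟩
  have iP : ∀ p p' : P, p.1.1 = p'.1.1 → p = p' := fun p p' h => Subtype.ext (hinj _ (mP p).1 _ (mP p').1 h)
  have iN : ∀ p p' : N, p.1.1 = p'.1.1 → p = p' := fun p p' h => Subtype.ext (hinj _ (mN p).1 _ (mN p').1 h)
  set UP : Finset (R2 × Bool) := (Finset.univ.filter (fun p : P => ¬ ∃ n, r p n)).image Subtype.val with hUP
  set UN : Finset (R2 × Bool) := (Finset.univ.filter (fun n : N => ¬ ∃ p, r p n)).image Subtype.val with hUN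
  set M : Finset (R2 × R2) := (Finset.univ.filter (fun m : P × N => r m.1 m.2)).image (fun m => (m.1.1.1, m.2.1.1)) with hM
  have hUPS : UP ⊆ S := by
    intro q hq; simp only [hUP, Finset.mem_image] at hq; obtain ⟨p, -, rfl⟩ := hq; exact (mP p).1
  have hUNS : UN ⊆ S := by
    intro q hq; simp only [hUN, Finset.mem_image] at hq; obtain ⟨p, -, rfl⟩ := hq; exact (mN p).1
  have hdisj : Disjoint UP UN := by
    rw [Finset.disjoint_left]
    intro q hq hq'
    simp only [hUP, hUN, Finset.mem_image] at hq hq'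
    obtain ⟨p, -, rfl⟩ := hq
    obtain ⟨n, -, h⟩ := hq'
    have := (mP p).2; have h2 := (mN n).2; rw [h, this] at h2; simp at h2
  have hMinj : ∀ m m' : P × N, (m.1.1.1, m.2.1.1) = (m'.1.1.1, m'.2.1.1) → m = m' := by
    intro m m' h
    rw [Prod.mk.injEq] at h
    exact Prod.ext (iP _ _ h.1) (iN _ _ h.2)
  have hMne : ∀ m ∈ M, m.1 ≠ m.2 := by
    intro m hm h
    simp only [hM, Finset.mem_image] at hm
    obtain ⟨⟨p, n⟩, -, rfl⟩ := hm
    have := hinj _ (mP p).1 _ (mN n).1 h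
    have h2 := (mP p).2; rw [this, (mN n).2] at h2; simp at h2
  have h1 := Qk.vp_singles hΩ hΩb (S := UP ∪ UN) (fun q hq => hS q (Finset.union_subset hUPS hUNS hq))
    (fun q hq q' hq' => hinj q (Finset.union_subset hUPS hUNS hq) q' (Finset.union_subset hUPS hUNS hq'))
  have h2 := h1.dipoles hΩ hΩb M hMne
  have hs1 : ∑ m ∈ M, 2 * dist m.1 m.2 = ∑ m ∈ Finset.univ.filter (fun m : P × N => r m.1 m.2), 2 * dist m.1.1.1 m.2.1.1 := by
    rw [hM, Finset.sum_image (fun m _ m' _ h => hMinj m m' h)]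
  have hs2 : ∑ q ∈ UP ∪ UN, sc Ω q.1 = ∑ p ∈ Finset.univ.filter (fun p : P => ¬ ∃ n, r p n), sc Ω p.1.1 +
        ∑ n ∈ Finset.univ.filter (fun n : N => ¬ ∃ p, r p n), sc Ω n.1.1 := by
    rw [Finset.sum_union hdisj, hUP, hUN, Finset.sum_image (fun m _ m' _ h => Subtype.ext h),
      Finset.sum_image (fun m _ m' _ h => Subtype.ext h)]
  have hsP : ∀ {X : Type} [CommMonoid X] (a : R2 × Bool → X), (∏ q ∈ S, a q) = (∏ p : P, a p.1) * ∏ n : N, a n.1 := by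
    intro X _ a
    rw [Finset.prod_coe_sort P a, Finset.prod_coe_sort N a, hP, hN, Finset.prod_filter_mul_prod_filter_not]
  have hvp : (fun y => vp (UP ∪ UN) y * ∏ m ∈ M, dp m.1 m.2 y) = vp S := by
    funext y
    unfold vp
    rw [hsP (fun q => vx q y), Finset.prod_union hdisj, hUP, hUN, hM,
      Finset.prod_image (fun m _ m' _ h => hMinj m m' h),
      Finset.prod_image (fun m _ m' _ h => Subtype.ext h), Finset.prod_image (fun m _ m' _ h => Subtype.ext h)]
    have e : ∀ m : P × N, dp m.1.1.1 m.2.1.1 y = vx m.1.1 y * vx m.2.1 y := by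
      intro m; unfold dp; rw [← (mP m.1).2, ← (mN m.2).2]
    simp only [e]
    rw [Finset.prod_mul_distrib, prod_matched r hr1 (fun p : P => vx p.1 y), prod_matched' r hr2 (fun p : N => vx p.1 y),
      ← Finset.prod_filter_mul_prod_filter_not Finset.univ (fun p : P => ∃ n, r p n) (fun p : P => vx p.1 y),
      ← Finset.prod_filter_mul_prod_filter_not Finset.univ (fun n : N => ∃ p, r p n) (fun p : N => vx p.1 y)]
    ring
  rw [hvp, ← mul_add] at h2
  refine ⟨_, h2, ?_⟩
  set F' : R2 → ℝ := fun x => if h : (x, true) ∈ P then F ⟨_, h⟩ else 0 with hF'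
  set G' : R2 → ℝ := fun x => if h : (x, false) ∈ N then G ⟨_, h⟩ else 0 with hG'
  have eF : ∀ p : P, F' p.1.1 = F p := by
    intro p
    have : (p.1.1, true) ∈ P := by rw [← (mP p).2]; exact p.2
    simp only [hF']; rw [dif_pos this]; congr 1; exact iP _ _ rfl
  have eG : ∀ p : N, G' p.1.1 = G p := by
    intro p
    have : (p.1.1, false) ∈ N := by rw [← (mN p).2]; exact p.2
    simp only [hG']; rw [dif_pos this]; congr 1; exact iN _ _ rfl
  obtain ⟨φ, p1, p2, p3, p4, p5⟩ := exists_phi Ω (P.image Prod.fst) (N.image Prod.fst) F' G'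
    (by
      intro p hp n hn
      simp only [Finset.mem_image] at hp hn
      obtain ⟨p, hp, rfl⟩ := hp; obtain ⟨n, hn, rfl⟩ := hn
      rw [eF ⟨p, hp⟩, eG ⟨n, hn⟩]; exact hFG _ _)
    (by
      intro p hp
      simp only [Finset.mem_image] at hp
      obtain ⟨p, hp, rfl⟩ := hp
      rw [eF ⟨p, hp⟩]; exact hF _)
    (by
      intro p hp
      simp only [Finset.mem_image] at hp
      obtain ⟨p, hp, rfl⟩ := hp
      rw [eG ⟨p, hp⟩]; exact hG _)
  refine ⟨φ, p1, p2, p3, ?_⟩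
  have hfin : ∑ q ∈ S, (if q.2 then 1 else -1) * φ q.1 = ∑ p : P, φ p.1.1 + ∑ n : N, - φ n.1.1 := by
    have := hsP (X := Multiplicative ℝ) (fun q => Multiplicative.ofAdd ((if q.2 then (1:ℝ) else -1) * φ q.1))
    have e : ∑ q ∈ S, (if q.2 then (1:ℝ) else -1) * φ q.1 =
      (∑ p : P, (if p.1.2 then (1:ℝ) else -1) * φ p.1.1) + ∑ p : N, (if p.1.2 then (1:ℝ) else -1) * φ p.1.1 := this
    rw [e]
    congr 1
    · refine Finset.sum_congr rfl fun p _ => ?_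
      rw [show p.1.2 = true by rw [(mP p).2]]; simp
    · refine Finset.sum_congr rfl fun p _ => ?_
      rw [show p.1.2 = false by rw [(mN p).2]]; simp
  rw [hfin, hs1, hs2]
  have g1 : ∑ p, F p ≤ ∑ p : P, φ p.1.1 := Finset.sum_le_sum fun p _ => by
    rw [← eF]; exact p4 _ (Finset.mem_image_of_mem _ p.2)
  have g2 : ∑ p, G p ≤ ∑ p : N, - φ p.1.1 := Finset.sum_le_sum fun p _ => by
    rw [← eG]; have := p5 _ (Finset.mem_image_of_mem _ p.2); linarith
  linarith

end Part10

section Part11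

lemma exists_cutoff {K U : Set R2} (hK : IsCompact K) (hU : IsOpen U) (hKU : K ⊆ U) :
    ∃ χ : R2 → ℝ, ContDiff ℝ (⊤ : ℕ∞) χ ∧ HasCompactSupport χ ∧ tsupport χ ⊆ U ∧
      (∀ x ∈ K, ∀ᶠ y in 𝓝 x, χ y = 1) ∧ ∀ x, χ x ∈ Icc (0:ℝ) 1 := by
  obtain ⟨K', hK', h1, h2⟩ := exists_compact_between hK hU hKU
  obtain ⟨f, hf1, hf2, hf3⟩ := exists_contMDiffMap_one_nhds_of_subset_interior (modelWithCornersSelf ℝ R2)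
    (n := (⊤ : ℕ∞)) hK.isClosed h1
  have hts : tsupport f ⊆ K' := by
    refine closure_minimal ?_ hK'.isClosed
    intro x hx; by_contra h; exact hx (hf2 x h)
  refine ⟨f, f.contMDiff.contDiff, hK'.of_isClosed_subset (isClosed_tsupport _) hts, hts.trans h2, ?_, hf3⟩
  intro x hx
  exact (eventually_nhdsSet_iff_forall.1 hf1) x hx

lemma fderiv_zero_of_notMem_tsupport {φ : R2 → ℝ} {x : R2} (h : x ∉ tsupport φ) : fderiv ℝ φ x = 0 := by
  have : φ =ᶠ[𝓝 x] fun _ => 0 := notMem_tsupport_iff_eventuallyEq.1 h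
  rw [this.fderiv_eq]; simp

lemma ibp {Ω : Set R2} (hΩ : IsOpen Ω) {A φ : R2 → ℝ} {C : ℝ≥0} (hA : ContDiffOn ℝ 1 A Ω) (hφ : LipschitzWith C φ)
    (hc : HasCompactSupport φ) (hs : tsupport φ ⊆ Ω) (v : R2) :
    ∫ x in Ω, A x * fderiv ℝ φ x v = - ∫ x in Ω, fderiv ℝ A x v * φ x := by
  obtain ⟨χ, c1, c2, c3, c4, c5⟩ := exists_cutoff hc hΩ hs
  set B : R2 → ℝ := fun x => χ x * A x with hB
  have hBs : ContDiff ℝ 1 B := by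
    rw [contDiff_iff_contDiffAt]
    intro x
    by_cases hx : x ∈ Ω
    · exact (c1.of_le (by exact_mod_cast le_top)).contDiffAt.mul (hA.contDiffAt (hΩ.mem_nhds hx))
    · have h0 : B =ᶠ[𝓝 x] fun _ => 0 := by
        filter_upwards [notMem_tsupport_iff_eventuallyEq.1 (fun h => hx (c3 h))] with y hy
        simp [hB, hy]
      exact contDiffAt_const.congr_of_eventuallyEq h0
  have hBc : HasCompactSupport B := c2.mul_right
  obtain ⟨D, hD⟩ := hBs.lipschitzWith_of_hasCompactSupport hBc one_ne_zero
  have key := hD.integral_lineDeriv_mul_eq (μ := (volume : Measure R2)) hφ hc v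
  have e1 : ∫ x, lineDeriv ℝ B x v * φ x = ∫ x in Ω, fderiv ℝ A x v * φ x := by
    rw [setIntegral_eq_integral_of_forall_compl_eq_zero]
    · refine integral_congr_ae (ae_of_all _ fun x => ?_)
      change lineDeriv ℝ B x v * φ x = fderiv ℝ A x v * φ x
      by_cases hx : x ∈ tsupport φ
      · rw [((hBs.differentiable one_ne_zero) x).lineDeriv_eq_fderiv]
        have : B =ᶠ[𝓝 x] A := by
          filter_upwards [c4 x hx] with y hy
          simp [hB, hy]
        rw [this.fderiv_eq]
      · simp [image_eq_zero_of_notMem_tsupport hx]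
    · intro x hx
      simp [image_eq_zero_of_notMem_tsupport (fun h => hx (hs h))]
  have e2 : ∫ x, lineDeriv ℝ φ x (-v) * B x = - ∫ x in Ω, A x * fderiv ℝ φ x v := by
    rw [setIntegral_eq_integral_of_forall_compl_eq_zero, ← integral_neg]
    · refine integral_congr_ae ?_
      filter_upwards [hφ.ae_differentiableAt] with x hx
      rw [hx.lineDeriv_eq_fderiv]
      by_cases hx' : x ∈ tsupport φ
      · have : B x = A x := by simp [hB, (c4 x hx').self_of_nhds]
        rw [this, map_neg]; ring
      · simp [fderiv_zero_of_notMem_tsupport hx']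
    · intro x hx
      simp [fderiv_zero_of_notMem_tsupport (fun h => hx (hs h))]
  rw [e1, e2] at key
  linarith

/-- pairing of a vector field with the rotated gradient -/
def Jp (Ω : Set R2) (w : R2 → ℂ) (φ : R2 → ℝ) : ℝ :=
  ∫ x in Ω, (1 / 2 : ℝ) * ((w x).re * fderiv ℝ φ x (bv 1) - (w x).im * fderiv ℝ φ x (bv 0))

lemma norm_fderiv_bv {φ : R2 → ℝ} {C : ℝ≥0} (hφ : LipschitzWith C φ) (x : R2) (j) : |fderiv ℝ φ x (bv j)| ≤ C := by
  have := (fderiv ℝ φ x).le_opNorm (bv j)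
  rw [norm_bv, mul_one] at this
  exact this.trans (norm_fderiv_le_of_lipschitz ℝ hφ)

lemma Jp_int {Ω : Set R2} {w : R2 → ℂ} {φ : R2 → ℝ} {C : ℝ≥0} (hw : IntegrableOn w Ω) (hφ : LipschitzWith C φ) :
    IntegrableOn (fun x => (1 / 2 : ℝ) * ((w x).re * fderiv ℝ φ x (bv 1) - (w x).im * fderiv ℝ φ x (bv 0))) Ω := by
  have h1 : ∀ j, AEStronglyMeasurable (fun x => fderiv ℝ φ x (bv j)) (volume.restrict Ω) := fun j =>
    (measurable_fderiv_apply_const ℝ φ (bv j)).aestronglyMeasurable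
  refine Integrable.const_mul (Integrable.sub ?_ ?_) _
  · exact (hw.re).mul_bdd (c := C) (h1 1) (ae_of_all _ fun x => norm_fderiv_bv hφ x 1)
  · exact (hw.im).mul_bdd (c := C) (h1 0) (ae_of_all _ fun x => norm_fderiv_bv hφ x 0)

lemma Jp_abs_le (a z : ℂ) {p q : ℝ} {C : ℝ} (hp : |p| ≤ C) (hq : |q| ≤ C) :
    |(1 / 2 : ℝ) * (a.re * q - a.im * p)| ≤ C * ‖a‖ := by
  have h1 := Complex.abs_re_le_norm a
  have h2 := Complex.abs_im_le_norm a
  have hC : 0 ≤ C := (abs_nonneg _).trans hp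
  rw [abs_mul, abs_of_pos (by norm_num : (0:ℝ) < 1/2)]
  have h3 := abs_sub (a.re * q) (a.im * p)
  rw [abs_mul, abs_mul] at h3
  have h4 : |a.re| * |q| ≤ ‖a‖ * C := mul_le_mul h1 hq (abs_nonneg _) (norm_nonneg _)
  have h5 : |a.im| * |p| ≤ ‖a‖ * C := mul_le_mul h2 hp (abs_nonneg _) (norm_nonneg _)
  linarith

lemma Jp_diff {Ω : Set R2} {w w' : R2 → ℂ} {φ : R2 → ℝ} {C : ℝ≥0} (hw : IntegrableOn w Ω) (hw' : IntegrableOn w' Ω)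
    (hφ : LipschitzWith C φ) : |Jp Ω w φ - Jp Ω w' φ| ≤ C * ∫ x in Ω, ‖w x - w' x‖ := by
  unfold Jp
  rw [← integral_sub (Jp_int hw hφ) (Jp_int hw' hφ), ← integral_const_mul, ← Real.norm_eq_abs]
  refine norm_integral_le_of_norm_le ((hw.sub hw').norm.const_mul _) (ae_of_all _ fun x => ?_)
  have := Jp_abs_le (w x - w' x) 0 (norm_fderiv_bv hφ x 0) (norm_fderiv_bv hφ x 1)
  rw [Real.norm_eq_abs]
  refine le_trans (le_of_eq ?_) this
  congr 1; simp only [Complex.sub_re, Complex.sub_im]; ring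

lemma Jp_add {Ω : Set R2} {w w' : R2 → ℂ} {φ : R2 → ℝ} {C : ℝ≥0} (hw : IntegrableOn w Ω) (hw' : IntegrableOn w' Ω)
    (hφ : LipschitzWith C φ) : Jp Ω (fun x => w x + w' x) φ = Jp Ω w φ + Jp Ω w' φ := by
  unfold Jp
  rw [← integral_add (Jp_int hw hφ) (Jp_int hw' hφ)]
  refine integral_congr_ae (ae_of_all _ fun x => ?_)
  simp only [Complex.add_re, Complex.add_im]; ring

lemma Jp_sum {Ω : Set R2} {ι : Type*} (S : Finset ι) {w : ι → R2 → ℂ} {φ : R2 → ℝ} {C : ℝ≥0} (hw : ∀ i ∈ S, IntegrableOn (w i) Ω)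
    (hφ : LipschitzWith C φ) : Jp Ω (fun x => ∑ i ∈ S, w i x) φ = ∑ i ∈ S, Jp Ω (w i) φ := by
  induction S using Finset.induction_on with
  | empty => simp [Jp]
  | insert i S hi ih =>
    simp only [Finset.sum_insert hi]
    rw [Jp_add (hw i (by simp)) _ hφ, ih fun j hj => hw j (by simp [hj])]
    exact integrable_finsetSum _ fun j hj => hw j (by simp [hj])

lemma Jp_congr {Ω : Set R2} {w w' : R2 → ℂ} {φ : R2 → ℝ} (h : ∀ᵐ x ∂(volume.restrict Ω), w x = w' x) :
    Jp Ω w φ = Jp Ω w' φ := by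
  unfold Jp
  refine integral_congr_ae ?_
  filter_upwards [h] with x hx
  rw [hx]

lemma Jp_curl {Ω : Set R2} (hΩ : IsOpen Ω) {w : R2 → ℂ} {φ : R2 → ℝ} {C : ℝ≥0} (hw : ContDiffOn ℝ 1 w Ω)
    (hφ : LipschitzWith C φ) (hc : HasCompactSupport φ) (hs : tsupport φ ⊆ Ω) :
    Jp Ω w φ = ∫ x in Ω, (1 / 2 : ℝ) * ((fderiv ℝ w x (bv 0)).im - (fderiv ℝ w x (bv 1)).re) * φ x := by
  have hre : ContDiffOn ℝ 1 (fun x => (w x).re) Ω := Complex.reCLM.contDiff.comp_contDiffOn hw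
  have him : ContDiffOn ℝ 1 (fun x => (w x).im) Ω := Complex.imCLM.contDiff.comp_contDiffOn hw
  have h1 := ibp hΩ hre hφ hc hs (bv 1)
  have h2 := ibp hΩ him hφ hc hs (bv 0)
  have hcont : ∀ {A : R2 → ℝ}, ContDiffOn ℝ 1 A Ω → ∀ v, IntegrableOn (fun x => A x * fderiv ℝ φ x v) Ω := by
    intro A hA v
    have : IntegrableOn (fun x => A x * fderiv ℝ φ x v) (tsupport φ) := by
      refine Integrable.mul_bdd (c := C * ‖v‖) ((hA.continuousOn.mono hs).integrableOn_compact hc)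
        (measurable_fderiv_apply_const ℝ φ v).aestronglyMeasurable (ae_of_all _ fun x => ?_)
      exact ((fderiv ℝ φ x).le_opNorm v).trans (by gcongr; exact norm_fderiv_le_of_lipschitz ℝ hφ)
    refine IntegrableOn.mono_set (t := univ) ?_ (subset_univ _)
    rw [integrableOn_univ]
    refine (integrableOn_iff_integrable_of_support_subset ?_).1 this
    intro x hx; by_contra h; exact hx (by simp [fderiv_zero_of_notMem_tsupport h])
  have hcont' : ∀ {A : R2 → ℝ}, ContDiffOn ℝ 1 A Ω → ∀ v, IntegrableOn (fun x => fderiv ℝ A x v * φ x) Ω := by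
    intro A hA v
    have : IntegrableOn (fun x => fderiv ℝ A x v * φ x) (tsupport φ) := by
      refine ContinuousOn.integrableOn_compact hc (ContinuousOn.mul ?_ hφ.continuous.continuousOn)
      exact ((hA.continuousOn_fderiv_of_isOpen hΩ le_rfl).mono hs).clm_apply continuousOn_const
    refine IntegrableOn.mono_set (t := univ) ?_ (subset_univ _)
    rw [integrableOn_univ]
    refine (integrableOn_iff_integrable_of_support_subset ?_).1 this
    intro x hx; by_contra h; exact hx (by simp [image_eq_zero_of_notMem_tsupport h])
  unfold Jp
  rw [integral_const_mul, integral_sub (hcont hre _) (hcont him _), h1, h2,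
    show - (∫ x in Ω, fderiv ℝ (fun x => (w x).re) x (bv 1) * φ x) - - (∫ x in Ω, fderiv ℝ (fun x => (w x).im) x (bv 0) * φ x)
      = (∫ x in Ω, fderiv ℝ (fun x => (w x).im) x (bv 0) * φ x) - ∫ x in Ω, fderiv ℝ (fun x => (w x).re) x (bv 1) * φ x by ring,
    ← integral_sub (hcont' him _) (hcont' hre _), ← integral_const_mul]
  refine setIntegral_congr_fun hΩ.measurableSet fun x hx => ?_
  have hd : HasFDerivAt w (fderiv ℝ w x) x :=
    ((hw.contDiffAt (hΩ.mem_nhds hx)).differentiableAt one_ne_zero).hasFDerivAt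
  have d1 := (Complex.imCLM.hasFDerivAt.comp x hd).fderiv
  have d2 := (Complex.reCLM.hasFDerivAt.comp x hd).fderiv
  have d1' : fderiv ℝ (fun x => (w x).im) x = Complex.imCLM.comp (fderiv ℝ w x) := d1
  have d2' : fderiv ℝ (fun x => (w x).re) x = Complex.reCLM.comp (fderiv ℝ w x) := d2
  simp only [d1', d2', ContinuousLinearMap.comp_apply, Complex.imCLM_apply, Complex.reCLM_apply]
  ring

end Part11

section Part12

lemma W_hasFDerivAt {g : R2 → ℂ} {x : R2} {D0 D1 : R2 →L[ℝ] ℂ} (h0 : HasFDerivAt (fun y => dj 0 g y / g y) D0 x)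
    (h1 : HasFDerivAt (fun y => dj 1 g y / g y) D1 x) (v : R2) : fderiv ℝ (W g) x v = ⟨(D0 v).im, (D1 v).im⟩ := by
  have e : W g = fun y => (((dj 0 g y / g y).im : ℝ) : ℂ) + (((dj 1 g y / g y).im : ℝ) : ℂ) * Complex.I := by
    funext y; unfold W; apply Complex.ext <;> simp
  have k0 := Complex.ofRealCLM.hasFDerivAt.comp x (Complex.imCLM.hasFDerivAt.comp x h0)
  have k1 := Complex.ofRealCLM.hasFDerivAt.comp x (Complex.imCLM.hasFDerivAt.comp x h1)
  have k := (k0.add (k1.mul_const' Complex.I)).fderiv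
  rw [e]
  have k' : fderiv ℝ (fun y => (((dj 0 g y / g y).im : ℝ) : ℂ) + (((dj 1 g y / g y).im : ℝ) : ℂ) * Complex.I) x = _ := k
  rw [k']
  apply Complex.ext <;> simp

lemma contDiffAt_dj {g : R2 → ℂ} {x : R2} (hg : ContDiffAt ℝ 2 g x) (j) : ContDiffAt ℝ 1 (dj j g) x := by
  unfold dj
  exact (hg.fderiv_right (m := 1) (by norm_num)).clm_apply contDiffAt_const

lemma contDiffAt_logd {g : R2 → ℂ} {x : R2} (hg : ContDiffAt ℝ 2 g x) (h0 : g x ≠ 0) (j) :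
    ContDiffAt ℝ 1 (fun y => dj j g y / g y) x := by
  simp only [div_eq_mul_inv]
  exact (contDiffAt_dj hg j).mul ((hg.of_le (by norm_num)).inv h0)

lemma contDiffAt_W {g : R2 → ℂ} {x : R2} (hg : ContDiffAt ℝ 2 g x) (h0 : g x ≠ 0) : ContDiffAt ℝ 1 (W g) x := by
  have e : W g = fun y => (((dj 0 g y / g y).im : ℝ) : ℂ) + (((dj 1 g y / g y).im : ℝ) : ℂ) * Complex.I := by
    funext y; unfold W; apply Complex.ext <;> simp
  rw [e]
  have k : ∀ j, ContDiffAt ℝ 1 (fun y => (((dj j g y / g y).im : ℝ) : ℂ)) x := fun j =>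
    Complex.ofRealCLM.contDiff.contDiffAt.comp x (Complex.imCLM.contDiff.contDiffAt.comp x (contDiffAt_logd hg h0 j))
  exact (k 0).add ((k 1).mul contDiffAt_const)

lemma curl_W {g : R2 → ℂ} {x : R2} (hg : ContDiffAt ℝ 2 g x) (h0 : g x ≠ 0) :
    (fderiv ℝ (W g) x (bv 0)).im - (fderiv ℝ (W g) x (bv 1)).re = 0 := by
  have hd : ∀ j, HasFDerivAt (fun y => dj j g y / g y) (fderiv ℝ (fun y => dj j g y / g y) x) x := fun j =>
    ((contDiffAt_logd hg h0 j).differentiableAt one_ne_zero).hasFDerivAt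
  rw [W_hasFDerivAt (hd 0) (hd 1), W_hasFDerivAt (hd 0) (hd 1)]
  set D0 := fderiv ℝ (fun y => dj 0 g y / g y) x
  set D1 := fderiv ℝ (fun y => dj 1 g y / g y) x
  have hgd : HasFDerivAt g (fderiv ℝ g x) x := (hg.differentiableAt two_ne_zero).hasFDerivAt
  have hne : ∀ᶠ y in 𝓝 x, g y ≠ 0 := hg.continuousAt.eventually_ne h0
  have hprod : ∀ j, fderiv ℝ (dj j g) x = (dj j g x / g x) • fderiv ℝ g x + g x • fderiv ℝ (fun y => dj j g y / g y) x := by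
    intro j
    have h1 := ((hd j).mul hgd)
    have h2 : dj j g =ᶠ[𝓝 x] fun y => (dj j g y / g y) * g y := by
      filter_upwards [hne] with y hy
      rw [div_mul_cancel₀ _ hy]
    rw [h2.fderiv_eq]; exact h1.fderiv
  have hsym := hg.isSymmSndFDerivAt (by simp) (bv 0) (bv 1)
  have hdd : DifferentiableAt ℝ (fderiv ℝ g) x := (hg.fderiv_right (m := 1) (by norm_num)).differentiableAt one_ne_zero
  have hj : ∀ j v, fderiv ℝ (dj j g) x v = fderiv ℝ (fderiv ℝ g) x v (bv j) := by
    intro j v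
    have := (hdd.hasFDerivAt.clm_apply (hasFDerivAt_const (bv j) x)).fderiv
    have h' : fderiv ℝ (dj j g) x = _ := this
    rw [h']; simp
  have a1 : fderiv ℝ (fderiv ℝ g) x (bv 0) (bv 1) = (dj 1 g x / g x) * dj 0 g x + g x * D1 (bv 0) := by
    rw [← hj, hprod]; rfl
  have a2 : fderiv ℝ (fderiv ℝ g) x (bv 1) (bv 0) = (dj 0 g x / g x) * dj 1 g x + g x * D0 (bv 1) := by
    rw [← hj, hprod]; rfl
  have : D1 (bv 0) = D0 (bv 1) := by
    apply mul_left_cancel₀ h0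
    have e : (dj 1 g x / g x) * dj 0 g x = (dj 0 g x / g x) * dj 1 g x := by ring
    rw [hsym, a2, e] at a1
    exact (add_left_cancel a1).symm
  simp [this]

lemma Jp_smooth {Ω : Set R2} (hΩ : IsOpen Ω) {g : R2 → ℂ} {φ : R2 → ℝ} {C : ℝ≥0} (hg : ContDiffOn ℝ 2 g Ω) (h0 : ∀ x ∈ Ω, g x ≠ 0)
    (hφ : LipschitzWith C φ) (hc : HasCompactSupport φ) (hs : tsupport φ ⊆ Ω) : Jp Ω (W g) φ = 0 := by
  rw [Jp_curl hΩ (fun x hx => (contDiffAt_W (hg.contDiffAt (hΩ.mem_nhds hx)) (h0 x hx)).contDiffWithinAt) hφ hc hs]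
  rw [setIntegral_congr_fun (g := fun _ => (0:ℝ)) hΩ.measurableSet]
  · simp
  · intro x hx
    simp only [curl_W (hg.contDiffAt (hΩ.mem_nhds hx)) (h0 x hx)]; simp

/-- regularized vortex field -/
def wr (a : R2) (ε : ℝ) (x : R2) : ℂ := Complex.I * cx (x - a) * (((‖x - a‖ ^ 2 + ε ^ 2)⁻¹ : ℝ) : ℂ)

lemma wr_fderiv (a : R2) {ε : ℝ} (hε : 0 < ε) (x : R2) :
    ContDiffAt ℝ 1 (wr a ε) x ∧ (fderiv ℝ (wr a ε) x (bv 0)).im - (fderiv ℝ (wr a ε) x (bv 1)).re = 2 * kern ε (x - a) := by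
  have hs : ‖x - a‖ ^ 2 + ε ^ 2 ≠ 0 := by positivity
  constructor
  · unfold wr
    refine (contDiffAt_const.mul ?_).mul ?_
    · exact contDiff_cx.contDiffAt.comp x (contDiffAt_id.sub contDiffAt_const)
    · refine Complex.ofRealCLM.contDiff.contDiffAt.comp x (ContDiffAt.inv ?_ hs)
      exact ((contDiffAt_id.sub contDiffAt_const).norm_sq ℝ).add contDiffAt_const
  have k1 : HasFDerivAt (fun y : R2 => cx (y - a)) (cx.toContinuousLinearEquiv : R2 →L[ℝ] ℂ) x := by
    have := (cx.toContinuousLinearEquiv : R2 →L[ℝ] ℂ).hasFDerivAt (x := x - a)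
    have h := this.comp x ((hasFDerivAt_id x).sub_const a)
    rw [ContinuousLinearMap.comp_id] at h
    exact h
  have k2 : HasFDerivAt (fun y : R2 => ‖y - a‖ ^ 2 + ε ^ 2) (2 • (innerSL ℝ (x - a))) x := by
    have := (((hasFDerivAt_id x).sub_const a).norm_sq).add_const (ε ^ 2)
    rw [ContinuousLinearMap.comp_id] at this
    exact this
  have k3 := (hasDerivAt_inv hs).comp_hasFDerivAt x k2
  have k4 := Complex.ofRealCLM.hasFDerivAt.comp x k3
  have k5 := (k1.const_mul Complex.I).mul k4
  have k6 : fderiv ℝ (wr a ε) x = _ := k5.fderiv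
  have i0 : inner ℝ (x - a) (bv 0) = (cx (x - a)).re := by rw [cx_re]; simp [bv, EuclideanSpace.inner_single_right]
  have i1 : inner ℝ (x - a) (bv 1) = (cx (x - a)).im := by rw [cx_im]; simp [bv, EuclideanSpace.inner_single_right]
  have hn : ‖x - a‖ ^ 2 = (cx (x - a)).re ^ 2 + (cx (x - a)).im ^ 2 := by
    rw [← cx.norm_map, Complex.sq_norm, Complex.normSq_apply]; ring
  rw [k6]
  have c0 : (cx.toContinuousLinearEquiv : R2 →L[ℝ] ℂ) (bv 0) = 1 := cx_bv0
  have c1 : (cx.toContinuousLinearEquiv : R2 →L[ℝ] ℂ) (bv 1) = Complex.I := cx_bv1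
  unfold kern
  clear k1 k2 k3 k4 k5 k6
  generalize hz : cx (x - a) = z at *
  simp only [add_apply, smul_apply, c0, c1, ContinuousLinearMap.comp_apply, innerSL_apply_apply, i0, i1, Function.comp_apply,
    Complex.ofRealCLM_apply, smul_eq_mul, nsmul_eq_mul]
  have hs' : ‖x - a‖ ^ 2 + ε ^ 2 = z.re ^ 2 + z.im ^ 2 + ε ^ 2 := by rw [hn]
  rw [hs'] at hs ⊢
  generalize hS : z.re ^ 2 + z.im ^ 2 + ε ^ 2 = s at *
  simp only [Complex.add_im, Complex.add_re, Complex.mul_im, Complex.mul_re, Complex.ofReal_im, Complex.ofReal_re, Complex.I_re, Complex.I_im,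
    Complex.one_re, Complex.one_im]
  have : ε ^ 2 = s - z.re ^ 2 - z.im ^ 2 := by rw [← hS]; ring
  rw [this]
  push_cast
  field_simp
  ring

end Part12

section Part13

lemma kern_tendsto {φ : R2 → ℝ} (hφ : Continuous φ) (hc : HasCompactSupport φ) (a : R2) {e : ℕ → ℝ} (he : ∀ n, 0 < e n)
    (hl : Tendsto e atTop (𝓝 0)) : Tendsto (fun n => ∫ x, kern (e n) (x - a) * φ x) atTop (𝓝 (Real.pi * φ a)) := by
  obtain ⟨B, hB⟩ := hφ.bounded_above_of_compact_support hc
  have e1 : ∀ n, ∫ x, kern (e n) (x - a) * φ x = ∫ x, kern 1 x * φ (e n • x + a) := by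
    intro n
    have h1 : ∫ x, kern (e n) (x - a) * φ x = ∫ x, kern (e n) x * φ (x + a) := by
      rw [← integral_add_right_eq_self (fun x => kern (e n) (x - a) * φ x) a]
      simp
    have h2 := Measure.integral_comp_smul (volume : Measure R2) (fun x => kern (e n) x * φ (x + a)) (e n)
    have hk : ∀ x : R2, kern (e n) (e n • x) = ((e n) ^ 2)⁻¹ * kern 1 x := by
      intro x
      have := he n
      unfold kern
      rw [norm_smul, Real.norm_eq_abs, mul_pow, sq_abs]
      have h3 : ‖x‖ ^ 2 + 1 ^ 2 ≠ 0 := by positivity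
      have h4 : e n ^ 2 * ‖x‖ ^ 2 + e n ^ 2 ≠ 0 := by positivity
      field_simp
    simp only [hk] at h2
    rw [h1]
    have h5 : Module.finrank ℝ R2 = 2 := by simp
    rw [h5, abs_of_pos (by have := he n; positivity)] at h2
    simp only [mul_assoc, smul_eq_mul] at h2
    rw [integral_const_mul] at h2
    exact (mul_left_cancel₀ (by have := he n; positivity) h2).symm
  simp only [e1]
  have hπ : Real.pi * φ a = ∫ x, kern 1 x * φ a := by
    rw [integral_mul_const, (kern_integral one_pos).2]
  rw [hπ]
  refine tendsto_integral_of_dominated_convergence (fun x => kern 1 x * B) ?_ ((kern_integral one_pos).1.mul_const B) ?_ ?_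
  · intro n
    exact ((continuous_kern one_pos).mul (hφ.comp (by fun_prop))).aestronglyMeasurable
  · intro n
    refine ae_of_all _ fun x => ?_
    rw [norm_mul, Real.norm_of_nonneg (kern_nonneg 1 x)]
    exact mul_le_mul_of_nonneg_left (hB _) (kern_nonneg 1 x)
  · refine ae_of_all _ fun x => Tendsto.const_mul _ ?_
    have : Tendsto (fun n => e n • x + a) atTop (𝓝 a) := by
      simpa using (hl.smul_const x).add_const a
    exact (hφ.tendsto a).comp this

lemma integrableOn_W_vx {Ω : Set R2} (hΩb : Bornology.IsBounded Ω) (q : R2 × Bool) : IntegrableOn (W (vx q)) Ω := by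
  refine (integrableOn_inv_norm q.1 hΩb).mono' (measurable_W (contDiff_vx q (n := 1)).continuous.measurable).aestronglyMeasurable ?_
  have : ∀ᵐ x ∂(volume.restrict Ω), x ≠ q.1 := by simp [ae_iff]
  filter_upwards [this] with x hx
  rw [norm_W_vx hx]

lemma wr_sub_norm {a x : R2} (h : x ≠ a) {ε : ℝ} :
    ‖wr a ε x - W (vx (a, true)) x‖ ≤ ‖x - a‖⁻¹ ∧ ‖wr a ε x‖ ≤ ‖x - a‖⁻¹ := by
  have hr : 0 < ‖x - a‖ := norm_pos_iff.2 (sub_ne_zero.2 h)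
  have h1 : (‖x - a‖ ^ 2 + ε ^ 2)⁻¹ ≤ (‖x - a‖ ^ 2)⁻¹ := by
    apply inv_anti₀ (by positivity); nlinarith [sq_nonneg ε]
  have h2 : 0 ≤ (‖x - a‖ ^ 2 + ε ^ 2)⁻¹ := by positivity
  have e : ‖x - a‖ * (‖x - a‖ ^ 2)⁻¹ = ‖x - a‖⁻¹ := by field_simp
  constructor
  · rw [W_vx_true h, wr, ← mul_sub, ← Complex.ofReal_sub, norm_mul, norm_mul, Complex.norm_I, one_mul,
      LinearIsometryEquiv.norm_map, Complex.norm_real, Real.norm_eq_abs, ← e]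
    gcongr
    rw [abs_le]; constructor <;> linarith
  · rw [wr, norm_mul, norm_mul, Complex.norm_I, one_mul,
      LinearIsometryEquiv.norm_map, Complex.norm_real, Real.norm_of_nonneg h2, ← e]
    gcongr

lemma continuous_wr (a : R2) {ε : ℝ} (hε : 0 < ε) : Continuous (wr a ε) :=
  continuous_iff_continuousAt.2 fun x => (wr_fderiv a hε x).1.continuousAt

lemma Jp_vx_true {Ω : Set R2} (hΩ : IsOpen Ω) (hΩb : Bornology.IsBounded Ω) {φ : R2 → ℝ} {C : ℝ≥0}
    (hφ : LipschitzWith C φ) (hc : HasCompactSupport φ) (hs : tsupport φ ⊆ Ω) (a : R2) :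
    Jp Ω (W (vx (a, true))) φ = Real.pi * φ a := by
  set e : ℕ → ℝ := fun n => 1 / ((n : ℝ) + 1) with hed
  have he : ∀ n, 0 < e n := fun n => by simp only [hed]; positivity
  have hl : Tendsto e atTop (𝓝 0) := tendsto_one_div_add_atTop_nhds_zero_nat
  have hne : ∀ᵐ x ∂(volume.restrict Ω), x ≠ a := by simp [ae_iff]
  have hIntg : ∀ n, IntegrableOn (wr a (e n)) Ω := fun n => by
    refine (integrableOn_inv_norm a hΩb).mono' (continuous_wr a (he n)).aestronglyMeasurable ?_
    filter_upwards [hne] with x hx using (wr_sub_norm hx).2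
  have h1 : ∀ n, Jp Ω (wr a (e n)) φ = ∫ x, kern (e n) (x - a) * φ x := by
    intro n
    rw [Jp_curl hΩ (fun x _ => (wr_fderiv a (he n) x).1.contDiffWithinAt) hφ hc hs,
      setIntegral_eq_integral_of_forall_compl_eq_zero]
    · refine integral_congr_ae (ae_of_all _ fun x => ?_)
      simp only
      rw [(wr_fderiv a (he n) x).2]; ring
    · intro x hx
      simp [image_eq_zero_of_notMem_tsupport (fun h => hx (hs h))]
  have h2 := kern_tendsto hφ.continuous hc a he hl
  simp only [← h1] at h2
  refine tendsto_nhds_unique ?_ h2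
  rw [tendsto_iff_dist_tendsto_zero]
  have h3 : Tendsto (fun n => (C : ℝ) * ∫ x in Ω, ‖wr a (e n) x - W (vx (a, true)) x‖) atTop (𝓝 0) := by
    rw [← mul_zero (C : ℝ)]
    refine Tendsto.const_mul _ ?_
    have : (0:ℝ) = ∫ x in Ω, (0:ℝ) := by simp
    rw [this]
    refine tendsto_integral_of_dominated_convergence (fun x => ‖x - a‖⁻¹) ?_ (integrableOn_inv_norm a hΩb) ?_ ?_
    · intro n; exact ((hIntg n).sub (integrableOn_W_vx hΩb _)).aestronglyMeasurable.norm
    · intro n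
      filter_upwards [hne] with x hx
      rw [norm_norm]; exact (wr_sub_norm hx).1
    · filter_upwards [hne] with x hx
      have hr : ‖x - a‖ ^ 2 ≠ 0 := by simpa [sub_eq_zero] using hx
      rw [← norm_zero (E := ℂ), ← sub_self (W (vx (a, true)) x)]
      refine (Tendsto.sub_const ?_ _).norm
      rw [W_vx_true hx]
      unfold wr
      refine Tendsto.const_mul _ ((Complex.continuous_ofReal.tendsto _).comp ?_)
      refine Tendsto.inv₀ ?_ hr
      simpa using (tendsto_const_nhds (x := ‖x - a‖ ^ 2)).add (hl.pow 2)
  refine squeeze_zero (fun n => dist_nonneg) (fun n => ?_) h3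
  rw [Real.dist_eq]
  exact Jp_diff (hIntg n) (integrableOn_W_vx hΩb _) hφ

lemma Jp_vx {Ω : Set R2} (hΩ : IsOpen Ω) (hΩb : Bornology.IsBounded Ω) {φ : R2 → ℝ} {C : ℝ≥0}
    (hφ : LipschitzWith C φ) (hc : HasCompactSupport φ) (hs : tsupport φ ⊆ Ω) (q : R2 × Bool) :
    Jp Ω (W (vx q)) φ = Real.pi * ((if q.2 then 1 else -1) * φ q.1) := by
  obtain ⟨a, b⟩ := q
  cases b with
  | true => simpa using Jp_vx_true hΩ hΩb hφ hc hs a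
  | false =>
    have := Jp_vx_true hΩ hΩb hφ hc hs a
    simp only [Bool.false_eq_true, if_false]
    rw [show Real.pi * (-1 * φ a) = - (Real.pi * φ a) by ring, ← this]
    unfold Jp
    rw [← integral_neg]
    refine integral_congr_ae (ae_of_all _ fun x => ?_)
    simp only [W_vx_false, Complex.neg_re, Complex.neg_im]; ring

lemma integrableOn_W_smooth {Ω : Set R2} (hΩb : Bornology.IsBounded Ω) {g : R2 → ℂ} (hg : ContDiff ℝ 2 g)
    (h0 : ∀ x ∈ closure Ω, g x ≠ 0) : IntegrableOn (W g) Ω := by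
  have : ContinuousOn (W g) (closure Ω) := fun x hx =>
    (contDiffAt_W hg.contDiffAt (h0 x hx)).continuousAt.continuousWithinAt
  exact (this.integrableOn_compact hΩb.isCompact_closure).mono_set subset_closure

lemma W_gvp_ae {Ω : Set R2} (hΩ : IsOpen Ω) {g : R2 → ℂ} (hg : ContDiff ℝ 2 g)
    (h0 : ∀ x ∈ closure Ω, g x ≠ 0) (S : Finset (R2 × Bool)) :
    ∀ᵐ x ∂(volume.restrict Ω), W (fun y => g y * vp S y) x = W g x + ∑ q ∈ S, W (vx q) x := by
  filter_upwards [ae_ne_of_finset S _, ae_restrict_mem hΩ.measurableSet] with x hx hxΩ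
  rw [W_mul (hg.differentiable two_ne_zero x) ((contDiff_vp S (n := 1)).differentiable one_ne_zero x) (h0 x (subset_closure hxΩ))
    (Finset.prod_ne_zero_iff.2 fun q hq => vx_ne (hx q hq)), W_vp hx]

lemma integrableOn_W_gvp {Ω : Set R2} (hΩ : IsOpen Ω) (hΩb : Bornology.IsBounded Ω) {g : R2 → ℂ} (hg : ContDiff ℝ 2 g)
    (h0 : ∀ x ∈ closure Ω, g x ≠ 0) (S : Finset (R2 × Bool)) : IntegrableOn (W (fun y => g y * vp S y)) Ω := by
  refine Integrable.congr (f := fun x => W g x + ∑ q ∈ S, W (vx q) x) ?_ ?_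
  · exact (integrableOn_W_smooth hΩb hg h0).add (integrable_finsetSum _ fun q _ => integrableOn_W_vx hΩb q)
  · filter_upwards [W_gvp_ae hΩ hg h0 S] with x hx using hx.symm

lemma Jp_main {Ω : Set R2} (hΩ : IsOpen Ω) (hΩb : Bornology.IsBounded Ω) {φ : R2 → ℝ} {C : ℝ≥0}
    (hφ : LipschitzWith C φ) (hc : HasCompactSupport φ) (hs : tsupport φ ⊆ Ω) {g : R2 → ℂ} (hg : ContDiff ℝ 2 g)
    (h0 : ∀ x ∈ closure Ω, g x ≠ 0) (S : Finset (R2 × Bool)) :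
    Jp Ω (W (fun y => g y * vp S y)) φ = Real.pi * ∑ q ∈ S, (if q.2 then 1 else -1) * φ q.1 := by
  rw [Jp_congr (W_gvp_ae hΩ hg h0 S), Jp_add (integrableOn_W_smooth hΩb hg h0)
    (integrable_finsetSum _ fun q _ => integrableOn_W_vx hΩb q) hφ, Jp_sum S (fun q _ => integrableOn_W_vx hΩb q) hφ,
    Jp_smooth hΩ hg.contDiffOn (fun x hx => h0 x (subset_closure hx)) hφ hc hs, zero_add, Finset.mul_sum]
  exact Finset.sum_congr rfl fun q _ => Jp_vx hΩ hΩb hφ hc hs q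

end Part13

section Part14

lemma exists_trunc {Ω : Set R2} (hΩb : Bornology.IsBounded Ω) {φ : R2 → ℝ} {C : ℝ≥0} (hφ : LipschitzWith C φ)
    (h1 : ∀ x, |φ x| ≤ 1) (h0 : ∀ x, x ∉ Ω → φ x = 0) {t : ℝ} (ht : 0 < t) :
    ∃ ψ : R2 → ℝ, LipschitzWith C ψ ∧ (∀ x, |ψ x| ≤ 1) ∧ HasCompactSupport ψ ∧ tsupport ψ ⊆ Ω ∧ ∀ x, |ψ x - φ x| ≤ t := by
  set s : ℝ → ℝ := fun y => y - max (-t) (min y t) with hs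
  have hs1 : ∀ x y, |s x - s y| ≤ |x - y| := by
    intro x y
    simp only [hs]
    rcases max_cases (-t) (min x t) with ⟨h1, h2⟩ | ⟨h1, h2⟩ <;> rcases max_cases (-t) (min y t) with ⟨h3, h4⟩ | ⟨h3, h4⟩ <;>
    rcases min_cases x t with ⟨h5, h6⟩ | ⟨h5, h6⟩ <;> rcases min_cases y t with ⟨h7, h8⟩ | ⟨h7, h8⟩ <;>
    rw [h1, h3] <;> simp only [h5, h7] at h2 h4 ⊢ <;> rcases abs_cases (x - y) with ⟨h9, h10⟩ | ⟨h9, h10⟩ <;> rw [h9, abs_le] <;> constructor <;> linarith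
  have hs0 : ∀ y, |y| < t → s y = 0 := by
    intro y hy
    rw [abs_lt] at hy
    simp only [hs]
    rw [min_eq_left hy.2.le, max_eq_right hy.1.le, sub_self]
  have h00 : s 0 = 0 := hs0 0 (by simpa using ht)
  have hsup : tsupport (fun x => s (φ x)) ⊆ {x | t ≤ |φ x|} := by
    refine closure_minimal ?_ (isClosed_le continuous_const hφ.continuous.abs)
    intro x hx
    by_contra h
    exact hx (hs0 _ (not_le.1 h))
  have hsub : {x | t ≤ |φ x|} ⊆ Ω := by
    intro x hx
    by_contra h
    have : t ≤ |φ x| := hx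
    rw [h0 x h, abs_zero] at this; linarith
  refine ⟨fun x => s (φ x), ?_, ?_, ?_, hsup.trans hsub, ?_⟩
  · refine LipschitzWith.of_dist_le_mul fun x y => ?_
    exact (hs1 _ _).trans (hφ.dist_le_mul x y)
  · intro x
    have := hs1 (φ x) 0
    rw [h00, sub_zero, sub_zero] at this
    exact this.trans (h1 x)
  · exact isCompact_of_isClosed_isBounded (isClosed_tsupport _) (hΩb.subset (hsup.trans hsub))
  · intro x
    simp only [hs, abs_le]
    constructor
    · have : max (-t) (min (φ x) t) ≤ t := max_le (by linarith) (min_le_right _ _)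
      linarith
    · have := le_max_left (-t) (min (φ x) t)
      linarith

lemma Good.vp_out {Ω : Set R2} (hΩ : IsOpen Ω) (hΩb : Bornology.IsBounded Ω) {g : R2 → ℂ} (hg : Good Ω g)
    (S : Finset (R2 × Bool)) (hS : ∀ q ∈ S, q.1 ∉ Ω) : Good Ω (fun y => g y * vp S y) := by
  unfold vp
  induction S using Finset.induction_on with
  | empty => simpa using hg
  | insert q S hq ih =>
    have h1 := ih fun q hq => hS q (by simp [hq])
    have h2 := Good.mul hΩ h1 (Good.vx hΩ hΩb (hS q (by simp)))
    convert h2 using 2 with y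
    rw [Finset.prod_insert hq]; ring

lemma Ok_gvp {Ω : Set R2} (hΩ : IsOpen Ω) (hΩb : Bornology.IsBounded Ω) {g : R2 → ℂ} (hg : ContDiff ℝ 2 g)
    (h0 : ∀ x ∈ closure Ω, g x ≠ 0) {S : Finset (R2 × Bool)} (hinj : ∀ q ∈ S, ∀ q' ∈ S, q.1 = q'.1 → q = q') :
    ∃ κ : ℝ, Ok Ω (nz fun y => g y * vp S y) (W fun y => g y * vp S y) (ENNReal.ofReal κ) ∧
      ∀ t > 0, ∃ φ : R2 → ℝ, LipschitzWith 2 φ ∧ (∀ x, |φ x| ≤ 1) ∧ (∀ x, x ∉ Ω → φ x = 0) ∧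
        κ ≤ Jp Ω (W fun y => g y * vp S y) φ + t := by
  set Si := S.filter (fun q => q.1 ∈ Ω) with hSi
  set So := S.filter (fun q => ¬ q.1 ∈ Ω) with hSo
  obtain ⟨κ, hκ, φ, f1, f2, f3, f4⟩ := Qk.vp_main hΩ hΩb (S := Si) (fun q hq => (Finset.mem_filter.1 hq).2)
    (fun q hq q' hq' => hinj q (Finset.mem_filter.1 hq).1 q' (Finset.mem_filter.1 hq').1)
  have hgo := (Good.of_smooth hΩ hΩb (hg.of_le (by norm_num)) h0).vp_out hΩ hΩb So (fun q hq => (Finset.mem_filter.1 hq).2)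
  have hok := hκ.ok _ hgo
  have e : (fun y => g y * vp So y * vp Si y) = fun y => g y * vp S y := by
    funext y
    unfold vp
    rw [mul_assoc, mul_comm (∏ q ∈ So, vx q y), hSi, hSo, Finset.prod_filter_mul_prod_filter_not]
  rw [e] at hok
  refine ⟨_, hok, fun t ht => ?_⟩
  have hpi := Real.pi_pos
  set t' := t / (Real.pi * (Si.card + 1)) with ht'
  have ht0 : 0 < t' := by positivity
  obtain ⟨ψ, p1, p2, p3, p4, p5⟩ := exists_trunc hΩb f1 f2 f3 ht0
  refine ⟨ψ, p1, p2, fun x hx => image_eq_zero_of_notMem_tsupport fun h => hx (p4 h), ?_⟩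
  rw [Jp_main hΩ hΩb p1 p3 p4 hg h0 S]
  have hsum : ∑ q ∈ S, (if q.2 then (1:ℝ) else -1) * ψ q.1 = ∑ q ∈ Si, (if q.2 then (1:ℝ) else -1) * ψ q.1 := by
    rw [hSi, Finset.sum_filter]
    refine Finset.sum_congr rfl fun q _ => ?_
    split_ifs with h1 h2 h3 <;> first | rfl | simp [image_eq_zero_of_notMem_tsupport (fun h => h2 (p4 h))] | simp [image_eq_zero_of_notMem_tsupport (fun h => h3 (p4 h))]
  have hle : ∑ q ∈ Si, (if q.2 then (1:ℝ) else -1) * φ q.1 ≤ ∑ q ∈ Si, (if q.2 then (1:ℝ) else -1) * ψ q.1 + Si.card * t' := by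
    rw [← nsmul_eq_mul, ← Finset.sum_const, ← Finset.sum_add_distrib]
    refine Finset.sum_le_sum fun q _ => ?_
    have := abs_le.1 (p5 q.1)
    split_ifs <;> linarith [this.1, this.2]
  have hfin : Real.pi * (Si.card * t') ≤ t := by
    have : Real.pi * ((Si.card + 1) * t') = t := by rw [ht']; field_simp
    nlinarith
  rw [hsum]
  have := mul_le_mul_of_nonneg_left (f4.trans hle) hpi.le
  linarith

end Part14

section Part15

lemma exists_small_ball (p : R2) (C : ℝ) {η : ℝ≥0∞} (hη : η ≠ 0) {ρ : ℝ} (hρ : 0 < ρ) :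
    ∃ r, 0 < r ∧ r < ρ ∧ ∫⁻ x in ball p r, (ENNReal.ofReal (C * ‖x - p‖⁻¹) + 2) ≤ η := by
  have hfin : ∫⁻ x in ball p 1, (ENNReal.ofReal (C * ‖x - p‖⁻¹) + 2) ≠ ⊤ := by
    rw [lintegral_add_right _ measurable_const]
    refine ENNReal.add_ne_top.2 ⟨?_, ?_⟩
    · exact ((integrableOn_inv_norm p isBounded_ball).const_mul C).lintegral_lt_top.ne
    · rw [setLIntegral_const]; exact ENNReal.mul_ne_top (by norm_num) measure_ball_lt_top.ne
  obtain ⟨δ, hδ, H⟩ := exists_pos_setLIntegral_lt_of_measure_lt hfin hη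
  have ht : Tendsto (fun r : ℝ => volume (ball p r)) (𝓝[>] 0) (𝓝 0) := by
    have : Tendsto (fun r : ℝ => ENNReal.ofReal (r ^ 2) * volume (ball (0 : R2) 1)) (𝓝[>] 0) (𝓝 0) := by
      have h1 : Tendsto (fun r : ℝ => ENNReal.ofReal (r ^ 2)) (𝓝[>] 0) (𝓝 0) := by
        have : Tendsto (fun r : ℝ => r ^ 2) (𝓝[>] 0) (𝓝 0) := by
          have := ((continuous_pow 2).tendsto (0:ℝ)).mono_left (nhdsWithin_le_nhds (s := Ioi 0))
          simpa using this
        simpa using ENNReal.tendsto_ofReal this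
      simpa using ENNReal.Tendsto.mul_const h1 (Or.inr (measure_ball_lt_top (μ := volume) (x := (0:R2)) (r := 1)).ne)
    refine this.congr' ?_
    filter_upwards [self_mem_nhdsWithin] with r hr
    rw [Measure.addHaar_ball_of_pos _ p hr]; simp
  have h1 : ∀ᶠ r : ℝ in 𝓝[>] 0, volume (ball p r) < δ := ht.eventually (gt_mem_nhds hδ)
  have h2 : ∀ᶠ r : ℝ in 𝓝[>] 0, r < min ρ 1 := nhdsWithin_le_nhds (gt_mem_nhds (lt_min hρ one_pos))
  obtain ⟨r, ⟨hr1, hr2⟩, hr3⟩ := ((h1.and h2).and self_mem_nhdsWithin).exists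
  refine ⟨r, hr3, hr2.trans_le (min_le_left _ _), ?_⟩
  have := H (ball p r) ((Measure.restrict_apply_le _ _).trans_lt hr1)
  rw [Measure.restrict_restrict measurableSet_ball, inter_eq_left.2 (ball_subset_ball (hr2.le.trans (min_le_right _ _)))] at this
  exact this.le

set_option maxHeartbeats 2000000 in
lemma single_zero {f : R2 → ℂ} (hf : ContDiff ℝ (⊤ : ℕ∞) f) {p : R2} (h0 : f p = 0) {a : ℂ} {b : Bool} {c : ℝ} (hc : 0 < c) (hca : c ≤ ‖a‖ ^ 2)
    (hL : ∀ x, c * ‖x - p‖ ^ 2 ≤ (fderiv ℝ f p (x - p) * starRingEnd ℂ (a * vx (p, b) x)).re)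
    {η : ℝ≥0∞} (hη : η ≠ 0) {r0 : ℝ} (hr0 : 0 < r0) :
    ∃ h : R2 → ℂ, ContDiff ℝ (⊤ : ℕ∞) h ∧ (∀ x, x ∉ ball p r0 → ∀ᶠ y in 𝓝 x, h y * vx (p, b) y = f y) ∧
      (∀ x, h x = 0 ↔ f x = 0 ∧ x ≠ p) ∧
      ∫⁻ x, ‖nz (fun y => h y * vx (p, b) y) x - nz f x‖ₑ ≤ η ∧ ∫⁻ x, ‖W (fun y => h y * vx (p, b) y) x - W f x‖ₑ ≤ η := by
  have ha : a ≠ 0 := by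
    rintro rfl
    have := hL (p + bv 0)
    simp [norm_bv] at this
    linarith
  set T : R2 → ℂ := fun x => a * vx (p, b) x with hT
  have hTs : ContDiff ℝ (⊤ : ℕ∞) T := contDiff_const.mul (contDiff_vx _)
  have hTn : ∀ x, ‖T x‖ = ‖a‖ * ‖x - p‖ := fun x => by simp only [hT]; rw [norm_mul, norm_vx]
  set L := fderiv ℝ f p with hLd
  have hfd : HasFDerivAt f L p := (hf.differentiable (by simp) p).hasFDerivAt
  set ε : ℝ := c / (2 * (‖a‖ + 1)) with hε
  have hε0 : 0 < ε := by positivity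
  have hεa : ε * ‖a‖ ≤ c / 2 := by
    rw [hε, div_mul_eq_mul_div, div_le_div_iff₀ (by positivity) (by norm_num)]; nlinarith [norm_nonneg a]
  set K := ‖L‖ + ‖fderiv ℝ T p‖ + 1 with hK
  have hK0 : 0 < K := by positivity
  have e1 : ∀ᶠ x in 𝓝 p, ‖f x - L (x - p)‖ ≤ ε * ‖x - p‖ := by
    have := hfd.isLittleO.def hε0
    simpa [h0] using this
  have e2 : ∀ᶠ x in 𝓝 p, ‖fderiv ℝ f x‖ < K :=
    ((hf.continuous_fderiv (by simp)).norm.continuousAt).eventually_lt continuousAt_const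
      (by have := norm_nonneg (fderiv ℝ T p); simp only [hK]; linarith)
  have e3 : ∀ᶠ x in 𝓝 p, ‖fderiv ℝ T x‖ < K :=
    ((hTs.continuous_fderiv (by simp)).norm.continuousAt).eventually_lt continuousAt_const
      (by have := norm_nonneg L; simp only [hK]; linarith)
  obtain ⟨ρ1, hρ1, hρ⟩ := Metric.eventually_nhds_iff_ball.1 (e1.and (e2.and e3))
  obtain ⟨ψ, s1, s2, s3, s4, s5⟩ := exists_cutoff (isCompact_singleton (x := (0:R2))) (isOpen_ball (x := (0:R2)) (ε := 1)) (by simp)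
  obtain ⟨C1, hC1⟩ := (s1.continuous_fderiv (by simp)).bounded_above_of_compact_support (s2.fderiv ℝ)
  have hC10 : 0 ≤ C1 := (norm_nonneg _).trans (hC1 0)
  set C2 := ‖a‖ + K + ε with hC2
  have hC20 : 0 < C2 := by positivity
  set m := c / (2 * (‖a‖ + 1)) with hm
  set C3 := 2 * ((3 * K + C1 * C2) / m) + 2 * (K / m) with hC3
  obtain ⟨r, hr, hrρ, hIntg⟩ := exists_small_ball p C3 hη (lt_min hρ1 hr0)
  have hrρ1 : r < ρ1 := hrρ.trans_le (min_le_left _ _)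
  have hrr0 : r < r0 := hrρ.trans_le (min_le_right _ _)
  set χ : R2 → ℝ := fun x => ψ (r⁻¹ • (x - p)) with hχ
  have hχs : ContDiff ℝ (⊤ : ℕ∞) χ := s1.comp (by fun_prop : ContDiff ℝ (⊤ : ℕ∞) (fun x : R2 => r⁻¹ • (x - p)))
  have hχd : ∀ x, ‖fderiv ℝ χ x‖ ≤ C1 * r⁻¹ := by
    intro x
    have k1 : HasFDerivAt (fun x : R2 => r⁻¹ • (x - p)) (r⁻¹ • ContinuousLinearMap.id ℝ R2) x :=
      ((((hasFDerivAt_id (𝕜 := ℝ) x).sub_const p).const_smul r⁻¹ :))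
    have k2 := ((s1.differentiable (by simp) (r⁻¹ • (x - p))).hasFDerivAt.comp x k1).fderiv
    have k3 : fderiv ℝ χ x = _ := k2
    rw [k3]
    refine (ContinuousLinearMap.opNorm_comp_le _ _).trans ?_
    refine mul_le_mul (hC1 _) ?_ (norm_nonneg _) hC10
    rw [norm_smul, Real.norm_of_nonneg (by positivity)]
    exact mul_le_of_le_one_right (by positivity) ContinuousLinearMap.norm_id_le
  have hχ0 : ∀ x, x ∉ ball p r → ∀ᶠ y in 𝓝 x, χ y = 0 := by
    intro x hx
    have : r⁻¹ • (x - p) ∉ tsupport ψ := by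
      intro h
      have := s3 h
      rw [mem_ball_zero_iff, norm_smul, Real.norm_of_nonneg (by positivity), inv_mul_lt_iff₀ hr, mul_one] at this
      exact hx (by rwa [mem_ball, dist_eq_norm])
    have h2 := notMem_tsupport_iff_eventuallyEq.1 this
    have h3 : ContinuousAt (fun y : R2 => r⁻¹ • (y - p)) x := by fun_prop
    exact h3.eventually h2
  have hχ1 : ∀ᶠ y in 𝓝 p, χ y = 1 := by
    have h3 : Tendsto (fun y : R2 => r⁻¹ • (y - p)) (𝓝 p) (𝓝 0) := by
      have : ContinuousAt (fun y : R2 => r⁻¹ • (y - p)) p := by fun_prop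
      simpa [ContinuousAt] using this
    exact h3.eventually (s4 0 rfl)
  set F : R2 → ℂ := fun x => f x + (χ x : ℂ) * (T x - f x) with hF
  have hFs : ContDiff ℝ (⊤ : ℕ∞) F :=
    hf.add ((Complex.ofRealCLM.contDiff.comp hχs).mul (hTs.sub hf))
  have hTp : T p = 0 := by rw [← norm_eq_zero, hTn]; simp
  have hFp : F p = 0 := by simp [hF, h0, hTp]
  have hFf : ∀ x, x ∉ ball p r → F =ᶠ[𝓝 x] f := by
    intro x hx
    filter_upwards [hχ0 x hx] with y hy
    simp [hF, hy]
  have hFT : F =ᶠ[𝓝 p] T := by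
    filter_upwards [hχ1] with y hy
    simp [hF, hy]
  -- lower bounds
  have hre : ∀ x ∈ ball p r, c / 2 * ‖x - p‖ ^ 2 ≤ (f x * starRingEnd ℂ (T x)).re := by
    intro x hx
    have hx1 := (hρ x (ball_subset_ball hrρ1.le hx)).1
    have h2 : (f x * starRingEnd ℂ (T x)).re = (L (x - p) * starRingEnd ℂ (T x)).re + ((f x - L (x - p)) * starRingEnd ℂ (T x)).re := by
      rw [← Complex.add_re]; congr 1; ring
    have h3 := (abs_le.1 (Complex.abs_re_le_norm ((f x - L (x - p)) * starRingEnd ℂ (T x)))).1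
    rw [norm_mul, RCLike.norm_conj, hTn] at h3
    have h4 : ‖f x - L (x - p)‖ * (‖a‖ * ‖x - p‖) ≤ (ε * ‖x - p‖) * (‖a‖ * ‖x - p‖) := by gcongr
    have h5 : (ε * ‖x - p‖) * (‖a‖ * ‖x - p‖) ≤ c / 2 * ‖x - p‖ ^ 2 := by
      have : (ε * ‖x - p‖) * (‖a‖ * ‖x - p‖) = ε * ‖a‖ * ‖x - p‖ ^ 2 := by ring
      rw [this]; gcongr
    have h6 := hL x
    rw [h2]
    simp only [hT] at h3 h6 ⊢
    linarith
  have hcT : ∀ x, c / 2 * ‖x - p‖ ^ 2 ≤ (‖T x‖ * ‖T x‖) := by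
    intro x
    rw [hTn]
    nlinarith [sq_nonneg (‖x - p‖), norm_nonneg a, mul_le_mul_of_nonneg_right hca (sq_nonneg ‖x - p‖)]
  have hlow : ∀ x ∈ ball p r, ∀ t ∈ Icc (0:ℝ) 1, m * ‖x - p‖ ≤ ‖f x + (t : ℂ) * (T x - f x)‖ := by
    intro x hx t ht
    rcases eq_or_lt_of_le (norm_nonneg (x - p)) with h | h
    · rw [← h]; simp
    have h1 : c / 2 * ‖x - p‖ ^ 2 ≤ ((f x + (t : ℂ) * (T x - f x)) * starRingEnd ℂ (T x)).re := by
      have e : ((f x + (t : ℂ) * (T x - f x)) * starRingEnd ℂ (T x)) = ((1 - t : ℝ) : ℂ) * (f x * starRingEnd ℂ (T x)) + (t : ℂ) * (T x * starRingEnd ℂ (T x)) := by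
        push_cast; ring
      rw [e, Complex.add_re, Complex.re_ofReal_mul, Complex.re_ofReal_mul, Complex.mul_conj, Complex.ofReal_re, Complex.normSq_eq_norm_sq, sq ‖T x‖]
      nlinarith [hre x hx, hcT x, ht.1, ht.2]
    have h2 := (Complex.re_le_norm ((f x + (t : ℂ) * (T x - f x)) * starRingEnd ℂ (T x)))
    rw [norm_mul, RCLike.norm_conj, hTn] at h2
    have h3 : ‖f x + (t : ℂ) * (T x - f x)‖ * (‖a‖ * ‖x - p‖) ≤ ‖f x + (t : ℂ) * (T x - f x)‖ * ((‖a‖ + 1) * ‖x - p‖) := by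
      gcongr; linarith
    have h4 : c / 2 * ‖x - p‖ ≤ ‖f x + (t : ℂ) * (T x - f x)‖ * (‖a‖ + 1) := by
      refine le_of_mul_le_mul_right ?_ h
      nlinarith
    rw [hm, div_mul_eq_mul_div, div_le_iff₀ (by positivity)]
    linarith
  have hm0 : 0 < m := by positivity
  have hFlow : ∀ x ∈ ball p r, m * ‖x - p‖ ≤ ‖F x‖ := fun x hx => hlow x hx (χ x) (s5 _)
  have hflow : ∀ x ∈ ball p r, m * ‖x - p‖ ≤ ‖f x‖ := fun x hx => by
    have := hlow x hx 0 (by simp)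
    simpa using this
  have hpr : p ∈ ball p r := mem_ball_self hr
  set h : R2 → ℂ := fun x => if x = p then a else F x / vx (p, b) x with hh
  have hvp : vx (p, b) p = 0 := by rw [← norm_eq_zero, norm_vx]; simp
  have hvn : ∀ x, x ≠ p → vx (p, b) x ≠ 0 := by
    intro x hx
    rw [← norm_ne_zero_iff, norm_vx]
    simpa [sub_eq_zero] using hx
  have hhF : (fun y => h y * vx (p, b) y) = F := by
    funext x
    by_cases hx : x = p
    · subst hx; rw [hvp, hFp, mul_zero]
    · simp only [hh, if_neg hx]
      exact div_mul_cancel₀ _ (hvn x hx)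
  have hhs : ContDiff ℝ (⊤ : ℕ∞) h := by
    rw [contDiff_iff_contDiffAt]
    intro x
    by_cases hx : x = p
    · subst hx
      refine (contDiffAt_const (c := a)).congr_of_eventuallyEq ?_
      filter_upwards [hFT] with y hy
      by_cases hy' : y = x
      · simp [hh, hy']
      · simp only [hh, if_neg hy', hy, hT]
        exact mul_div_cancel_right₀ _ (hvn y hy')
    · have : ContDiffAt ℝ (⊤ : ℕ∞) (fun y => F y * (vx (p, b) y)⁻¹) x :=
        hFs.contDiffAt.mul ((contDiff_vx _).contDiffAt.inv (hvn x hx))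
      refine this.congr_of_eventuallyEq ?_
      filter_upwards [isOpen_ne.mem_nhds hx] with y hy
      simp only [hh, if_neg hy, div_eq_mul_inv]
  have hdF : ∀ x ∈ ball p r, ‖fderiv ℝ F x‖ ≤ 3 * K + C1 * C2 := by
    intro x hx
    obtain ⟨q1, q2, q3⟩ := hρ x (ball_subset_ball hrρ1.le hx)
    have d1 : HasFDerivAt (fun y => (χ y : ℂ)) (Complex.ofRealCLM.comp (fderiv ℝ χ x)) x :=
      Complex.ofRealCLM.hasFDerivAt.comp x (hχs.differentiable (by simp) x).hasFDerivAt
    have df := (hf.differentiable (by simp) x).hasFDerivAt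
    have dT := (hTs.differentiable (by simp) x).hasFDerivAt
    have dF := (df.add (d1.mul (dT.sub df))).fderiv
    have dF' : fderiv ℝ F x = _ := dF
    rw [dF']
    have hTf : ‖T x - f x‖ ≤ C2 * ‖x - p‖ := by
      have z1 := norm_sub_le (T x) (f x)
      have z2 := norm_le_norm_add_norm_sub' (f x) (L (x - p))
      have z3 := L.le_opNorm (x - p)
      have z4 := norm_nonneg (fderiv ℝ T p)
      have z5 := norm_nonneg (x - p)
      rw [hTn] at z1
      have z6 : ‖L‖ * ‖x - p‖ ≤ K * ‖x - p‖ := by gcongr; simp only [hK]; linarith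
      simp only [hC2]
      nlinarith
    have hxr : ‖x - p‖ ≤ r := by rw [← dist_eq_norm]; exact (mem_ball.1 hx).le
    have t1 : ‖(χ x : ℂ) • (fderiv ℝ T x - fderiv ℝ f x)‖ ≤ 2 * K := by
      rw [norm_smul, Complex.norm_real, Real.norm_of_nonneg (s5 _).1]
      have := norm_sub_le (fderiv ℝ T x) (fderiv ℝ f x)
      have h1 := (s5 (r⁻¹ • (x - p))).2
      calc χ x * ‖fderiv ℝ T x - fderiv ℝ f x‖ ≤ 1 * ‖fderiv ℝ T x - fderiv ℝ f x‖ := by gcongr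
        _ ≤ _ := by linarith
    have t2 : ‖(T x - f x) • (Complex.ofRealCLM.comp (fderiv ℝ χ x))‖ ≤ C1 * C2 := by
      rw [norm_smul]
      have u1 : ‖Complex.ofRealCLM.comp (fderiv ℝ χ x)‖ ≤ C1 * r⁻¹ := by
        refine (ContinuousLinearMap.opNorm_comp_le _ _).trans ?_
        rw [Complex.ofRealCLM_norm, one_mul]; exact hχd x
      calc _ ≤ (C2 * r) * (C1 * r⁻¹) := by
            gcongr
            exact hTf.trans (by gcongr)
        _ = C1 * C2 := by field_simp
    have t3 := norm_add_le ((χ x : ℂ) • (fderiv ℝ T x - fderiv ℝ f x)) ((T x - f x) • (Complex.ofRealCLM.comp (fderiv ℝ χ x)))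
    have t4 := norm_add_le (fderiv ℝ f x) ((χ x : ℂ) • (fderiv ℝ T x - fderiv ℝ f x) + (T x - f x) • (Complex.ofRealCLM.comp (fderiv ℝ χ x)))
    refine le_trans (le_of_eq ?_) (t4.trans (by linarith : _ ≤ 3 * K + C1 * C2))
    rfl
  have hWb : ∀ x ∈ ball p r, x ≠ p → ‖W F x - W f x‖ ≤ C3 * ‖x - p‖⁻¹ := by
    intro x hx hxp
    have hxp' : 0 < ‖x - p‖ := norm_pos_iff.2 (sub_ne_zero.2 hxp)
    have b1 := norm_W_le F x
    have b2 := norm_W_le f x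
    obtain ⟨q1, q2, q3⟩ := hρ x (ball_subset_ball hrρ1.le hx)
    have b3 : ‖fderiv ℝ F x‖ / ‖F x‖ ≤ (3 * K + C1 * C2) / (m * ‖x - p‖) := by
      have := hFlow x hx
      have := hdF x hx
      gcongr
    have b4 : ‖fderiv ℝ f x‖ / ‖f x‖ ≤ K / (m * ‖x - p‖) := by
      have := hflow x hx
      gcongr
    have b5 := norm_sub_le (W F x) (W f x)
    have b6 : C3 * ‖x - p‖⁻¹ = 2 * ((3 * K + C1 * C2) / (m * ‖x - p‖)) + 2 * (K / (m * ‖x - p‖)) := by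
      simp only [hC3]; field_simp
    linarith
  have hIntg' : ∫⁻ x, (ball p r).indicator (fun x => (ENNReal.ofReal (C3 * ‖x - p‖⁻¹) + 2)) x ≤ η := by
    rw [lintegral_indicator measurableSet_ball]; exact hIntg
  have hzero : ∀ x, h x = 0 ↔ f x = 0 ∧ x ≠ p := by
    intro x
    by_cases hx : x = p
    · subst hx; simp [hh, ha]
    · have e : h x = 0 ↔ F x = 0 := by
        simp only [hh, if_neg hx, div_eq_zero_iff]
        simp [hvn x hx]
      rw [e]
      by_cases hxr : x ∈ ball p r
      · have hxp' : 0 < ‖x - p‖ := norm_pos_iff.2 (sub_ne_zero.2 hx)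
        have n1 : F x ≠ 0 := norm_pos_iff.1 (lt_of_lt_of_le (by positivity) (hFlow x hxr))
        have n2 : f x ≠ 0 := norm_pos_iff.1 (lt_of_lt_of_le (by positivity) (hflow x hxr))
        simp [n1, n2]
      · rw [(hFf x hxr).eq_of_nhds]; simp [hx]
  have hae : ∀ᵐ x : R2, x ≠ p := by
    have := ae_ne_of_finset {(p, true)} (volume : Measure R2)
    simpa using this
  refine ⟨h, hhs, ?_, hzero, ?_, ?_⟩
  · intro x hx
    have := hFf x (fun h => hx (ball_subset_ball hrr0.le h))
    filter_upwards [this] with y hy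
    rw [← hy, ← hhF]
  · rw [hhF]
    refine (lintegral_mono fun x => ?_).trans hIntg'
    by_cases hxr : x ∈ ball p r
    · rw [indicator_of_mem hxr]
      refine le_add_left ?_
      rw [← ofReal_norm]
      have := norm_sub_le (nz F x) (nz f x)
      have h1 := norm_nz_le F x
      have h2 := norm_nz_le f x
      calc _ ≤ ENNReal.ofReal 2 := ENNReal.ofReal_le_ofReal (by linarith)
        _ = 2 := by norm_num
    · rw [indicator_of_notMem hxr]
      simp [nz, (hFf x hxr).eq_of_nhds]
  · rw [hhF]
    refine (lintegral_mono_ae ?_).trans hIntg'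
    filter_upwards [hae] with x hxp
    by_cases hxr : x ∈ ball p r
    · rw [indicator_of_mem hxr]
      refine le_add_right ?_
      rw [← ofReal_norm]
      exact ENNReal.ofReal_le_ofReal (hWb x hxr hxp)
    · rw [indicator_of_notMem hxr, W_congr (hFf x hxr)]
      simp

end Part15

section Part16

lemma lin_split {L : R2 →L[ℝ] ℂ} (hL : Function.Injective L) (p : R2) :
    ∃ (a : ℂ) (b : Bool) (c : ℝ), 0 < c ∧ c ≤ ‖a‖ ^ 2 ∧
      ∀ x, c * ‖x - p‖ ^ 2 ≤ (L (x - p) * starRingEnd ℂ (a * vx (p, b) x)).re := by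
  set A : ℂ := (L (bv 0) - Complex.I * L (bv 1)) / 2 with hA
  set B : ℂ := (L (bv 0) + Complex.I * L (bv 1)) / 2 with hB
  have hLv : ∀ v : R2, L v = A * cx v + B * starRingEnd ℂ (cx v) := by
    intro v
    have e : v = v 0 • bv 0 + v 1 • bv 1 := by
      ext i; fin_cases i <;> simp [bv]
    have h1 : L v = (v 0 : ℂ) * L (bv 0) + (v 1 : ℂ) * L (bv 1) := by
      conv_lhs => rw [e]
      rw [map_add, map_smul, map_smul]; simp
    have h2 : cx v = (v 0 : ℂ) + (v 1 : ℂ) * Complex.I := by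
      apply Complex.ext <;> simp [cx_re, cx_im]
    rw [h1, h2, hA, hB]
    simp only [map_add, map_mul, Complex.conj_ofReal, Complex.conj_I]
    linear_combination ((v 1 : ℂ) * L (bv 1)) * Complex.I_mul_I
  have hne : ‖A‖ ≠ ‖B‖ := by
    intro h
    by_cases hA0 : A = 0
    · have hB0 : B = 0 := by rw [← norm_eq_zero, ← h, hA0, norm_zero]
      have : L (bv 0) = L 0 := by rw [hLv, hLv, hA0, hB0]; simp
      have := hL this
      have h1 := norm_bv 0
      rw [this] at h1; simp at h1
    · obtain ⟨z, hz⟩ := IsAlgClosed.exists_pow_nat_eq (-B / A) (n := 2) (by norm_num)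
      have hzn : ‖z‖ = 1 := by
        have : ‖z‖ ^ 2 = 1 := by
          rw [← norm_pow, hz, norm_div, norm_neg, ← h, div_self (norm_ne_zero_iff.2 hA0)]
        nlinarith [norm_nonneg z]
      have hzc : z * starRingEnd ℂ z = 1 := by
        rw [Complex.mul_conj, Complex.normSq_eq_norm_sq, hzn]; simp
      have hz0 : z ≠ 0 := by rintro rfl; simp at hzn
      have hB' : B = - (A * z ^ 2) := by rw [hz]; field_simp
      have : L (cx.symm z) = L 0 := by
        rw [hLv, map_zero, LinearIsometryEquiv.apply_symm_apply, hB']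
        linear_combination (-A * z) * hzc
      have := hL this
      have h2 : z = 0 := by rw [← cx.apply_symm_apply z, this, map_zero]
      exact hz0 h2
  have hvx : ∀ x b, ‖vx (p, b) x‖ = ‖x - p‖ := fun x b => norm_vx _ _
  have key : ∀ (P Q s : ℂ), (‖P‖ ^ 2 - ‖P‖ * ‖Q‖) * ‖s‖ ^ 2 ≤ ((P * s + Q * starRingEnd ℂ s) * starRingEnd ℂ (P * s)).re := by
    intro P Q s
    have e : ((P * s + Q * starRingEnd ℂ s) * starRingEnd ℂ (P * s)) = (P * s) * starRingEnd ℂ (P * s) + Q * starRingEnd ℂ s * starRingEnd ℂ (P * s) := by ring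
    rw [e, Complex.mul_conj, Complex.add_re, Complex.ofReal_re, Complex.normSq_eq_norm_sq, norm_mul]
    have := (abs_le.1 (Complex.abs_re_le_norm (Q * starRingEnd ℂ s * starRingEnd ℂ (P * s)))).1
    rw [norm_mul, norm_mul, RCLike.norm_conj, RCLike.norm_conj, norm_mul] at this
    nlinarith
  rcases lt_or_gt_of_ne hne with h | h
  · refine ⟨B, false, ‖B‖ ^ 2 - ‖B‖ * ‖A‖, ?_, ?_, ?_⟩
    · nlinarith [norm_nonneg A]
    · nlinarith [norm_nonneg A, norm_nonneg B, mul_nonneg (norm_nonneg A) (norm_nonneg B)]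
    · intro x
      have := key B A (vx (p, false) x)
      rw [hvx] at this
      rw [hLv]
      have e1 : starRingEnd ℂ (cx (x - p)) = vx (p, false) x := by simp [vx]
      have e2 : cx (x - p) = starRingEnd ℂ (vx (p, false) x) := by rw [← e1, Complex.conj_conj]
      rw [e2, Complex.conj_conj, add_comm]
      exact this
  · refine ⟨A, true, ‖A‖ ^ 2 - ‖A‖ * ‖B‖, ?_, ?_, ?_⟩
    · nlinarith [norm_nonneg B]
    · nlinarith [norm_nonneg A, norm_nonneg B, mul_nonneg (norm_nonneg A) (norm_nonneg B)]
    · intro x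
      have := key A B (vx (p, true) x)
      rw [hvx] at this
      rw [hLv]
      have e1 : (cx (x - p)) = vx (p, true) x := by simp [vx]
      rw [e1]
      exact this

lemma struct_zeros {Ω : Set R2} (hΩ : IsOpen Ω) (n : ℕ) : ∀ (Z : Finset R2), Z.card = n →
    ∀ f : R2 → ℂ, ContDiff ℝ (⊤ : ℕ∞) f → (∀ x ∈ closure Ω, f x = 0 ↔ x ∈ Z) → (∀ x ∈ Z, f x = 0) →
    (∀ p ∈ Z, Function.Injective (fderiv ℝ f p)) → ∀ η : ℝ≥0∞, η ≠ 0 →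
    ∃ (S : Finset (R2 × Bool)) (g : R2 → ℂ), ContDiff ℝ (⊤ : ℕ∞) g ∧ (∀ x ∈ closure Ω, g x ≠ 0) ∧
      (∀ q ∈ S, q.1 ∈ Z) ∧ (∀ q ∈ S, ∀ q' ∈ S, q.1 = q'.1 → q = q') ∧
      ∫⁻ x in Ω, ‖nz (fun y => g y * vp S y) x - nz f x‖ₑ ≤ η ∧
      ∫⁻ x in Ω, ‖W (fun y => g y * vp S y) x - W f x‖ₑ ≤ η := by
  induction n with
  | zero =>
    intro Z hZ f hf hz hz' hi η hη
    rw [Finset.card_eq_zero] at hZ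
    subst hZ
    have e : (fun y => f y * vp ∅ y) = f := by funext y; simp [vp]
    refine ⟨∅, f, hf, fun x hx h => by simpa using (hz x hx).1 h, by simp, by simp, ?_, ?_⟩ <;> rw [e] <;> simp
  | succ n ih =>
    intro Z hZ f hf hz hz' hi η hη
    obtain ⟨p, hp⟩ : Z.Nonempty := Finset.card_pos.1 (by omega)
    set Z' := Z.erase p with hZ'
    have hη2 : η / 2 ≠ 0 := (ENNReal.half_pos hη).ne'
    obtain ⟨r0, hr0, hr0'⟩ : ∃ r0 > 0, ball p r0 ⊆ ((Z' : Set R2))ᶜ := by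
      apply Metric.isOpen_iff.1 Z'.finite_toSet.isClosed.isOpen_compl
      simp [hZ']
    obtain ⟨a, b, c, hc, hca, hL⟩ := lin_split (hi p hp) p
    obtain ⟨h, hh, h1, h2, h3, h4⟩ := single_zero hf (hz' p hp) hc hca hL hη2 hr0
    have hZ'c : Z'.card = n := by rw [hZ', Finset.card_erase_of_mem hp]; omega
    have s1 : ∀ x ∈ closure Ω, h x = 0 ↔ x ∈ Z' := by
      intro x hx
      rw [h2, hz x hx, hZ', Finset.mem_erase, and_comm]
    have s2 : ∀ x ∈ Z', h x = 0 := by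
      intro x hx
      rw [hZ', Finset.mem_erase] at hx
      exact (h2 x).2 ⟨hz' x hx.2, hx.1⟩
    have s3 : ∀ p ∈ Z', Function.Injective (fderiv ℝ h p) := by
      intro q hq
      have hq' := hq
      rw [hZ', Finset.mem_erase] at hq'
      have hqb : q ∉ ball p r0 := fun hb => hr0' hb hq
      have hhq : h q = 0 := (h2 q).2 ⟨hz' q hq'.2, hq'.1⟩
      have e : fderiv ℝ f q = fderiv ℝ (fun y => h y * vx (p, b) y) q :=
        (Filter.EventuallyEq.fderiv_eq (h1 q hqb)).symm
      rw [fderiv_fun_mul (hh.differentiable (by simp) q) (differentiableAt_vx _ _), hhq] at e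
      intro v w hvw
      apply hi q hq'.2
      simp only [e, add_apply, smul_apply, hvw, zero_smul]
    obtain ⟨S', g, g1, g2, g3, g4, g5, g6⟩ := ih Z' hZ'c h hh s1 s2 s3 (η / 2) hη2
    have hpS : (p, b) ∉ S' := fun hm => by
      have := g3 _ hm
      simp [hZ'] at this
    have hvp : ∀ y, vp (insert (p, b) S') y = vx (p, b) y * vp S' y := fun y => by
      unfold vp; rw [Finset.prod_insert hpS]
    have hfun : (fun y => g y * vp (insert (p, b) S') y) = fun y => (g y * vp S' y) * vx (p, b) y := by
      funext y; rw [hvp]; ring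
    have hae := ae_ne_of_finset (insert (p, b) S') (volume.restrict Ω)
    have haeZ := ae_ne_of_finset (Z.image fun z => (z, true)) (volume.restrict Ω)
    have haeΩ := ae_restrict_mem hΩ.measurableSet (μ := volume)
    have hmF : Measurable (fun y => (g y * vp S' y) : R2 → ℂ) := ((g1.continuous).mul (contDiff_vp (n := 1) S').continuous).measurable
    have hmh : Measurable h := hh.continuous.measurable
    refine ⟨insert (p, b) S', g, g1, g2, ?_, ?_, ?_, ?_⟩
    · intro q hq
      rcases Finset.mem_insert.1 hq with rfl | hq
      · exact hp
      · exact Finset.mem_of_mem_erase (g3 q hq)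
    · intro q hq q' hq' he
      rcases Finset.mem_insert.1 hq with rfl | hq1 <;> rcases Finset.mem_insert.1 hq' with rfl | hq1'
      · rfl
      · exact absurd (g3 _ hq1') (by rw [← he]; simp [hZ'])
      · exact absurd (g3 _ hq1) (by rw [he]; simp [hZ'])
      · exact g4 _ hq1 _ hq1' he
    · rw [hfun]
      calc ∫⁻ x in Ω, ‖nz (fun y => (g y * vp S' y) * vx (p, b) y) x - nz f x‖ₑ
          ≤ ∫⁻ x in Ω, (‖nz (fun y => (g y * vp S' y)) x - nz h x‖ₑ + ‖nz (fun y => h y * vx (p, b) y) x - nz f x‖ₑ) := by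
            refine lintegral_mono fun x => ?_
            rw [nz_mul (fun y => g y * vp S' y) (vx (p, b)), nz_mul h (vx (p, b))]
            have e : nz (fun y => g y * vp S' y) x * nz (vx (p, b)) x - nz f x = (nz (fun y => g y * vp S' y) x - nz h x) * nz (vx (p, b)) x + (nz h x * nz (vx (p, b)) x - nz f x) := by ring
            rw [e]
            refine (enorm_add_le _ _).trans ?_
            gcongr
            rw [← ofReal_norm, ← ofReal_norm, norm_mul]
            exact ENNReal.ofReal_le_ofReal (mul_le_of_le_one_right (norm_nonneg _) (norm_nz_le _ _))
        _ = _ := lintegral_add_left ((measurable_nz hmF).sub (measurable_nz hmh)).enorm _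
        _ ≤ η / 2 + η / 2 := by
            exact add_le_add g5 ((setLIntegral_le_lintegral _ _).trans h3)
        _ = η := ENNReal.add_halves η
    · rw [hfun]
      calc ∫⁻ x in Ω, ‖W (fun y => (g y * vp S' y) * vx (p, b) y) x - W f x‖ₑ
          ≤ ∫⁻ x in Ω, (‖W (fun y => (g y * vp S' y)) x - W h x‖ₑ + ‖W (fun y => h y * vx (p, b) y) x - W f x‖ₑ) := by
            refine lintegral_mono_ae ?_
            filter_upwards [hae, haeZ, haeΩ] with x hx1 hx2 hx3
            have n1 : vx (p, b) x ≠ 0 := vx_ne (hx1 _ (Finset.mem_insert_self _ _))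
            have n2 : vp S' x ≠ 0 := Finset.prod_ne_zero_iff.2 fun q hq => vx_ne (hx1 _ (Finset.mem_insert_of_mem hq))
            have n3 : g x ≠ 0 := g2 x (subset_closure hx3)
            have n4 : h x ≠ 0 := by
              intro h0
              have := (hz x (subset_closure hx3)).1 ((h2 x).1 h0).1
              exact hx2 (x, true) (Finset.mem_image_of_mem _ this) rfl
            rw [W_mul (F := fun y => g y * vp S' y) (G := vx (p, b)) ?_ (differentiableAt_vx _ _) (mul_ne_zero n3 n2) n1,
              W_mul (F := h) (G := vx (p, b)) (hh.differentiable (by simp) x) (differentiableAt_vx _ _) n4 n1]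
            · have e : W (fun y => g y * vp S' y) x + W (vx (p, b)) x - W f x = (W (fun y => g y * vp S' y) x - W h x) + (W h x + W (vx (p, b)) x - W f x) := by ring
              rw [e]
              exact enorm_add_le _ _
            · exact (g1.differentiable (by simp) x).mul ((contDiff_vp (n := 1) S').differentiable (by simp) x)
        _ = _ := lintegral_add_left ((measurable_W hmF).sub (measurable_W hmh)).enorm _
        _ ≤ η / 2 + η / 2 := by
            exact add_le_add g6 ((setLIntegral_le_lintegral _ _).trans h4)
        _ = η := ENNReal.add_halves η

end Part16

section Part17

lemma finite_zeros {f : R2 → ℂ} (hf : ContDiff ℝ (⊤ : ℕ∞) f) {K : Set R2} (hK : IsCompact K)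
    (hi : ∀ x, f x = 0 → Function.Injective (fderiv ℝ f x)) : {x ∈ K | f x = 0}.Finite := by
  by_contra hinf
  have hc : IsCompact {x ∈ K | f x = 0} := hK.inter_right (isClosed_singleton.preimage hf.continuous)
  obtain ⟨x, hx, hacc⟩ := Set.Infinite.exists_accPt_of_subset_isCompact hinf hc subset_rfl
  rw [accPt_iff_frequently] at hacc
  obtain ⟨C, -, hC⟩ := (LinearMap.injective_iff_antilipschitz (fderiv ℝ f x : R2 →ₗ[ℝ] ℂ)).1 (hi x hx.2)
  have := (hf.differentiable (by simp) x).hasFDerivAt.eventually_ne (c := 0) ⟨C, hC⟩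
  rw [eventually_nhdsWithin_iff] at this
  obtain ⟨y, hy1, hy2⟩ := (hacc.and_eventually this).exists
  exact hy2 hy1.1 hy1.2.2

lemma sard_null {g : R2 → ℂ} (hg : ContDiff ℝ (⊤ : ℕ∞) g) :
    volume ((fun x => cx.symm (g x)) '' {x | ¬ Function.Injective (fderiv ℝ g x)}) = 0 := by
  set L : R2 → (R2 →L[ℝ] R2) := fun x => (cx.symm.toContinuousLinearEquiv : ℂ →L[ℝ] R2).comp (fderiv ℝ g x)
  refine MeasureTheory.addHaar_image_eq_zero_of_det_fderivWithin_eq_zero (f' := L) volume ?_ ?_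
  · intro x _
    exact ((cx.symm.toContinuousLinearEquiv : ℂ →L[ℝ] R2).hasFDerivAt.comp x
      (hg.differentiable (by simp) x).hasFDerivAt).hasFDerivWithinAt
  · intro x hx
    by_contra hdet
    apply hx
    have hu : IsUnit (LinearMap.det (L x : R2 →ₗ[ℝ] R2)) := isUnit_iff_ne_zero.2 hdet
    have hinj : Function.Injective (L x : R2 →ₗ[ℝ] R2) := by
      have := (LinearMap.equivOfDetNeZero _ hdet).injective
      exact this
    intro v w hvw
    apply hinj
    change cx.symm (fderiv ℝ g x v) = cx.symm (fderiv ℝ g x w)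
    rw [hvw]

lemma nz_bound {f : R2 → ℂ} {x : R2} {U : ℂ} (hU : ‖U‖ = 1) : ‖nz f x - U‖ ≤ 2 * ‖f x - U‖ := by
  by_cases h : f x = 0
  · simp [nz, h, hU]
  · have h1 : nz f x - U = (nz f x - f x) + (f x - U) := by ring
    have h2 : ‖nz f x - f x‖ ≤ ‖f x - U‖ := by
      have hn : (‖f x‖ : ℂ) ≠ 0 := by simpa using h
      have e : nz f x - f x = nz f x * ((1 - ‖f x‖ : ℝ) : ℂ) := by
        simp only [nz]; push_cast; field_simp
      rw [e, norm_mul, norm_nz h, one_mul, Complex.norm_real, Real.norm_eq_abs, ← hU]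
      rw [abs_sub_comm]
      exact abs_norm_sub_norm_le _ _
    rw [h1]
    exact (norm_add_le _ _).trans (by linarith)

lemma inv_bound {w U : ℂ} {e s : ℝ} (hU : ‖U‖ = 1) (hs : s ≤ 1 / 4) (hs0 : 0 ≤ s) (he : ‖w - U‖ ≤ e + s) (he0 : 0 ≤ e) :
    ‖w⁻¹ - U⁻¹‖ ≤ 2 * s + 4 * min e 1 * (1 + ‖w‖⁻¹) := by
  have hw0 : 0 ≤ ‖w‖⁻¹ := by positivity
  have hU0 : U ≠ 0 := by rintro rfl; simp at hU
  by_cases h : e ≤ 1 / 4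
  · have h1 : 1 / 2 ≤ ‖w‖ := by
      have := norm_sub_norm_le U w
      rw [norm_sub_rev] at this
      linarith
    have hw : w ≠ 0 := by rintro rfl; norm_num at h1
    have e1 : w⁻¹ - U⁻¹ = (U - w) * (w⁻¹ * U⁻¹) := by field_simp
    rw [e1, norm_mul, norm_mul, norm_inv, norm_inv, hU, inv_one, mul_one, norm_sub_rev, min_eq_left (by linarith)]
    have h2 : ‖w‖⁻¹ ≤ 2 := by
      rw [inv_le_comm₀ (by linarith) (by norm_num)]; linarith
    have h3 : ‖w - U‖ * ‖w‖⁻¹ ≤ (e + s) * 2 := by gcongr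
    nlinarith [mul_nonneg he0 hw0]
  · have hm : 1 / 4 ≤ min e 1 := le_min (by linarith) (by norm_num)
    have := norm_sub_le w⁻¹ U⁻¹
    rw [norm_inv, norm_inv, hU, inv_one] at this
    nlinarith

/-- phase gradient of `u` from complex partial derivatives -/
def om (U : R2 → ℂ) (D : Fin 2 → R2 → ℂ) (x : R2) : ℂ :=
  ⟨(starRingEnd ℂ (U x) * D 0 x).im, (starRingEnd ℂ (U x) * D 1 x).im⟩

lemma W_bound {f : R2 → ℂ} {x : R2} {U : R2 → ℂ} {D : Fin 2 → R2 → ℂ} {e s : ℝ} (hU : ‖U x‖ = 1) (hs : s ≤ 1 / 4) (hs0 : 0 ≤ s)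
    (he : ‖f x - U x‖ ≤ e + s) (he0 : 0 ≤ e) :
    ‖W f x - om U D x‖ ≤ ∑ j, (2 * s * ‖D j x‖ + (‖dj j f x - D j x‖ + 4 * (‖D j x‖ * min e 1)) * (1 + ‖f x‖⁻¹)) := by
  have hk : ∀ j, |(dj j f x / f x).im - (starRingEnd ℂ (U x) * D j x).im| ≤
      2 * s * ‖D j x‖ + (‖dj j f x - D j x‖ + 4 * (‖D j x‖ * min e 1)) * (1 + ‖f x‖⁻¹) := by
    intro j
    rw [← Complex.sub_im]
    refine (Complex.abs_im_le_norm _).trans ?_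
    have hc : starRingEnd ℂ (U x) = (U x)⁻¹ := by
      rw [Complex.inv_def, Complex.normSq_eq_norm_sq, hU]; simp
    have e1 : dj j f x / f x - starRingEnd ℂ (U x) * D j x = (dj j f x - D j x) * (f x)⁻¹ + D j x * ((f x)⁻¹ - (U x)⁻¹) := by
      rw [hc]; ring
    rw [e1]
    refine (norm_add_le _ _).trans ?_
    rw [norm_mul, norm_mul, norm_inv]
    have := inv_bound hU hs hs0 he he0
    have h1 : ‖D j x‖ * ‖(f x)⁻¹ - (U x)⁻¹‖ ≤ ‖D j x‖ * (2 * s + 4 * min e 1 * (1 + ‖f x‖⁻¹)) := by gcongr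
    nlinarith [norm_nonneg (dj j f x - D j x)]
  refine (Complex.norm_le_abs_re_add_abs_im _).trans ?_
  rw [Fin.sum_univ_two]
  have h0 := hk 0
  have h1 := hk 1
  simp only [W, om, Complex.sub_re, Complex.sub_im]
  linarith

end Part17

section Part18

lemma tail_min {μ : Measure R2} {D : R2 → ℂ} (hD : Integrable D μ) (hDm : Measurable D) {e : ℕ → R2 → ℝ≥0∞}
    (hem : ∀ k, Measurable (e k))
    (he : Tendsto (fun k => ∫⁻ x, e k x ∂μ) atTop (𝓝 0)) :
    Tendsto (fun k => ∫⁻ x, ‖D x‖ₑ * min (e k x) 1 ∂μ) atTop (𝓝 0) := by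
  rw [ENNReal.tendsto_nhds_zero]
  intro ε hε
  set δ : ℝ≥0∞ := min ε 1 / 2 with hδ
  have hδ0 : 0 < δ := ENNReal.half_pos (lt_min hε one_pos).ne'
  have hδt : δ ≠ ⊤ := (ENNReal.div_lt_top (ne_top_of_le_ne_top ENNReal.one_ne_top (min_le_right _ _)) (by norm_num)).ne
  have hδε : δ + δ ≤ ε := by rw [hδ, ENNReal.add_halves]; exact min_le_left _ _
  obtain ⟨M, hM0, hM⟩ := (memLp_one_iff_integrable.2 hD).integral_indicator_norm_ge_nonneg_le
    (ENNReal.toReal_pos hδ0.ne' hδt)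
  rw [ENNReal.ofReal_toReal hδt] at hM
  have h1 : Tendsto (fun k => ENNReal.ofReal M * ∫⁻ x, e k x ∂μ) atTop (𝓝 0) := by
    have := ENNReal.Tendsto.const_mul he (Or.inr (ENNReal.ofReal_ne_top (r := M)))
    simpa using this
  filter_upwards [ENNReal.tendsto_nhds_zero.1 h1 δ hδ0] with k hk
  calc ∫⁻ x, ‖D x‖ₑ * min (e k x) 1 ∂μ ≤ ∫⁻ x, (ENNReal.ofReal M * e k x + ‖{x | M ≤ (‖D x‖₊ : ℝ)}.indicator D x‖ₑ) ∂μ := by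
        refine lintegral_mono fun x => ?_
        by_cases hx : M ≤ (‖D x‖₊ : ℝ)
        · refine le_add_left ?_
          rw [indicator_of_mem (show x ∈ {x | M ≤ (‖D x‖₊ : ℝ)} from hx)]
          exact mul_le_of_le_one_right' (min_le_right _ _)
        · refine le_add_right ?_
          refine mul_le_mul' ?_ (min_le_left _ _)
          rw [← ofReal_norm]
          exact ENNReal.ofReal_le_ofReal (not_le.1 hx).le
    _ = ENNReal.ofReal M * ∫⁻ x, e k x ∂μ + ∫⁻ x, ‖{x | M ≤ (‖D x‖₊ : ℝ)}.indicator D x‖ₑ ∂μ := by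
        rw [lintegral_add_left ((hem k).const_mul _), lintegral_const_mul _ (hem k)]
    _ ≤ δ + δ := add_le_add hk hM
    _ ≤ ε := hδε

lemma choose_step {Ω : Set R2} {U : R2 → ℂ} {D : Fin 2 → R2 → ℂ} (hUm : Measurable U)
    (hDm : ∀ j, Measurable (D j)) (hU1 : ∀ᵐ x ∂volume.restrict Ω, ‖U x‖ = 1)
    {s : ℝ} (hs0 : 0 < s) (hs : s ≤ 1 / 4) : ∃ C : ℝ≥0∞, C ≠ ⊤ ∧ ∀ g : R2 → ℂ, ContDiff ℝ (⊤ : ℕ∞) g →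
    ∃ f : R2 → ℂ, ContDiff ℝ (⊤ : ℕ∞) f ∧ (∀ x, f x = 0 → Function.Injective (fderiv ℝ f x)) ∧
      ∫⁻ x in Ω, (‖nz f x - U x‖ₑ + ‖W f x - om U D x‖ₑ) ≤
        (∫⁻ x in Ω, (2 * (‖g x - U x‖ₑ + ENNReal.ofReal s) + ∑ j, ENNReal.ofReal (2 * s) * ‖D j x‖ₑ)) +
        C * ∫⁻ x in Ω, ∑ j, (‖dj j g x - D j x‖ₑ + 4 * (‖D j x‖ₑ * min ‖g x - U x‖ₑ 1)) := by
  obtain ⟨K, hK, hK'⟩ := exists_inv_bound s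
  set vB := volume (ball (0 : R2) s) with hvB
  have hvB0 : vB ≠ 0 := (measure_ball_pos _ _ hs0).ne'
  have hvBt : vB ≠ ⊤ := measure_ball_lt_top.ne
  refine ⟨vB⁻¹ * (vB + K), ENNReal.mul_ne_top (ENNReal.inv_ne_top.2 hvB0) (ENNReal.add_ne_top.2 ⟨hvBt, hK.ne⟩), ?_⟩
  intro g hg
  set P : R2 → ℝ≥0∞ := fun x => 2 * (‖g x - U x‖ₑ + ENNReal.ofReal s) + ∑ j, ENNReal.ofReal (2 * s) * ‖D j x‖ₑ with hP
  set Q : R2 → ℝ≥0∞ := fun x => ∑ j, (‖dj j g x - D j x‖ₑ + 4 * (‖D j x‖ₑ * min ‖g x - U x‖ₑ 1)) with hQ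
  have hgm : Measurable g := hg.continuous.measurable
  have hdm : ∀ j, Measurable (dj j g) := fun j => measurable_fderiv_apply_const ℝ g (bv j)
  have hPm : Measurable P := by
    simp only [hP]
    exact (((hgm.sub hUm).enorm.add_const _).const_mul _).add (Finset.measurable_sum _ fun j _ => (hDm j).enorm.const_mul _)
  have hQm : Measurable Q := by
    simp only [hQ]
    exact (Finset.measurable_sum _ fun j _ => ((hdm j).sub (hDm j)).enorm.add (((hDm j).enorm.mul ((hgm.sub hUm).enorm.min measurable_const)).const_mul _))
  set k : R2 → R2 → ℝ≥0∞ := fun y x => P x + Q x * (1 + ENNReal.ofReal ‖cx.symm (g x) - y‖⁻¹) with hk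
  have hkm : Measurable (Function.uncurry k) := by
    have h1 : Measurable fun z : R2 × R2 => cx.symm (g z.2) - z.1 :=
      (cx.symm.continuous.measurable.comp (hgm.comp measurable_snd)).sub measurable_fst
    exact (hPm.comp measurable_snd).add ((hQm.comp measurable_snd).mul (measurable_const.add h1.norm.inv.ennreal_ofReal))
  have hsw : ∫⁻ y in ball (0 : R2) s, ∫⁻ x in Ω, k y x ≤ vB * ((∫⁻ x in Ω, P x) + (vB⁻¹ * (vB + K)) * ∫⁻ x in Ω, Q x) := by
    rw [lintegral_lintegral_swap hkm.aemeasurable]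
    calc ∫⁻ x in Ω, ∫⁻ y in ball (0 : R2) s, k y x ≤ ∫⁻ x in Ω, (vB * P x + (vB + K) * Q x) := by
          refine lintegral_mono fun x => ?_
          have hm : Measurable fun y : R2 => ENNReal.ofReal ‖cx.symm (g x) - y‖⁻¹ :=
            (measurable_const.sub measurable_id).norm.inv.ennreal_ofReal
          change ∫⁻ y in ball (0 : R2) s, P x + Q x * (1 + ENNReal.ofReal ‖cx.symm (g x) - y‖⁻¹) ≤ _
          generalize P x = P0
          generalize Q x = Q0
          rw [lintegral_add_left measurable_const, lintegral_const_mul _ (hm.const_add 1),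
            lintegral_add_left measurable_const, setLIntegral_const, setLIntegral_const, one_mul, ← hvB, mul_comm P0, mul_comm Q0]
          have := hK' (cx.symm (g x))
          gcongr
      _ = vB * (∫⁻ x in Ω, P x) + (vB + K) * ∫⁻ x in Ω, Q x := by
          rw [lintegral_add_left (hPm.const_mul _), lintegral_const_mul _ hPm, lintegral_const_mul _ hQm]
      _ = _ := by
          rw [mul_add, ← mul_assoc, ← mul_assoc, ENNReal.mul_inv_cancel hvB0 hvBt, one_mul]
  have hIm : Measurable fun y => ∫⁻ x in Ω, k y x := hkm.lintegral_prod_right'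
  set N := ((fun x => cx.symm (g x)) '' {x | ¬ Function.Injective (fderiv ℝ g x)}) ∪ (ball (0 : R2) s)ᶜ with hN
  have hN0 : (volume.restrict (ball (0 : R2) s)) N = 0 := by
    rw [hN, measure_union_null_iff]
    refine ⟨le_antisymm ((Measure.restrict_apply_le _ _).trans (sard_null hg).le) zero_le, ?_⟩
    rw [Measure.restrict_apply measurableSet_ball.compl]; simp
  have hfm : IsFiniteMeasure (volume.restrict (ball (0 : R2) s)) := ⟨by rw [Measure.restrict_apply_univ]; exact measure_ball_lt_top⟩
  have hne : volume.restrict (ball (0 : R2) s) ≠ 0 := by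
    rw [Ne, Measure.restrict_eq_zero]; exact hvB0
  obtain ⟨y, hyN, hy⟩ := exists_notMem_null_le_laverage hne hIm.aemeasurable hN0
  rw [hN, mem_union, not_or, notMem_compl_iff] at hyN
  obtain ⟨hy1, hy2⟩ := hyN
  have hy2' : ‖y‖ < s := by simpa using hy2
  have hfd : ∀ x, fderiv ℝ (fun x => g x - cx y) x = fderiv ℝ g x := fun x => by
    rw [fderiv_sub_const]
  refine ⟨fun x => g x - cx y, hg.sub contDiff_const, ?_, ?_⟩
  · intro x hx
    rw [hfd]
    by_contra hni
    exact hy1 ⟨x, hni, by simp only; rw [sub_eq_zero.1 hx]; simp⟩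
  · have hle : ∫⁻ x in Ω, k y x ≤ (∫⁻ x in Ω, P x) + (vB⁻¹ * (vB + K)) * ∫⁻ x in Ω, Q x := by
      rw [laverage_eq, Measure.restrict_apply_univ, ← hvB] at hy
      refine hy.trans ?_
      rw [ENNReal.div_le_iff hvB0 hvBt, mul_comm]
      exact hsw
    refine (lintegral_mono_ae ?_).trans hle
    filter_upwards [hU1] with x hx
    have he : ‖(g x - cx y) - U x‖ ≤ ‖g x - U x‖ + s := by
      have : (g x - cx y) - U x = (g x - U x) - cx y := by ring
      rw [this]
      refine (norm_sub_le _ _).trans ?_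
      rw [LinearIsometryEquiv.norm_map]; linarith
    have b1 := (nz_bound (f := fun x => g x - cx y) (x := x) hx).trans (mul_le_mul_of_nonneg_left he zero_le_two)
    have b2 := W_bound (f := fun x => g x - cx y) (x := x) (D := D) hx hs hs0.le he (norm_nonneg _)
    have hdj : ∀ j, dj j (fun x => g x - cx y) x = dj j g x := fun j => by simp only [dj, hfd]
    have hnn : ‖cx.symm (g x) - y‖ = ‖g x - cx y‖ := by
      rw [← cx.norm_map (cx.symm (g x) - y), map_sub, LinearIsometryEquiv.apply_symm_apply]
    have hb : ‖nz (fun x => g x - cx y) x - U x‖ + ‖W (fun x => g x - cx y) x - om U D x‖ ≤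
      (2 * (‖g x - U x‖ + s) + ∑ j, (2 * s * ‖D j x‖)) + (∑ j, (‖dj j g x - D j x‖ + 4 * (‖D j x‖ * min ‖g x - U x‖ 1))) * (1 + ‖g x - cx y‖⁻¹) := by
      simp only [hdj] at b2
      rw [Finset.sum_add_distrib, ← Finset.sum_mul] at b2
      linarith
    have hc := ENNReal.ofReal_le_ofReal hb
    rw [ENNReal.ofReal_add (norm_nonneg _) (norm_nonneg _), ofReal_norm, ofReal_norm] at hc
    refine hc.trans (le_of_eq ?_)
    simp only [hk, hP, hQ, hnn]
    have m0 : ∀ j, 0 ≤ 4 * (‖D j x‖ * min ‖g x - U x‖ 1) := fun j => by positivity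
    rw [ENNReal.ofReal_add (by positivity) (by positivity), ENNReal.ofReal_mul (by positivity), ENNReal.ofReal_add (by positivity) (by positivity),
      ENNReal.ofReal_add zero_le_one (by positivity), ENNReal.ofReal_one, ENNReal.ofReal_mul zero_le_two, ENNReal.ofReal_add (by positivity) (by positivity),
      ENNReal.ofReal_sum_of_nonneg (fun j _ => by positivity), ENNReal.ofReal_sum_of_nonneg (fun j _ => by positivity), ofReal_norm]
    congr 1
    · congr 1
      · norm_num
      · refine Finset.sum_congr rfl fun j _ => ?_
        rw [ENNReal.ofReal_mul (by positivity), ofReal_norm]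
    · congr 1
      refine Finset.sum_congr rfl fun j _ => ?_
      rw [ENNReal.ofReal_add (norm_nonneg _) (m0 j), ENNReal.ofReal_mul (by norm_num), ENNReal.ofReal_mul (norm_nonneg _), ENNReal.ofReal_min, ofReal_norm, ofReal_norm, ofReal_norm]
      norm_num

lemma choose_y {Ω : Set R2} (hΩb : Bornology.IsBounded Ω) {U : R2 → ℂ} {D : Fin 2 → R2 → ℂ} (hUm : Measurable U)
    (hDm : ∀ j, Measurable (D j)) (hU1 : ∀ᵐ x ∂volume.restrict Ω, ‖U x‖ = 1) (hD : ∀ j, IntegrableOn (D j) Ω)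
    (HD : ∀ η : ℝ≥0∞, η ≠ 0 → ∃ g : R2 → ℂ, ContDiff ℝ (⊤ : ℕ∞) g ∧ ∫⁻ x in Ω, ‖g x - U x‖ₑ ≤ η ∧
      ∀ j, ∫⁻ x in Ω, ‖dj j g x - D j x‖ₑ ≤ η) {η : ℝ≥0∞} (hη : η ≠ 0) :
    ∃ f : R2 → ℂ, ContDiff ℝ (⊤ : ℕ∞) f ∧ (∀ x, f x = 0 → Function.Injective (fderiv ℝ f x)) ∧
      ∫⁻ x in Ω, ‖nz f x - U x‖ₑ ≤ η ∧ ∫⁻ x in Ω, ‖W f x - om U D x‖ₑ ≤ η := by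
  set V := volume Ω with hV
  have hVt : V ≠ ⊤ := hΩb.measure_lt_top.ne
  set N0 := ∑ j, ∫⁻ x in Ω, ‖D j x‖ₑ with hN0
  have hN0t : N0 ≠ ⊤ := ENNReal.sum_ne_top.2 fun j _ => (hD j).2.ne
  obtain ⟨n, hn0, hn⟩ := ENNReal.exists_nnreal_pos_mul_lt (ENNReal.add_ne_top.2 ⟨hVt, hN0t⟩) (ENNReal.half_pos hη).ne'
  set s : ℝ := min (n / 2) (1 / 4) with hs
  have hs0 : 0 < s := lt_min (by positivity) (by norm_num)
  have hsn : ENNReal.ofReal (2 * s) ≤ n := by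
    rw [← ENNReal.ofReal_coe_nnreal]
    refine ENNReal.ofReal_le_ofReal ?_
    have := min_le_left ((n : ℝ) / 2) (1 / 4)
    linarith
  obtain ⟨C, hC, HC⟩ := choose_step (Ω := Ω) hUm hDm hU1 hs0 (min_le_right _ _)
  have HD' := fun k : ℕ => HD ((k : ℝ≥0∞) + 1)⁻¹ (by simp)
  choose g hg1 hg2 hg3 using HD'
  have hlim : Tendsto (fun k : ℕ => ((k : ℝ≥0∞) + 1)⁻¹) atTop (𝓝 0) := by
    have := (ENNReal.tendsto_inv_nat_nhds_zero).comp (tendsto_add_atTop_nat 1)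
    refine this.congr fun k => ?_
    simp
  have l1 : Tendsto (fun k => ∫⁻ x in Ω, ‖g k x - U x‖ₑ) atTop (𝓝 0) :=
    tendsto_of_tendsto_of_tendsto_of_le_of_le tendsto_const_nhds hlim (fun _ => zero_le) hg2
  have l2 : ∀ j, Tendsto (fun k => ∫⁻ x in Ω, ‖dj j (g k) x - D j x‖ₑ) atTop (𝓝 0) := fun j =>
    tendsto_of_tendsto_of_tendsto_of_le_of_le tendsto_const_nhds hlim (fun _ => zero_le) (fun k => hg3 k j)
  have hgm : ∀ k, Measurable (g k) := fun k => (hg1 k).continuous.measurable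
  have hdm : ∀ k j, Measurable (dj j (g k)) := fun k j => measurable_fderiv_apply_const ℝ (g k) (bv j)
  have l3 : ∀ j, Tendsto (fun k => ∫⁻ x in Ω, ‖D j x‖ₑ * min ‖g k x - U x‖ₑ 1) atTop (𝓝 0) := fun j =>
    tail_min (hD j) (hDm j) (fun k => ((hgm k).sub hUm).enorm) l1
  have l4 : Tendsto (fun k => ∫⁻ x in Ω, ∑ j, (‖dj j (g k) x - D j x‖ₑ + 4 * (‖D j x‖ₑ * min ‖g k x - U x‖ₑ 1))) atTop (𝓝 0) := by
    have e : ∀ k, ∫⁻ x in Ω, ∑ j, (‖dj j (g k) x - D j x‖ₑ + 4 * (‖D j x‖ₑ * min ‖g k x - U x‖ₑ 1)) =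
        ∑ j, ((∫⁻ x in Ω, ‖dj j (g k) x - D j x‖ₑ) + 4 * ∫⁻ x in Ω, ‖D j x‖ₑ * min ‖g k x - U x‖ₑ 1) := by
      intro k
      have m1 : ∀ j, Measurable fun x => ‖D j x‖ₑ * min ‖g k x - U x‖ₑ 1 := fun j =>
        (hDm j).enorm.mul (((hgm k).sub hUm).enorm.min measurable_const)
      have m2 : ∀ j, Measurable fun x => ‖dj j (g k) x - D j x‖ₑ := fun j => ((hdm k j).sub (hDm j)).enorm
      have m3 : ∀ j, Measurable fun x => ‖dj j (g k) x - D j x‖ₑ + 4 * (‖D j x‖ₑ * min ‖g k x - U x‖ₑ 1) := fun j =>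
        (m2 j).add ((m1 j).const_mul _)
      rw [lintegral_finsetSum _ (fun j _ => m3 j)]
      refine Finset.sum_congr rfl fun j _ => ?_
      rw [lintegral_add_left (m2 j), lintegral_const_mul _ (m1 j)]
    simp_rw [e]
    have : Tendsto (fun k => ∑ j : Fin 2, ((∫⁻ x in Ω, ‖dj j (g k) x - D j x‖ₑ) + 4 * ∫⁻ x in Ω, ‖D j x‖ₑ * min ‖g k x - U x‖ₑ 1)) atTop
        (𝓝 (∑ j : Fin 2, (0 + 4 * 0))) :=
      tendsto_finsetSum _ fun j _ => (l2 j).add (ENNReal.Tendsto.const_mul (l3 j) (Or.inr (by norm_num)))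
    simpa using this
  have l5 : Tendsto (fun k => 2 * (∫⁻ x in Ω, ‖g k x - U x‖ₑ) + C * ∫⁻ x in Ω, ∑ j, (‖dj j (g k) x - D j x‖ₑ + 4 * (‖D j x‖ₑ * min ‖g k x - U x‖ₑ 1))) atTop (𝓝 0) := by
    have := (ENNReal.Tendsto.const_mul l1 (Or.inr (by norm_num : (2:ℝ≥0∞) ≠ ⊤))).add (ENNReal.Tendsto.const_mul l4 (Or.inr hC))
    simpa using this
  obtain ⟨k, hk⟩ := (ENNReal.tendsto_nhds_zero.1 l5 (η / 2) (ENNReal.half_pos hη)).exists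
  obtain ⟨f, f1, f2, f3⟩ := HC (g k) (hg1 k)
  have hP : ∫⁻ x in Ω, (2 * (‖g k x - U x‖ₑ + ENNReal.ofReal s) + ∑ j, ENNReal.ofReal (2 * s) * ‖D j x‖ₑ)
      = 2 * (∫⁻ x in Ω, ‖g k x - U x‖ₑ) + ENNReal.ofReal (2 * s) * (V + N0) := by
    have m1 : Measurable fun x => ‖g k x - U x‖ₑ := ((hgm k).sub hUm).enorm
    rw [lintegral_add_left ((m1.add_const _).const_mul _), lintegral_const_mul _ (m1.add_const _), lintegral_add_left m1,
      lintegral_finsetSum _ (fun j _ => (hDm j).enorm.const_mul _), setLIntegral_const]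
    have : ∀ j, ∫⁻ x in Ω, ENNReal.ofReal (2 * s) * ‖D j x‖ₑ = ENNReal.ofReal (2 * s) * ∫⁻ x in Ω, ‖D j x‖ₑ := fun j =>
      lintegral_const_mul _ (hDm j).enorm
    simp_rw [this]
    rw [← Finset.mul_sum, ← hN0, ← hV, ENNReal.ofReal_mul zero_le_two, ENNReal.ofReal_ofNat]
    ring
  have hfin : ∫⁻ x in Ω, (‖nz f x - U x‖ₑ + ‖W f x - om U D x‖ₑ) ≤ η := by
    refine f3.trans ?_
    rw [hP, add_right_comm]
    calc _ ≤ η / 2 + η / 2 := add_le_add hk ((mul_le_mul_left hsn _).trans hn.le)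
      _ = η := ENNReal.add_halves η
  refine ⟨f, f1, f2, le_trans (lintegral_mono fun x => le_self_add) hfin, le_trans (lintegral_mono fun x => le_add_self) hfin⟩

end Part18

section Part19

lemma trans_cont {F : R2 → ℂ} (hF : Integrable F) (hFm : Measurable F) {ε : ℝ≥0∞} (hε : ε ≠ 0) :
    ∃ δ > 0, ∀ t : R2, ‖t‖ < δ → ∫⁻ x, ‖F (x - t) - F x‖ₑ ≤ ε := by
  have hε3 : ε / 3 ≠ 0 := (ENNReal.div_pos hε (by norm_num)).ne'
  obtain ⟨h, hc, hle, hcont, -⟩ := hF.exists_hasCompactSupport_lintegral_sub_le hε3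
  set K := cthickening 1 (tsupport h) with hK
  have hKc : IsCompact K := hc.isCompact.cthickening
  obtain ⟨κ, hκ, hκV⟩ := ENNReal.exists_nnreal_pos_mul_lt (hKc.measure_lt_top (μ := volume)).ne hε3
  have huc := hc.uniformContinuous_of_continuous hcont
  obtain ⟨δ, hδ, H⟩ := Metric.uniformContinuous_iff.1 huc κ hκ
  refine ⟨min δ 1, lt_min hδ one_pos, fun t ht => ?_⟩
  have hm : Measurable h := hcont.measurable
  have hms : Measurable fun x : R2 => x - t := measurable_id.sub_const t
  have a1 : ∫⁻ x, ‖F (x - t) - h (x - t)‖ₑ ≤ ε / 3 := by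
    rw [lintegral_sub_right_eq_self (fun x => ‖F x - h x‖ₑ) t]; exact hle
  have a2 : ∫⁻ x, ‖h (x - t) - h x‖ₑ ≤ ε / 3 := by
    refine le_trans ?_ hκV.le
    rw [← setLIntegral_const, ← lintegral_indicator hKc.isClosed.measurableSet]
    refine lintegral_mono fun x => ?_
    by_cases hx : x ∈ K
    · rw [indicator_of_mem hx]
      have : dist (x - t) x < δ := by
        rw [dist_eq_norm]; simpa using ht.trans_le (min_le_left _ _)
      have := H this
      rw [dist_eq_norm] at this
      rw [← ofReal_norm, ← ENNReal.ofReal_coe_nnreal]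
      exact ENNReal.ofReal_le_ofReal this.le
    · rw [indicator_of_notMem hx]
      have e1 : h x = 0 := by
        by_contra h0
        exact hx (self_subset_cthickening _ (subset_tsupport _ h0))
      have e2 : h (x - t) = 0 := by
        by_contra h0
        refine hx (mem_cthickening_of_dist_le x (x - t) 1 _ (subset_tsupport _ h0) ?_)
        rw [dist_eq_norm]; simpa using (ht.trans_le (min_le_right _ _)).le
      simp [e1, e2]
  have a3 : ∫⁻ x, ‖h x - F x‖ₑ ≤ ε / 3 := by
    refine le_trans (le_of_eq (lintegral_congr fun x => ?_)) hle
    rw [← enorm_neg, neg_sub]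
  calc ∫⁻ x, ‖F (x - t) - F x‖ₑ ≤ ∫⁻ x, (‖F (x - t) - h (x - t)‖ₑ + (‖h (x - t) - h x‖ₑ + ‖h x - F x‖ₑ)) := by
        refine lintegral_mono fun x => ?_
        have e : F (x - t) - F x = (F (x - t) - h (x - t)) + ((h (x - t) - h x) + (h x - F x)) := by ring
        rw [e]
        exact (enorm_add_le _ _).trans (by gcongr; exact enorm_add_le _ _)
    _ = (∫⁻ x, ‖F (x - t) - h (x - t)‖ₑ) + ((∫⁻ x, ‖h (x - t) - h x‖ₑ) + ∫⁻ x, ‖h x - F x‖ₑ) := by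
        rw [lintegral_add_left, lintegral_add_left]
        · exact ((hm.comp hms).sub hm).enorm
        · exact ((hFm.comp hms).sub (hm.comp hms)).enorm
    _ ≤ ε / 3 + (ε / 3 + ε / 3) := add_le_add a1 (add_le_add a2 a3)
    _ = ε := by rw [← add_assoc]; exact ENNReal.add_thirds ε

/-- mollification -/
def mol (k : R2 → ℝ) (F : R2 → ℂ) : R2 → ℂ := convolution k F (ContinuousLinearMap.lsmul ℝ ℝ) volume

lemma mol_apply (k : R2 → ℝ) (F : R2 → ℂ) (x : R2) : mol k F x = ∫ t, k t • F (x - t) := rfl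

lemma mol_apply' (k : R2 → ℝ) (F : R2 → ℂ) (x : R2) : mol k F x = ∫ t, k (x - t) • F t :=
  convolution_eq_swap _

lemma mol_close {F : R2 → ℂ} (hF : Integrable F) (hFm : Measurable F) {ε : ℝ≥0∞} {δ : ℝ}
    (hδ : ∀ t : R2, ‖t‖ < δ → ∫⁻ x, ‖F (x - t) - F x‖ₑ ≤ ε) {k : R2 → ℝ} (hk : Continuous k) (hks : HasCompactSupport k)
    (hk0 : ∀ t, 0 ≤ k t) (hk1 : ∫ t, k t = 1) (hkδ : ∀ t, δ ≤ ‖t‖ → k t = 0) :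
    ∫⁻ x, ‖mol k F x - F x‖ₑ ≤ ε := by
  have hki : Integrable k := hk.integrable_of_hasCompactSupport hks
  have hl1 : ∫⁻ t, ENNReal.ofReal (k t) = 1 := by
    rw [← ofReal_integral_eq_lintegral_ofReal hki (Filter.Eventually.of_forall hk0), hk1]; simp
  have hce : ConvolutionExists k F (ContinuousLinearMap.lsmul ℝ ℝ) volume :=
    hks.convolutionExists_left _ hk hF.locallyIntegrable
  have e : ∀ x, ‖mol k F x - F x‖ₑ ≤ ∫⁻ t, ENNReal.ofReal (k t) * ‖F (x - t) - F x‖ₑ := by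
    intro x
    have i1 : Integrable fun t => k t • F (x - t) := hce x
    have : mol k F x - F x = ∫ t, k t • (F (x - t) - F x) := by
      simp_rw [smul_sub]
      rw [integral_sub i1 (hki.smul_const _), integral_smul_const, hk1, one_smul, mol_apply]
    rw [this]
    refine (enorm_integral_le_lintegral_enorm _).trans (le_of_eq (lintegral_congr fun t => ?_))
    rw [enorm_smul, Real.enorm_of_nonneg (hk0 t)]
  have hm : Measurable (Function.uncurry fun (x t : R2) => ENNReal.ofReal (k t) * ‖F (x - t) - F x‖ₑ) := by
    have h1 : Measurable fun z : R2 × R2 => z.1 - z.2 := measurable_fst.sub measurable_snd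
    exact ((hk.measurable.comp measurable_snd).ennreal_ofReal).mul ((hFm.comp h1).sub (hFm.comp measurable_fst)).enorm
  calc ∫⁻ x, ‖mol k F x - F x‖ₑ ≤ ∫⁻ x, ∫⁻ t, ENNReal.ofReal (k t) * ‖F (x - t) - F x‖ₑ := lintegral_mono e
    _ = ∫⁻ t, ∫⁻ x, ENNReal.ofReal (k t) * ‖F (x - t) - F x‖ₑ := lintegral_lintegral_swap hm.aemeasurable
    _ ≤ ∫⁻ t, ENNReal.ofReal (k t) * ε := by
        refine lintegral_mono fun t => ?_
        have hmt : Measurable fun x => ‖F (x - t) - F x‖ₑ := ((hFm.comp (measurable_id.sub_const t)).sub hFm).enorm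
        rw [lintegral_const_mul _ hmt]
        by_cases ht : ‖t‖ < δ
        · have := hδ t ht
          gcongr
        · rw [hkδ t (not_lt.1 ht)]; simp
    _ = ε := by
        rw [lintegral_mul_const _ hk.measurable.ennreal_ofReal, hl1, one_mul]

/-- local geometry -/
def Loc (Ω O : Set R2) (n : R2) (c τ0 : ℝ) : Prop :=
  ∀ x ∈ Ω ∩ O, ∀ τ, 0 < τ → τ < τ0 → closedBall (x + τ • n) (c * τ) ⊆ Ω

lemma exists_Loc {Ω : Set R2} (hΩ : IsOpen Ω) (hl : HasLipschitzBoundary Ω) {p : R2} (hp : p ∈ closure Ω) :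
    ∃ (O : Set R2) (n : R2) (c τ0 : ℝ), IsOpen O ∧ p ∈ O ∧ 0 < c ∧ 0 < τ0 ∧ Loc Ω O n c τ0 := by
  by_cases hpΩ : p ∈ Ω
  · obtain ⟨r, hr, hr'⟩ := Metric.isOpen_iff.1 hΩ p hpΩ
    refine ⟨ball p (r / 2), 0, 1, r / 2, isOpen_ball, mem_ball_self (by positivity), one_pos, by positivity, ?_⟩
    intro x hx τ h0 h1 y hy
    apply hr'
    rw [smul_zero, add_zero, one_mul, mem_closedBall] at hy
    have h2 := mem_ball.1 hx.2
    have := dist_triangle y x p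
    rw [mem_ball]; linarith
  · have hpf : p ∈ frontier Ω := ⟨hp, by rwa [hΩ.interior_eq]⟩
    obtain ⟨r, hr, f, γ, L, hγ, H⟩ := hl p hpf
    set A := f.toRealAffineIsometryEquiv.linearIsometryEquiv with hA
    have hf : ∀ x v : R2, f (x + v) = f x + A v := by
      intro x v
      have := f.toRealAffineIsometryEquiv.map_vadd x v
      simp only [vadd_eq_add] at this
      rw [add_comm x v, add_comm (f x)]
      exact this
    have hcoord : ∀ (v : R2) i, |v i| ≤ ‖v‖ := fun v i => by
      have := PiLp.norm_apply_le v i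
      simpa using this
    refine ⟨ball p (r / 2), A.symm (bv 1), 1 / (1 + L), r / 4, isOpen_ball, mem_ball_self (by positivity), by positivity, by positivity, ?_⟩
    set c : ℝ := 1 / (1 + L) with hc
    have hc1 : c ≤ 1 := by
      rw [hc, div_le_one (by positivity)]; have := L.coe_nonneg; linarith
    have hc0 : 0 < c := by positivity
    have hcL : c * (1 + L) = 1 := by rw [hc]; field_simp
    intro x hx τ h0 h1 y hy
    have hxp : dist x p < r / 2 := hx.2
    have hxr : x ∈ ball p r := by rw [mem_ball]; linarith
    have hx1 := (H x hxr).1 hx.1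
    set w := y - (x + τ • A.symm (bv 1)) with hw
    have hwn : ‖w‖ ≤ c * τ := by rw [hw, ← dist_eq_norm]; exact hy
    have hyx : y = x + (τ • A.symm (bv 1) + w) := by rw [hw]; abel
    have hyr : y ∈ ball p r := by
      have d1 : dist y x ≤ τ + c * τ := by
        rw [dist_eq_norm, hyx, add_sub_cancel_left]
        refine (norm_add_le _ _).trans ?_
        rw [norm_smul, Real.norm_of_nonneg h0.le, LinearIsometryEquiv.norm_map, norm_bv, mul_one]
        linarith
      have := dist_triangle y x p
      rw [mem_ball]; nlinarith
    rw [H y hyr]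
    have hfy : f y = f x + (τ • bv 1 + A w) := by
      rw [hyx, hf, map_add, map_smul, LinearIsometryEquiv.apply_symm_apply]
    have y0 : f y 0 = f x 0 + A w 0 := by rw [hfy]; simp [bv]
    have y1 : f y 1 = f x 1 + τ + A w 1 := by rw [hfy]; simp [bv]; ring
    have b0 := hcoord (A w) 0
    have b1 := hcoord (A w) 1
    rw [LinearIsometryEquiv.norm_map] at b0 b1
    have g1 : γ (f y 0) - γ (f x 0) ≤ L * (c * τ) := by
      have := hγ.dist_le_mul (f y 0) (f x 0)
      rw [Real.dist_eq, Real.dist_eq, y0, add_sub_cancel_left] at this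
      rw [y0]
      refine (le_abs_self _).trans (this.trans ?_)
      gcongr
      exact b0.trans hwn
    have b2 := (abs_le.1 (b1.trans hwn)).1
    rw [y1]
    have : L * (c * τ) + c * τ = τ := by
      have : L * (c * τ) + c * τ = (c * (1 + L)) * τ := by ring
      rw [this, hcL, one_mul]
    linarith

end Part19

section Part20

lemma dj_mol {k : R2 → ℝ} (hk : ContDiff ℝ (⊤ : ℕ∞) k) (hks : HasCompactSupport k) {F : R2 → ℂ}
    (hF : Integrable F) (j : Fin 2) (x : R2) :
    dj j (mol k F) x = ∫ t, (fderiv ℝ k (x - t) (bv j)) • F t := by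
  have hd : HasFDerivAt (mol k F) _ x :=
    hks.hasFDerivAt_convolution_left (ContinuousLinearMap.lsmul ℝ ℝ) (hk.of_le (by simp)) hF.locallyIntegrable x
  have hce : ConvolutionExistsAt (fderiv ℝ k) F x (ContinuousLinearMap.precompL R2 (ContinuousLinearMap.lsmul ℝ ℝ)) volume :=
    (hks.fderiv ℝ).convolutionExists_left _ (hk.continuous_fderiv (by simp)) hF.locallyIntegrable x
  rw [dj, hd.fderiv, convolution]
  rw [ContinuousLinearMap.integral_apply hce]
  rw [← integral_sub_left_eq_self _ volume x]
  refine integral_congr_ae (Filter.Eventually.of_forall fun t => ?_)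
  simp only [ContinuousLinearMap.precompL_apply, sub_sub_cancel, ContinuousLinearMap.lsmul_apply]

lemma dj_mol_loc {Ω : Set R2} (hΩ : IsOpen Ω) {U : R2 → ℂ} {D : Fin 2 → R2 → ℂ}
    (hU : IntegrableOn U Ω)
    (hw : ∀ φ : R2 → ℝ, ContDiff ℝ (⊤ : ℕ∞) φ → HasCompactSupport φ → tsupport φ ⊆ Ω → ∀ j,
      ∫ x in Ω, (fderiv ℝ φ x (bv j)) • U x = - ∫ x in Ω, φ x • D j x)
    {k : R2 → ℝ} (hk : ContDiff ℝ (⊤ : ℕ∞) k) {q : R2} {r : ℝ} (hks : tsupport k ⊆ closedBall q r)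
    {x : R2} (hx : closedBall (x - q) r ⊆ Ω) (j : Fin 2) :
    dj j (mol k (Ω.indicator U)) x = mol k (Ω.indicator (D j)) x := by
  have hkc : HasCompactSupport k :=
    HasCompactSupport.of_support_subset_isCompact (isCompact_closedBall q r) ((subset_tsupport k).trans hks)
  rw [dj_mol hk hkc ((integrable_indicator_iff hΩ.measurableSet).2 hU), mol_apply']
  have e : ∀ (a : R2 → ℝ) (F : R2 → ℂ), ∫ t, a t • Ω.indicator F t = ∫ t in Ω, a t • F t := by
    intro a F
    rw [← integral_indicator hΩ.measurableSet]
    refine integral_congr_ae (Filter.Eventually.of_forall fun t => ?_)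
    by_cases ht : t ∈ Ω <;> simp [ht]
  rw [e, e]
  set φ : R2 → ℝ := fun y => k (x - y) with hφ
  have hs : ContDiff ℝ (⊤ : ℕ∞) φ := hk.comp (contDiff_const.sub contDiff_id)
  have hsup : Function.support φ ⊆ closedBall (x - q) r := by
    intro y hy
    have : x - y ∈ closedBall q r := hks (subset_tsupport _ hy)
    rw [mem_closedBall, dist_eq_norm] at this ⊢
    have e1 : y - (x - q) = -((x - y) - q) := by abel
    rw [e1, norm_neg]
    exact this
  have hts : tsupport φ ⊆ closedBall (x - q) r := closure_minimal hsup isClosed_closedBall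
  have := hw φ hs (HasCompactSupport.of_support_subset_isCompact (isCompact_closedBall _ _) hsup) (hts.trans hx) j
  have hfd : ∀ t, fderiv ℝ φ t (bv j) = - fderiv ℝ k (x - t) (bv j) := by
    intro t
    have h1 : HasFDerivAt k (fderiv ℝ k (x - t)) (x - t) := (hk.differentiable (by simp) (x - t)).hasFDerivAt
    have h2 : HasFDerivAt (fun y : R2 => x - y) (-ContinuousLinearMap.id ℝ R2) t := (hasFDerivAt_id (𝕜 := ℝ) t).const_sub x
    have h3 : HasFDerivAt φ _ t := h1.comp t h2
    rw [h3.fderiv]; simp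
  simp_rw [hfd, neg_smul] at this
  rw [integral_neg, neg_inj] at this
  exact this

lemma loc_approx {Ω : Set R2} (hΩ : IsOpen Ω) {U : R2 → ℂ} {D : Fin 2 → R2 → ℂ}
    (hUm : Measurable U) (hDm : ∀ j, Measurable (D j))
    (hU : IntegrableOn U Ω) (hD : ∀ j, IntegrableOn (D j) Ω)
    (hw : ∀ φ : R2 → ℝ, ContDiff ℝ (⊤ : ℕ∞) φ → HasCompactSupport φ → tsupport φ ⊆ Ω → ∀ j,
      ∫ x in Ω, (fderiv ℝ φ x (bv j)) • U x = - ∫ x in Ω, φ x • D j x)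
    {O : Set R2} (hO : IsOpen O) {n : R2} {c τ0 : ℝ} (hc : 0 < c) (hτ0 : 0 < τ0) (hL : Loc Ω O n c τ0)
    {ε : ℝ≥0∞} (hε : ε ≠ 0) :
    ∃ g : R2 → ℂ, ContDiff ℝ (⊤ : ℕ∞) g ∧ ∫⁻ x in Ω, ‖g x - U x‖ₑ ≤ ε ∧
      ∀ j, ∫⁻ x in Ω ∩ O, ‖dj j g x - D j x‖ₑ ≤ ε := by
  have hm := hΩ.measurableSet
  have iU : Integrable (Ω.indicator U) := (integrable_indicator_iff hm).2 hU
  have iD : ∀ j, Integrable (Ω.indicator (D j)) := fun j => (integrable_indicator_iff hm).2 (hD j)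
  have mU : Measurable (Ω.indicator U) := hUm.indicator hm
  have mD : ∀ j, Measurable (Ω.indicator (D j)) := fun j => (hDm j).indicator hm
  obtain ⟨δ, hδ, Hδ⟩ := trans_cont iU mU hε
  obtain ⟨δ0, hδ0, Hδ0⟩ := trans_cont (iD 0) (mD 0) hε
  obtain ⟨δ1, hδ1, Hδ1⟩ := trans_cont (iD 1) (mD 1) hε
  set d := min δ (min δ0 δ1) with hd
  have hd0 : 0 < d := lt_min hδ (lt_min hδ0 hδ1)
  obtain ⟨τ, hτ, hτ1, hτ2⟩ : ∃ τ : ℝ, 0 < τ ∧ τ < τ0 ∧ (‖n‖ + c) * τ < d := by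
    have hnc : 0 < ‖n‖ + c := by positivity
    refine ⟨min (τ0 / 2) (d / (2 * (‖n‖ + c))), by positivity, ?_, ?_⟩
    · exact (min_le_left _ _).trans_lt (by linarith)
    · have : (‖n‖ + c) * min (τ0 / 2) (d / (2 * (‖n‖ + c))) ≤ (‖n‖ + c) * (d / (2 * (‖n‖ + c))) := by
        gcongr; exact min_le_right _ _
      have e : (‖n‖ + c) * (d / (2 * (‖n‖ + c))) = d / 2 := by field_simp
      linarith
  let b : ContDiffBump (-(τ • n)) := ⟨c * τ / 2, c * τ, by positivity, by have := mul_pos hc hτ; linarith⟩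
  set k : R2 → ℝ := b.normed volume with hk
  have kc : ContDiff ℝ (⊤ : ℕ∞) k := b.contDiff_normed
  have ks : tsupport k ⊆ closedBall (-(τ • n)) (c * τ) := (b.tsupport_normed_eq).subset
  have khs : HasCompactSupport k := b.hasCompactSupport_normed
  have k0 : ∀ t, 0 ≤ k t := fun t => b.nonneg_normed t
  have k1 : ∫ t, k t = 1 := b.integral_normed
  have kd : ∀ t, d ≤ ‖t‖ → k t = 0 := by
    intro t ht
    by_contra h0
    have := ks (subset_tsupport _ h0)
    rw [mem_closedBall, dist_eq_norm, sub_neg_eq_add] at this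
    have h2 : ‖t‖ ≤ ‖t + τ • n‖ + ‖τ • n‖ := by
      have := norm_sub_le (t + τ • n) (τ • n)
      rwa [add_sub_cancel_right] at this
    rw [norm_smul, Real.norm_of_nonneg hτ.le] at h2
    linarith
  have r1 : ∀ (F : R2 → ℂ) (g : R2 → ℂ), ∫⁻ x in Ω, ‖g x - F x‖ₑ ≤ ∫⁻ x, ‖g x - Ω.indicator F x‖ₑ := by
    intro F g
    refine le_trans (le_of_eq ?_) (setLIntegral_le_lintegral Ω _)
    refine setLIntegral_congr_fun hm fun x hx => ?_
    simp only [indicator_of_mem hx]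
  refine ⟨mol k (Ω.indicator U), khs.contDiff_convolution_left _ kc iU.locallyIntegrable, ?_, ?_⟩
  · refine (r1 U _).trans (mol_close iU mU (fun t ht => Hδ t ?_) kc.continuous khs k0 k1 kd)
    exact ht.trans_le (min_le_left _ _)
  · intro j
    have e : ∫⁻ x in Ω ∩ O, ‖dj j (mol k (Ω.indicator U)) x - D j x‖ₑ = ∫⁻ x in Ω ∩ O, ‖mol k (Ω.indicator (D j)) x - D j x‖ₑ := by
      refine setLIntegral_congr_fun (hm.inter hO.measurableSet) fun x hx => ?_
      rw [dj_mol_loc hΩ hU hw kc ks (x := x) ?_ j]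
      rw [sub_neg_eq_add]
      exact hL x hx τ hτ hτ1
    rw [e]
    refine (lintegral_mono_set inter_subset_left).trans ((r1 (D j) _).trans (mol_close (iD j) (mD j) (fun t ht => ?_) kc.continuous khs k0 k1 kd))
    fin_cases j
    · exact Hδ0 t (ht.trans_le ((min_le_right _ _).trans (min_le_left _ _)))
    · exact Hδ1 t (ht.trans_le ((min_le_right _ _).trans (min_le_right _ _)))

end Part20

section Part21

open scoped Manifold in
lemma exists_partition {Ω : Set R2} (hb : Bornology.IsBounded Ω) {ι : Type} [Fintype ι] (O : ι → Set R2) (hO : ∀ i, IsOpen (O i))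
    (hcov : closure Ω ⊆ ⋃ i, O i) :
    ∃ χ : ι → R2 → ℝ, (∀ i, ContDiff ℝ (⊤ : ℕ∞) (χ i)) ∧ (∀ i x, x ∉ O i → χ i x = 0) ∧
      (∀ i x, χ i x ∈ Icc (0 : ℝ) 1) ∧ ∀ x ∈ closure Ω, ∑ i, χ i x = 1 := by
  obtain ⟨f, hf⟩ := SmoothPartitionOfUnity.exists_isSubordinate 𝓘(ℝ, R2) (isClosed_closure (s := Ω)) O hO hcov
  refine ⟨fun i x => f i x, fun i => (f i).contMDiff.contDiff, fun i x hx => ?_, fun i x => ⟨f.nonneg i x, f.le_one i x⟩, fun x hx => ?_⟩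
  · by_contra h0
    exact hx (hf i (subset_tsupport _ h0))
  · rw [← finsum_eq_sum_of_fintype]
    exact f.sum_eq_one hx

lemma density {Ω : Set R2} (hΩ : IsOpen Ω) (hb : Bornology.IsBounded Ω) (hl : HasLipschitzBoundary Ω)
    {U : R2 → ℂ} {D : Fin 2 → R2 → ℂ}
    (hUm : Measurable U) (hDm : ∀ j, Measurable (D j))
    (hU : IntegrableOn U Ω) (hD : ∀ j, IntegrableOn (D j) Ω)
    (hw : ∀ φ : R2 → ℝ, ContDiff ℝ (⊤ : ℕ∞) φ → HasCompactSupport φ → tsupport φ ⊆ Ω → ∀ j,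
      ∫ x in Ω, (fderiv ℝ φ x (bv j)) • U x = - ∫ x in Ω, φ x • D j x)
    (η : ℝ≥0∞) (hη : η ≠ 0) :
    ∃ g : R2 → ℂ, ContDiff ℝ (⊤ : ℕ∞) g ∧ ∫⁻ x in Ω, ‖g x - U x‖ₑ ≤ η ∧
      ∀ j, ∫⁻ x in Ω, ‖dj j g x - D j x‖ₑ ≤ η := by
  have hm := hΩ.measurableSet
  have hK : IsCompact (closure Ω) := hb.isCompact_closure
  have HL := fun p (hp : p ∈ closure Ω) => exists_Loc hΩ hl hp
  choose! O n c τ0 hO hpO hc hτ hL using HL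
  obtain ⟨T, hT, hTc⟩ := hK.elim_nhds_subcover O fun p hp => (hO p hp).mem_nhds (hpO p hp)
  obtain ⟨χ, χs, χO, χ1, χsum⟩ := exists_partition hb (ι := T) (fun i => O i) (fun i => hO i (hT i i.2))
    (by intro x hx; have := hTc hx; simp only [mem_iUnion] at this ⊢; obtain ⟨i, hi, hxi⟩ := this; exact ⟨⟨i, hi⟩, hxi⟩)
  have hC : ∀ i : T, ∃ C : ℝ, ∀ x ∈ closure Ω, ‖fderiv ℝ (χ i) x‖ ≤ C := fun i =>
    hK.exists_bound_of_continuousOn ((χs i).continuous_fderiv (by simp)).continuousOn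
  choose C hC using hC
  set B : ℝ := ∑ i, |C i| with hB
  have hB0 : 0 ≤ B := Finset.sum_nonneg fun i _ => abs_nonneg _
  have hBb : ∀ i : T, ∀ x ∈ closure Ω, ‖fderiv ℝ (χ i) x‖ ≤ B := fun i x hx =>
    (hC i x hx).trans ((le_abs_self _).trans (Finset.single_le_sum (f := fun i : T => |C i|) (fun i _ => abs_nonneg _) (Finset.mem_univ i)))
  have hfin : (Fintype.card T : ℝ≥0∞) * (ENNReal.ofReal B + 1) ≠ ⊤ :=
    ENNReal.mul_ne_top (by simp) (by simp)
  obtain ⟨ε, hε, hεη⟩ := ENNReal.exists_nnreal_pos_mul_lt hfin hη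
  have hε' : (ε : ℝ≥0∞) ≠ 0 := by simpa using hε.ne'
  have HG := fun i : T => loc_approx hΩ hUm hDm hU hD hw (hO i (hT i i.2)) (hc i (hT i i.2)) (hτ i (hT i i.2)) (hL i (hT i i.2)) hε'
  choose g gs gU gD using HG
  have hsum : ∀ a : T → ℝ≥0∞, (∀ i, a i ≤ (ENNReal.ofReal B + 1) * ε) → ∑ i, a i ≤ η := by
    intro a ha
    calc ∑ i, a i ≤ ∑ i : T, (ENNReal.ofReal B + 1) * (ε : ℝ≥0∞) := Finset.sum_le_sum fun i _ => ha i
      _ = ε * ((Fintype.card T : ℝ≥0∞) * (ENNReal.ofReal B + 1)) := by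
          rw [Finset.sum_const, Finset.card_univ, nsmul_eq_mul]; ring
      _ ≤ η := hεη.le
  have mg : ∀ i, Measurable (g i) := fun i => (gs i).continuous.measurable
  have mdg : ∀ i j, Measurable (dj j (g i)) := fun i j =>
    (((gs i).continuous_fderiv (by simp)).clm_apply continuous_const).measurable
  have m1 : ∀ i, Measurable fun x => ‖g i x - U x‖ₑ := fun i => ((mg i).sub hUm).enorm
  have m2 : ∀ i j, Measurable fun x => ‖dj j (g i) x - D j x‖ₑ := fun i j => ((mdg i j).sub (hDm j)).enorm
  have χe : ∀ i x, ‖χ i x‖ₑ ≤ 1 := fun i x => by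
    rw [← ofReal_norm, Real.norm_of_nonneg (χ1 i x).1]
    exact ENNReal.ofReal_le_one.2 (χ1 i x).2
  have hone : ∀ x ∈ Ω, ∑ i, χ i x = 1 := fun x hx => χsum x (subset_closure hx)
  refine ⟨fun x => ∑ i, χ i x • g i x, ContDiff.sum fun i _ => (χs i).smul (gs i), ?_, fun j => ?_⟩
  · calc ∫⁻ x in Ω, ‖(∑ i, χ i x • g i x) - U x‖ₑ ≤ ∫⁻ x in Ω, ∑ i, ‖g i x - U x‖ₑ := by
          refine setLIntegral_mono' hm fun x hx => ?_
          have e : (∑ i, χ i x • g i x) - U x = ∑ i, χ i x • (g i x - U x) := by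
            simp_rw [smul_sub]
            rw [Finset.sum_sub_distrib, ← Finset.sum_smul, hone x hx, one_smul]
          rw [e]
          refine (enorm_sum_le _ _).trans (Finset.sum_le_sum fun i _ => ?_)
          rw [enorm_smul]
          exact mul_le_of_le_one_left' (χe i x)
      _ = ∑ i, ∫⁻ x in Ω, ‖g i x - U x‖ₑ := lintegral_finsetSum _ fun i _ => m1 i
      _ ≤ η := by
          refine hsum _ fun i => (gU i).trans ?_
          exact le_mul_of_one_le_left' le_add_self
  · calc ∫⁻ x in Ω, ‖dj j (fun x => ∑ i, χ i x • g i x) x - D j x‖ₑ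
        ≤ ∫⁻ x in Ω, ∑ i, (ENNReal.ofReal B * ‖g i x - U x‖ₑ + (O i).indicator (fun x => ‖dj j (g i) x - D j x‖ₑ) x) := by
          refine setLIntegral_mono' hm fun x hx => ?_
          have hd : HasFDerivAt (fun x => ∑ i, χ i x • g i x) (∑ i, (χ i x • fderiv ℝ (g i) x + (fderiv ℝ (χ i) x).smulRight (g i x))) x :=
            HasFDerivAt.fun_sum fun i _ => (((χs i).differentiable (by simp) x).hasFDerivAt).smul (((gs i).differentiable (by simp) x).hasFDerivAt)
          have h0 : ∑ i, fderiv ℝ (χ i) x (bv j) = 0 := by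
            have h1 : HasFDerivAt (fun x => ∑ i, χ i x) (∑ i, fderiv ℝ (χ i) x) x :=
              HasFDerivAt.fun_sum fun i _ => (((χs i).differentiable (by simp) x).hasFDerivAt)
            have h2 : HasFDerivAt (fun x => ∑ i, χ i x) (0 : R2 →L[ℝ] ℝ) x := by
              refine (hasFDerivAt_const (1 : ℝ) x).congr_of_eventuallyEq ?_
              filter_upwards [hΩ.mem_nhds hx] with y hy using hone y hy
            have := congrArg (fun A : R2 →L[ℝ] ℝ => A (bv j)) (h1.unique h2)
            simpa [ContinuousLinearMap.sum_apply] using this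
          have e : dj j (fun x => ∑ i, χ i x • g i x) x - D j x
              = ∑ i, ((fderiv ℝ (χ i) x (bv j)) • (g i x - U x) + χ i x • (dj j (g i) x - D j x)) := by
            rw [dj, hd.fderiv]
            simp_rw [smul_sub]
            rw [Finset.sum_add_distrib, Finset.sum_add_distrib, Finset.sum_sub_distrib, Finset.sum_sub_distrib, ← Finset.sum_smul, ← Finset.sum_smul, h0, hone x hx]
            simp only [ContinuousLinearMap.sum_apply, ContinuousLinearMap.add_apply, ContinuousLinearMap.smul_apply,
              ContinuousLinearMap.smulRight_apply, Finset.sum_add_distrib, dj, zero_smul, one_smul]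
            ring
          rw [e]
          refine (enorm_sum_le _ _).trans (Finset.sum_le_sum fun i _ => (enorm_add_le _ _).trans (add_le_add ?_ ?_))
          · rw [enorm_smul]
            gcongr
            rw [← ofReal_norm]
            refine ENNReal.ofReal_le_ofReal (((fderiv ℝ (χ i) x).le_opNorm _).trans ?_)
            rw [norm_bv, mul_one]
            exact hBb i x (subset_closure hx)
          · by_cases hxO : x ∈ O i
            · rw [indicator_of_mem hxO, enorm_smul]
              exact mul_le_of_le_one_left' (χe i x)
            · rw [χO i x hxO]; simp
      _ = ∑ i, ∫⁻ x in Ω, (ENNReal.ofReal B * ‖g i x - U x‖ₑ + (O i).indicator (fun x => ‖dj j (g i) x - D j x‖ₑ) x) := by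
          refine lintegral_finsetSum _ fun i _ => ?_
          exact ((m1 i).const_mul _).add ((m2 i j).indicator (hO i (hT i i.2)).measurableSet)
      _ ≤ η := by
          refine hsum _ fun i => ?_
          rw [lintegral_add_left ((m1 i).const_mul _), lintegral_const_mul _ (m1 i), setLIntegral_indicator (hO i (hT i i.2)).measurableSet,
            add_mul, one_mul, inter_comm]
          exact add_le_add (mul_le_mul_right (gU i) _) (gD i j)

end Part21

section Part22

lemma mk_eq (a b : ℝ) : (⟨a, b⟩ : ℂ) = (a : ℂ) + (b : ℂ) * Complex.I := by
  apply Complex.ext <;> simp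

lemma measurable_om {U : R2 → ℂ} {D : Fin 2 → R2 → ℂ} (hU : Measurable U) (hD : ∀ j, Measurable (D j)) :
    Measurable (om U D) := by
  have h : ∀ j, Measurable fun x => (((starRingEnd ℂ (U x)) * D j x).im : ℂ) := fun j =>
    Complex.measurable_ofReal.comp (Complex.measurable_im.comp ((Complex.continuous_conj.measurable.comp hU).mul (hD j)))
  have e : om U D = fun x => (((starRingEnd ℂ (U x)) * D 0 x).im : ℂ) + (((starRingEnd ℂ (U x)) * D 1 x).im : ℂ) * Complex.I := by
    funext x; exact mk_eq _ _
  rw [e]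
  exact (h 0).add ((h 1).mul_const _)

lemma norm_om_le {U : R2 → ℂ} {D : Fin 2 → R2 → ℂ} {x : R2} (h1 : ‖U x‖ = 1) : ‖om U D x‖ ≤ ‖D 0 x‖ + ‖D 1 x‖ := by
  have h : ∀ j, |((starRingEnd ℂ (U x)) * D j x).im| ≤ ‖D j x‖ := fun j => by
    refine (Complex.abs_im_le_norm _).trans ?_
    rw [norm_mul, RCLike.norm_conj, h1, one_mul]
  have := Complex.norm_le_abs_re_add_abs_im (om U D x)
  exact this.trans (add_le_add (h 0) (h 1))

lemma core {Ω : Set R2} (hΩ : IsOpen Ω) (hb : Bornology.IsBounded Ω) (hl : HasLipschitzBoundary Ω)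
    {U : R2 → ℂ} {D : Fin 2 → R2 → ℂ}
    (hUm : Measurable U) (hDm : ∀ j, Measurable (D j))
    (hU : IntegrableOn U Ω) (hD : ∀ j, IntegrableOn (D j) Ω)
    (hU1 : ∀ᵐ x ∂volume.restrict Ω, ‖U x‖ = 1)
    (hw : ∀ φ : R2 → ℝ, ContDiff ℝ (⊤ : ℕ∞) φ → HasCompactSupport φ → tsupport φ ⊆ Ω → ∀ j,
      ∫ x in Ω, (fderiv ℝ φ x (bv j)) • U x = - ∫ x in Ω, φ x • D j x)
    {κ : ℝ≥0∞} (hκ : ∀ φ : R2 → ℝ, LipschitzWith 2 φ → (∀ x, |φ x| ≤ 1) → (∀ x ∉ Ω, φ x = 0) →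
      ENNReal.ofReal (Jp Ω (om U D) φ) ≤ κ) : Ok Ω U (om U D) κ := by
  have hom : IntegrableOn (om U D) Ω := by
    refine Integrable.mono' ((hD 0).norm.add (hD 1).norm) (measurable_om hUm hDm).aestronglyMeasurable ?_
    filter_upwards [hU1] with x hx using norm_om_le hx
  rw [← add_zero κ]
  refine Ok_transfer hUm (measurable_om hUm hDm) fun η hη => ?_
  set e : ℝ≥0∞ := min η 1 with he
  have he0 : e ≠ 0 := (lt_min hη one_pos).ne'
  have het : e ≠ ⊤ := ne_top_of_le_ne_top ENNReal.one_ne_top (min_le_right _ _)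
  have heη : e ≤ η := min_le_left _ _
  have he8 : e / 8 ≠ 0 := (ENNReal.div_pos he0 (by norm_num)).ne'
  obtain ⟨f, fs, fi, fU, fW⟩ := choose_y hb hUm hDm hU1 hD (density hΩ hb hl hUm hDm hU hD hw) he8
  have hfin := finite_zeros fs hb.isCompact_closure fi
  obtain ⟨S, g, gs, g0, -, hinj, gU, gW⟩ := struct_zeros hΩ _ hfin.toFinset rfl f fs
    (fun x hx => by simp [hx]) (fun x hx => by simpa using (hfin.mem_toFinset.1 hx).2)
    (fun p hp => fi p (hfin.mem_toFinset.1 hp).2) (e / 8) he8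
  have gs2 : ContDiff ℝ 2 g := gs.of_le (WithTop.coe_le_coe.2 le_top)
  obtain ⟨κ', hOk, hκ'⟩ := Ok_gvp hΩ hb gs2 g0 hinj
  set v : R2 → ℂ := fun y => g y * vp S y with hv
  have hv0 : Measurable v := gs.continuous.measurable.mul (contDiff_vp S (n := 1)).continuous.measurable
  have hvm : Measurable (nz v) := measurable_nz hv0
  have hWi : IntegrableOn (W v) Ω := integrableOn_W_gvp hΩ hb gs2 g0 S
  have tri : ∀ a b d : R2 → ℂ, AEMeasurable (fun x => ‖a x - b x‖ₑ) (volume.restrict Ω) → ∫⁻ x in Ω, ‖a x - b x‖ₑ ≤ e / 8 →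
      ∫⁻ x in Ω, ‖b x - d x‖ₑ ≤ e / 8 → ∫⁻ x in Ω, ‖a x - d x‖ₑ ≤ e / 4 := by
    intro a b d hm h1 h2
    calc ∫⁻ x in Ω, ‖a x - d x‖ₑ ≤ ∫⁻ x in Ω, (‖a x - b x‖ₑ + ‖b x - d x‖ₑ) := by
          refine lintegral_mono fun x => ?_
          have : a x - d x = (a x - b x) + (b x - d x) := by ring
          rw [this]; exact enorm_add_le _ _
      _ = (∫⁻ x in Ω, ‖a x - b x‖ₑ) + ∫⁻ x in Ω, ‖b x - d x‖ₑ := lintegral_add_left' hm _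
      _ ≤ e / 8 + e / 8 := add_le_add h1 h2
      _ = e / 4 := by
          rw [← two_mul, ← mul_div_assoc]
          rw [ENNReal.div_eq_div_iff (by norm_num) (by norm_num) (by norm_num) (by norm_num)]
          ring
  have hfm : Measurable (nz f) := measurable_nz fs.continuous.measurable
  have q1 : ∫⁻ x in Ω, ‖nz v x - U x‖ₑ ≤ e / 4 := tri _ _ _ ((hvm.sub hfm).enorm.aemeasurable) gU fU
  have q2 : ∫⁻ x in Ω, ‖W v x - om U D x‖ₑ ≤ e / 4 := by
    refine tri _ _ _ ?_ gW fW
    exact ((measurable_W hv0).sub (measurable_W fs.continuous.measurable)).enorm.aemeasurable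
  have he4 : e / 4 ≤ η := (ENNReal.div_le_of_le_mul (by simpa using le_mul_of_one_le_right' (by norm_num))).trans heη
  refine ⟨nz v, W v, hvm, q1.trans he4, by rw [zero_add]; exact q2.trans he4, ?_⟩
  have hκb : ENNReal.ofReal κ' ≤ κ + η := by
    have ht : 0 < e.toReal / 2 := half_pos (ENNReal.toReal_pos he0 het)
    obtain ⟨φ, p1, p2, p3, p4⟩ := hκ' _ ht
    have hd := Jp_diff hWi hom p1
    have hIntg : ∫ x in Ω, ‖W v x - om U D x‖ ≤ (e / 4).toReal := by
      have hae : AEStronglyMeasurable (fun x => W v x - om U D x) (volume.restrict Ω) := (hWi.sub hom).aestronglyMeasurable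
      rw [integral_norm_eq_lintegral_enorm hae]
      exact ENNReal.toReal_mono (ENNReal.div_ne_top het (by norm_num)) q2
    rw [ENNReal.toReal_div] at hIntg
    have h4 : (4 : ℝ≥0∞).toReal = 4 := by simp
    rw [h4] at hIntg
    have h5 := (abs_le.1 hd).2
    have : κ' ≤ Jp Ω (om U D) φ + e.toReal := by
      have : ((2 : ℝ≥0) : ℝ) = 2 := rfl
      rw [this] at h5
      linarith
    calc ENNReal.ofReal κ' ≤ ENNReal.ofReal (Jp Ω (om U D) φ + e.toReal) := ENNReal.ofReal_le_ofReal this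
      _ ≤ ENNReal.ofReal (Jp Ω (om U D) φ) + ENNReal.ofReal e.toReal := ENNReal.ofReal_add_le
      _ ≤ κ + η := by
          rw [ENNReal.ofReal_toReal het]
          exact add_le_add (hκ φ p1 p2 p3) heη
  intro η' hη'
  obtain ⟨w, w1, w2, w3, w4⟩ := hOk η' hη'
  exact ⟨w, w1, w2, w3, w4.trans (by gcongr)⟩

end Part22

section Part23

lemma weak_cx {Ω : Set R2} {u : R2 → R2} {G : R2 → Matrix (Fin 2) (Fin 2) ℝ} (hu : MemW11 Ω u G)
    {U : R2 → ℂ} {D : Fin 2 → R2 → ℂ}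
    (hU : IntegrableOn U Ω) (hD : ∀ j, IntegrableOn (D j) Ω)
    (eU : ∀ᵐ x ∂volume.restrict Ω, U x = cx (u x))
    (eD : ∀ j, ∀ᵐ x ∂volume.restrict Ω, D j x = ⟨G x 0 j, G x 1 j⟩)
    (φ : R2 → ℝ) (hφ : ContDiff ℝ (⊤ : ℕ∞) φ) (hs : HasCompactSupport φ) (ht : tsupport φ ⊆ Ω) (j : Fin 2) :
      ∫ x in Ω, (fderiv ℝ φ x (bv j)) • U x = - ∫ x in Ω, φ x • D j x := by
  have hw := hu.2.2 φ hφ hs ht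
  have c1 : Continuous fun x => fderiv ℝ φ x (bv j) := (hφ.continuous_fderiv (by simp)).clm_apply continuous_const
  obtain ⟨C, hC⟩ := hs.exists_bound_of_continuous hφ.continuous
  obtain ⟨C', hC'⟩ := (hs.fderiv ℝ).exists_bound_of_continuous (hφ.continuous_fderiv (by simp))
  have i1 : Integrable (fun x => (fderiv ℝ φ x (bv j)) • U x) (volume.restrict Ω) := by
    refine Integrable.bdd_smul hU C' c1.aestronglyMeasurable (Filter.Eventually.of_forall fun x => ?_)
    refine ((fderiv ℝ φ x).le_opNorm _).trans ?_
    rw [norm_bv, mul_one]; exact hC' x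
  have i2 : Integrable (fun x => φ x • D j x) (volume.restrict Ω) :=
    Integrable.bdd_smul (hD j) C hφ.continuous.aestronglyMeasurable (Filter.Eventually.of_forall hC)
  apply Complex.ext
  · have a1 := Complex.reCLM.integral_comp_comm i1
    have a2 := Complex.reCLM.integral_comp_comm i2
    rw [Complex.neg_re]
    refine Eq.trans a1.symm (Eq.trans ?_ (congrArg Neg.neg a2))
    refine Eq.trans ?_ (Eq.trans (hw 0 j) (congrArg Neg.neg ?_))
    · refine integral_congr_ae ?_
      filter_upwards [eU] with x hx
      simp only [Complex.reCLM_apply, Complex.smul_re, hx, cx_re, smul_eq_mul]; ring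
    · refine integral_congr_ae ?_
      filter_upwards [eD j] with x hx
      simp only [Complex.reCLM_apply, Complex.smul_re, hx, smul_eq_mul]; ring
  · have a1 := Complex.imCLM.integral_comp_comm i1
    have a2 := Complex.imCLM.integral_comp_comm i2
    rw [Complex.neg_im]
    refine Eq.trans a1.symm (Eq.trans ?_ (congrArg Neg.neg a2))
    refine Eq.trans ?_ (Eq.trans (hw 1 j) (congrArg Neg.neg ?_))
    · refine integral_congr_ae ?_
      filter_upwards [eU] with x hx
      simp only [Complex.imCLM_apply, Complex.smul_im, hx, cx_im, smul_eq_mul]; ring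
    · refine integral_congr_ae ?_
      filter_upwards [eD j] with x hx
      simp only [Complex.imCLM_apply, Complex.smul_im, hx, smul_eq_mul]; ring

lemma Jp_le_lip {Ω : Set R2} (hΩ : IsOpen Ω) {w : R2 → ℂ} (hw : IntegrableOn w Ω) {φ : R2 → ℝ}
    (hφ : LipschitzOnWith 2 φ (closure Ω)) : Jp Ω w φ ≤ ∫ x in Ω, 2 * ‖w x‖ := by
  refine (le_abs_self _).trans ?_
  rw [← Real.norm_eq_abs, Jp]
  refine norm_integral_le_of_norm_le (hw.norm.const_mul 2) ?_
  refine (ae_restrict_mem hΩ.measurableSet).mono fun x hx => ?_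
  have h1 : ‖fderiv ℝ φ x‖ ≤ ((2 : ℝ≥0) : ℝ) :=
    norm_fderiv_le_of_lipschitzOn ℝ (Filter.mem_of_superset (hΩ.mem_nhds hx) subset_closure) hφ
  have h2 : ∀ j, |fderiv ℝ φ x (bv j)| ≤ 2 := fun j => by
    have := (fderiv ℝ φ x).le_opNorm (bv j)
    rw [norm_bv, mul_one] at this
    exact this.trans h1
  have r := Complex.abs_re_le_norm (w x)
  have i := Complex.abs_im_le_norm (w x)
  have p1 : |(w x).re * fderiv ℝ φ x (bv 1)| ≤ ‖w x‖ * 2 := by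
    rw [abs_mul]; exact mul_le_mul r (h2 1) (abs_nonneg _) (norm_nonneg _)
  have p2 : |(w x).im * fderiv ℝ φ x (bv 0)| ≤ ‖w x‖ * 2 := by
    rw [abs_mul]; exact mul_le_mul i (h2 0) (abs_nonneg _) (norm_nonneg _)
  have p3 := abs_sub ((w x).re * fderiv ℝ φ x (bv 1)) ((w x).im * fderiv ℝ φ x (bv 0))
  rw [Real.norm_eq_abs, abs_mul, abs_of_pos (by norm_num : (0 : ℝ) < 1 / 2)]
  linarith

lemma final_aux (Ω : Set R2) (hΩ : IsOpen Ω) (hb : Bornology.IsBounded Ω)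
    (hl : HasLipschitzBoundary Ω)
    (u : R2 → R2) (G : R2 → Matrix (Fin 2) (Fin 2) ℝ)
    (hu : MemW11 Ω u G) (hS : SphereValued Ω u) :
    relaxedArea u Ω < ⊤ ∧
    relaxedArea u Ω ≤
      ENNReal.ofReal (∫ x in Ω, Real.sqrt (1 + ∑ i, ∑ j, (G x i j) ^ 2)) +
        flatNorm Ω 2 (detPairing Ω u G) := by
  have hm := hΩ.measurableSet
  haveI : IsFiniteMeasure (volume.restrict Ω) := ⟨by rw [Measure.restrict_apply_univ]; exact hb.measure_lt_top⟩
  have iU0 : IntegrableOn (fun x => cx (u x)) Ω := cx.toContinuousLinearEquiv.toContinuousLinearMap.integrable_comp hu.1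
  have iD0 : ∀ j, IntegrableOn (fun x => (⟨G x 0 j, G x 1 j⟩ : ℂ)) Ω := fun j => by
    simp_rw [mk_eq]
    exact (hu.2.1 0 j).ofReal.add ((hu.2.1 1 j).ofReal.mul_const _)
  set U : R2 → ℂ := iU0.aestronglyMeasurable.mk _ with hUd
  set D : Fin 2 → R2 → ℂ := fun j => (iD0 j).aestronglyMeasurable.mk _ with hDd
  have hUm : Measurable U := iU0.aestronglyMeasurable.stronglyMeasurable_mk.measurable
  have hDm : ∀ j, Measurable (D j) := fun j => (iD0 j).aestronglyMeasurable.stronglyMeasurable_mk.measurable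
  have eU : ∀ᵐ x ∂volume.restrict Ω, U x = cx (u x) := iU0.aestronglyMeasurable.ae_eq_mk.symm
  have eD : ∀ j, ∀ᵐ x ∂volume.restrict Ω, D j x = ⟨G x 0 j, G x 1 j⟩ := fun j => (iD0 j).aestronglyMeasurable.ae_eq_mk.symm
  have hU : IntegrableOn U Ω := Integrable.congr iU0 iU0.aestronglyMeasurable.ae_eq_mk
  have hD : ∀ j, IntegrableOn (D j) Ω := fun j => Integrable.congr (iD0 j) (iD0 j).aestronglyMeasurable.ae_eq_mk
  have hU1 : ∀ᵐ x ∂volume.restrict Ω, ‖U x‖ = 1 := by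
    filter_upwards [eU, hS] with x h1 h2
    rw [h1, LinearIsometryEquiv.norm_map, h2]
  have eom : ∀ᵐ x ∂volume.restrict Ω, (om U D x).re = u x 0 * G x 1 0 - u x 1 * G x 0 0 ∧
      (om U D x).im = u x 0 * G x 1 1 - u x 1 * G x 0 1 := by
    filter_upwards [eU, eD 0, eD 1] with x h1 h2 h3
    constructor
    · simp only [om, h1, h2, Complex.mul_im, Complex.conj_re, Complex.conj_im, cx_re, cx_im]; ring
    · simp only [om, h1, h3, Complex.mul_im, Complex.conj_re, Complex.conj_im, cx_re, cx_im]; ring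
  have hdet : ∀ φ : R2 → ℝ, detPairing Ω u G φ = Jp Ω (om U D) φ := by
    intro φ
    rw [detPairing, Jp]
    refine integral_congr_ae ?_
    filter_upwards [eom] with x hx
    rw [hx.1, hx.2, Fin.sum_univ_two]
    simp only [lambdaVec, Matrix.cons_val_zero, Matrix.cons_val_one]
    ring
  have hom : IntegrableOn (om U D) Ω := by
    refine Integrable.mono' ((hD 0).norm.add (hD 1).norm) (measurable_om hUm hDm).aestronglyMeasurable ?_
    filter_upwards [hU1] with x hx using norm_om_le hx
  have hfl : flatNorm Ω 2 (detPairing Ω u G) < ⊤ := by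
    refine lt_of_le_of_lt (b := ENNReal.ofReal (∫ x in Ω, 2 * ‖om U D x‖)) ?_ ENNReal.ofReal_lt_top
    rw [flatNorm, flatNormOn]
    refine iSup₂_le fun φ hφ => ENNReal.ofReal_le_ofReal ?_
    rw [hdet]
    exact Jp_le_lip hΩ hom hφ.1
  have hOk : Ok Ω U (om U D) (flatNorm Ω 2 (detPairing Ω u G)) := by
    refine core hΩ hb hl hUm hDm hU hD hU1 (weak_cx hu hU hD eU eD) fun φ p1 p2 p3 => ?_
    rw [← hdet, flatNorm, flatNormOn]
    refine le_iSup₂_of_le φ ⟨p1.lipschitzOnWith, fun p hp => p3 p ?_, fun p _ => p2 p⟩ le_rfl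
    rw [hΩ.frontier_eq] at hp
    exact hp.2
  have hmain := relaxedArea_le_of_Ok hΩ hb hu.1 eU hOk
  have hGm : AEStronglyMeasurable (fun x => Real.sqrt (1 + ∑ i, ∑ j, (G x i j) ^ 2)) (volume.restrict Ω) := by
    have h0 : ∀ i j, AEMeasurable (fun x => (G x i j) ^ 2) (volume.restrict Ω) := fun i j =>
      (hu.2.1 i j).aestronglyMeasurable.aemeasurable.pow_const 2
    simp_rw [Fin.sum_univ_two]
    exact ((((h0 0 0).add (h0 0 1)).add ((h0 1 0).add (h0 1 1))).const_add 1).sqrt.aestronglyMeasurable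
  have hGi : Integrable (fun x => Real.sqrt (1 + ∑ i, ∑ j, (G x i j) ^ 2)) (volume.restrict Ω) := by
    refine Integrable.mono' (g := fun x => 1 + ((|G x 0 0| + |G x 0 1|) + (|G x 1 0| + |G x 1 1|))) ?_ hGm ?_
    · exact (integrable_const _).add (((hu.2.1 0 0).abs.add (hu.2.1 0 1).abs).add ((hu.2.1 1 0).abs.add (hu.2.1 1 1).abs))
    · refine Filter.Eventually.of_forall fun x => ?_
      rw [Real.norm_of_nonneg (Real.sqrt_nonneg _)]
      apply Real.sqrt_le_iff.2
      refine ⟨by positivity, ?_⟩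
      simp_rw [Fin.sum_univ_two]
      rw [← sq_abs (G x 0 0), ← sq_abs (G x 0 1), ← sq_abs (G x 1 0), ← sq_abs (G x 1 1)]
      have a := abs_nonneg (G x 0 0)
      have b := abs_nonneg (G x 0 1)
      have c := abs_nonneg (G x 1 0)
      have d := abs_nonneg (G x 1 1)
      generalize |G x 0 0| = A at *
      generalize |G x 0 1| = B at *
      generalize |G x 1 0| = C at *
      generalize |G x 1 1| = E at *
      have : 0 ≤ A * B := by positivity
      have : 0 ≤ A * C := by positivity
      have : 0 ≤ A * E := by positivity
      have : 0 ≤ B * C := by positivity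
      have : 0 ≤ B * E := by positivity
      have : 0 ≤ C * E := by positivity
      nlinarith
  have hle : ∫⁻ x in Ω, ENNReal.ofReal (Real.sqrt (1 + ‖om U D x‖ ^ 2)) ≤
      ENNReal.ofReal (∫ x in Ω, Real.sqrt (1 + ∑ i, ∑ j, (G x i j) ^ 2)) := by
    rw [ofReal_integral_eq_lintegral_ofReal hGi (Filter.Eventually.of_forall fun x => Real.sqrt_nonneg _)]
    refine lintegral_mono_ae ?_
    filter_upwards [eom, hS] with x hx h1
    refine ENNReal.ofReal_le_ofReal (Real.sqrt_le_sqrt ?_)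
    have hn : u x 0 ^ 2 + u x 1 ^ 2 = 1 := by
      have := EuclideanSpace.norm_sq_eq (u x)
      rw [h1, Fin.sum_univ_two, Real.norm_eq_abs, Real.norm_eq_abs, sq_abs, sq_abs] at this
      linarith
    have hCS : ∀ a b s t : ℝ, a ^ 2 + b ^ 2 = 1 → (a * t - b * s) ^ 2 ≤ s ^ 2 + t ^ 2 := by
      intro a b s t h
      have : (a * t - b * s) ^ 2 + (a * s + b * t) ^ 2 = (a ^ 2 + b ^ 2) * (s ^ 2 + t ^ 2) := by ring
      rw [h] at this
      have := sq_nonneg (a * s + b * t)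
      linarith
    rw [← Complex.normSq_eq_norm_sq, Complex.normSq_apply, hx.1, hx.2]
    simp_rw [Fin.sum_univ_two]
    have q0 := hCS _ _ (G x 0 0) (G x 1 0) hn
    have q1 := hCS _ _ (G x 0 1) (G x 1 1) hn
    nlinarith
  have hfinal := hmain.trans (add_le_add_left hle _)
  exact ⟨hfinal.trans_lt (ENNReal.add_lt_top.2 ⟨ENNReal.ofReal_lt_top, hfl⟩), hfinal⟩

end Part23

/-- **Theorem 1.1.** For a bounded open connected Lipschitz set `Ω ⊂ ℝ²` and
`u ∈ W^{1,1}(Ω;S¹)`, the relaxed area is finite and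
`𝒜(u,Ω) ≤ ∫_Ω √(1+|∇u|²) dx + ‖Det(∇u)‖_{flat,α}`. -/
theorem relaxedArea_le_flat (Ω : Set R2) (hΩo : IsOpen Ω) (hΩb : Bornology.IsBounded Ω)
    (hΩc : IsConnected Ω) (hΩl : HasLipschitzBoundary Ω)
    (u : R2 → R2) (G : R2 → Matrix (Fin 2) (Fin 2) ℝ)
    (hu : MemW11 Ω u G) (hS : SphereValued Ω u) :
    relaxedArea u Ω < ⊤ ∧
    relaxedArea u Ω ≤
      ENNReal.ofReal (∫ x in Ω, Real.sqrt (1 + ∑ i, ∑ j, (G x i j) ^ 2)) +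
        flatNorm Ω 2 (detPairing Ω u G) := by
  exact final_aux Ω hΩo hΩb hΩl u G hu hS
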